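/- Let n ≥ 3 and let d > 2 be an odd composite square-free integer whose prime divisors are all ≡ ±3 (mod 8) or ≡ 9 (mod 16), with at least one prime divisor ≡ 3 (mod 8) and no prime divisor ≡ 5 (mod 8). With t = 4q + 2r as above (q = #{p | d : p ≡ 9 mod 16}, r = #{p | d : p ≡ 3 or 5 mod 8}), one has rank_2(Cl(Q(ζ_{2^n}, √d))) = t − 3 if some prime p ≡ 1 (mod 8) dividing d satisfies (2/p)_4 = −1, and rank_2(Cl(Q(ζ_{2^n}, √d))) = t − 2 otherwise. -/

import Mathlib

open NumberField IntermediateField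

/-- The 2-rank of the class group: dim_{F₂} Cl(K)/Cl(K)². -/
noncomputable def rank2 (K : Type*) [Field K] [NumberField K] : ℕ :=
  Nat.log 2 (Nat.card
    (ClassGroup (𝓞 K) ⧸ Subgroup.closure {x : ClassGroup (𝓞 K) | ∃ y, x = y ^ 2}))

open IsDedekindDomain nonZeroDivisors

/-- The norm `x ↦ x * σ x` attached to an endomorphism `σ` of a commutative group. -/
def twistedNorm {M : Type*} [CommGroup M] (σ : M →* M) : M →* M := MonoidHom.id M * σ

/-- The homomorphism `x ↦ x / σ x` attached to an endomorphism `σ` of a commutative group. -/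
def twistedDiv {M : Type*} [CommGroup M] (σ : M →* M) : M →* M := MonoidHom.id M / σ

/-- The subgroup of elements fixed by an endomorphism. -/
def fixedBy {M : Type*} [CommGroup M] (σ : M →* M) : Subgroup M := σ.eqLocus (MonoidHom.id M)

section Abstract

variable {M I : Type*} [CommGroup M] [CommGroup I]

@[simp] lemma twistedNorm_apply (σ : M →* M) (x : M) : twistedNorm σ x = x * σ x := rfl

@[simp] lemma twistedDiv_apply (σ : M →* M) (x : M) : twistedDiv σ x = x / σ x := rfl

@[simp] lemma mem_fixedBy (σ : M →* M) (x : M) : x ∈ fixedBy σ ↔ σ x = x := Iff.rfl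

lemma relIndex_eq_of_inf_eq {G : Type*} [Group G] {H H' S : Subgroup G}
    (h : ∀ x ∈ S, x ∈ H ↔ x ∈ H') : H.relIndex S = H'.relIndex S := by
  rw [← Subgroup.inf_relIndex_right H, ← Subgroup.inf_relIndex_right H']
  congr 1
  ext x
  simp only [Subgroup.mem_inf]
  constructor
  · rintro ⟨h1, h2⟩; exact ⟨(h x h2).1 h1, h2⟩
  · rintro ⟨h1, h2⟩; exact ⟨(h x h2).2 h1, h2⟩

/-- The square-torsion subgroup modulo `P`, as a subgroup of the ambient group. -/
def sqrtSubgroup (P : Subgroup I) : Subgroup I := P.comap (powMonoidHom 2)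

@[simp] lemma mem_sqrtSubgroup (P : Subgroup I) (J : I) : J ∈ sqrtSubgroup P ↔ J ^ 2 ∈ P :=
  Iff.rfl

/-- An abstract form of Chevalley's ambiguous class number formula for an action of a group of
order two on an exact sequence `1 → E → M → I`, when ideals of the base have odd order. -/
theorem ambiguous_class_formula (σ : M →* M) (τ : I →* I) (hσ : ∀ x, σ (σ x) = x)
    (hτ : ∀ J, τ (τ J) = J) (f : M →* I) (hf : ∀ x, f (σ x) = τ (f x))
    (h90M : ∀ x, x * σ x = 1 → ∃ y, x = y / σ y)
    (h90I : ∀ J, J * τ J = 1 → ∃ y, J = y / τ y)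
    (IK : Subgroup I) (hIK : ∀ J ∈ IK, τ J = J) (hN : ∀ J, J * τ J ∈ IK)
    (h : ℕ) (hodd : Odd h) (hpow : ∀ J ∈ IK, ∃ x, σ x = x ∧ f x = J ^ h)
    (hfix : ∀ x, σ x = x → f x ∈ IK) :
    f.range.relIndex (sqrtSubgroup f.range) *
        (f.ker.map (twistedDiv σ)).relIndex (f.ker ⊓ (twistedNorm σ).ker) =
      IK.relIndex (fixedBy τ) *
        (f.ker.map (twistedNorm σ)).relIndex (f.ker ⊓ (twistedNorm σ).range) := by
  set P := f.range with hP
  set E := f.ker with hE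
  set B := fixedBy τ with hB
  have hPτ : ∀ J ∈ P, τ J ∈ P := by
    rintro _ ⟨x, rfl⟩; exact ⟨σ x, hf x⟩
  have hIKB : IK ≤ B := hIK
  let Y : Subgroup I := P.comap (twistedDiv τ)
  have hY : ∀ J, J ∈ Y ↔ J / τ J ∈ P := fun J => Iff.rfl
  have hBP : B ⊔ P ≤ Y := by
    refine sup_le ?_ ?_
    · intro J hJ
      rw [hY, (mem_fixedBy τ J).1 hJ, div_self']; exact one_mem _
    · intro J hJ
      rw [hY]; exact div_mem hJ (hPτ J hJ)
  -- `[Y : B P] = [E ∩ N M : N E]`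
  have relIndex_fixed : (B ⊔ P).relIndex Y = (E.map (twistedNorm σ)).relIndex
      (E ⊓ (twistedNorm σ).range) := by
    let S : Subgroup (I × M) :=
      MonoidHom.eqLocus (MonoidHom.fst I M) ((τ.comp (MonoidHom.fst I M)) *
        (f.comp (MonoidHom.snd I M)))
    have hS : ∀ p : I × M, p ∈ S ↔ p.1 = τ p.1 * f p.2 := fun p => Iff.rfl
    have e1 : Y = S.map (MonoidHom.fst I M) := by
      ext J
      constructor
      · rintro ⟨x, hx⟩
        refine ⟨(J, x), ?_, rfl⟩
        have hx' : f x = J / τ J := hx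
        change J = τ J * f x
        rw [hx']; simp
      · rintro ⟨⟨J', x⟩, hp, rfl⟩
        refine ⟨x, ?_⟩
        have := (hS _).1 hp
        simp only at this
        change f x = J' / τ J'
        rw [eq_div_iff_mul_eq', mul_comm, ← this]
    have e2 : E ⊓ (twistedNorm σ).range =
        S.map ((twistedNorm σ).comp (MonoidHom.snd I M)) := by
      ext x
      constructor
      · rintro ⟨hx, ⟨y, rfl⟩⟩
        have : f y * τ (f y) = 1 := by
          rw [← hf, ← map_mul]; exact hx
        obtain ⟨J, hJ⟩ := h90I _ this
        refine ⟨(J, y), ?_, rfl⟩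
        change J = τ J * f y
        rw [hJ]; simp
      · rintro ⟨⟨J, y⟩, hp, rfl⟩
        refine ⟨?_, ⟨y, rfl⟩⟩
        have h1 : J = τ J * f y := hp
        have h2 : f y = J / τ J := by rw [eq_div_iff_mul_eq', mul_comm, ← h1]
        change f (y * σ y) = 1
        rw [map_mul, hf, h2, map_div, hτ]; simp
    rw [e1, e2, ← Subgroup.relIndex_comap, ← Subgroup.relIndex_comap]
    apply relIndex_eq_of_inf_eq
    rintro ⟨J, y⟩ hp
    have h1 : J = τ J * f y := hp
    have h2 : f y = J / τ J := by rw [eq_div_iff_mul_eq', mul_comm, ← h1]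
    constructor
    · intro hJ
      obtain ⟨b, hb, c, ⟨β, rfl⟩, hbc⟩ := Subgroup.mem_sup.1 hJ
      have hb' : τ b = b := hb
      have hbc' : b * f β = J := hbc
      refine ⟨y / (β / σ β), ?_, ?_⟩
      · change f _ = 1
        rw [map_div, h2, ← hbc', map_div, hf, map_mul, hb', mul_div_mul_left_eq_div, div_self']
      · change y / (β / σ β) * σ (y / (β / σ β)) = y * σ y
        rw [map_div, map_div, hσ]
        rw [div_mul_div_comm, div_mul_div_cancel, div_self', div_one]
    · rintro ⟨e, he, hey⟩
      have he' : f e = 1 := he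
      have hey' : e * σ e = y * σ y := hey
      obtain ⟨β, hβ⟩ := h90M (y / e) (by
        rw [map_div, div_mul_div_comm, hey', div_self'])
      refine Subgroup.mem_sup.2 ⟨J / f β, ?_, f β, ⟨β, rfl⟩, by simp⟩
      have h3 : f y = f β / τ (f β) := by
        have := congrArg f hβ
        rwa [map_div, he', div_one, map_div, hf] at this
      change τ (J / f β) = J / f β
      rw [map_div, div_eq_div_iff_mul_eq_mul, ]
      rw [h2] at h3
      rw [div_eq_div_iff_mul_eq_mul] at h3
      rw [h3, mul_comm]
  -- `[B P : I_K P] [B ∩ I_K P : I_K] = [B : I_K]`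
  have relIndex_base : (IK ⊔ P).relIndex (B ⊔ P) * IK.relIndex (B ⊓ (IK ⊔ P)) = IK.relIndex B := by
    have h1 : (IK ⊔ P).relIndex (B ⊔ P) = (B ⊓ (IK ⊔ P)).relIndex B := by
      have : B ⊔ P = B ⊔ (IK ⊔ P) := by
        rw [← sup_assoc, sup_eq_left.2 hIKB]
      rw [this, Subgroup.relIndex_sup_right, Subgroup.inf_relIndex_left]
    rw [h1, mul_comm]
    exact Subgroup.relIndex_mul_relIndex _ _ _ (le_inf hIKB le_sup_left) inf_le_left
  -- elements whose divisor comes from the base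
  have key : ∀ x, f x ∈ IK → ∃ a e, σ a = a ∧ f e = 1 ∧ x = a * e := by
    intro x hx
    obtain ⟨a, ha, hfa⟩ := hpow _ hx
    obtain ⟨k, rfl⟩ := hodd
    have hfx : τ (f x) = f x := hIK _ hx
    refine ⟨a / (x * σ x) ^ k, x * (x * σ x) ^ k / a, ?_, ?_, ?_⟩
    · rw [map_div, ha, map_pow, map_mul, hσ, mul_comm (σ x)]
    · rw [map_div, hfa, map_mul, map_pow, map_mul, hf, hfx, ← pow_two, ← pow_mul, ← pow_succ',
        div_self']
    · rw [div_mul_div_comm, eq_div_iff_mul_eq']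
      simp only [mul_comm, mul_left_comm]
  have relIndex_inf : IK.relIndex (B ⊓ (IK ⊔ P)) = (E.map (twistedDiv σ)).relIndex
      (E ⊓ (twistedNorm σ).ker) := by
    let X : Subgroup M := B.comap f
    have e1 : E ⊓ (twistedNorm σ).ker = X.map (twistedDiv σ) := by
      ext x
      constructor
      · rintro ⟨hx, hx'⟩
        obtain ⟨y, rfl⟩ := h90M x hx'
        refine ⟨y, ?_, rfl⟩
        have : f (y / σ y) = 1 := hx
        rw [map_div, div_eq_one, hf] at this
        exact this.symm
      · rintro ⟨y, hy, rfl⟩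
        have hy' : τ (f y) = f y := hy
        refine ⟨?_, ?_⟩
        · change f (y / σ y) = 1
          rw [map_div, hf, hy', div_self']
        · change y / σ y * σ (y / σ y) = 1
          rw [map_div, hσ]; simp
    have e2 : B ⊓ (IK ⊔ P) = IK ⊔ X.map f := by
      ext J
      constructor
      · rintro ⟨hJ, hJ'⟩
        obtain ⟨b, hb, c, ⟨β, rfl⟩, rfl⟩ := Subgroup.mem_sup.1 hJ'
        refine Subgroup.mem_sup.2 ⟨b, hb, f β, ⟨β, ?_, rfl⟩, rfl⟩
        have h1 : τ (b * f β) = b * f β := hJ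
        rw [map_mul, hIK b hb] at h1
        exact mul_left_cancel h1
      · intro hJ
        obtain ⟨b, hb, c, ⟨β, hβ, rfl⟩, rfl⟩ := Subgroup.mem_sup.1 hJ
        refine ⟨mul_mem (hIKB hb) hβ, mul_mem (Subgroup.mem_sup_left hb)
          (Subgroup.mem_sup_right ⟨β, rfl⟩)⟩
    rw [e1, e2, Subgroup.relIndex_sup_left, ← Subgroup.relIndex_comap, ← Subgroup.relIndex_comap]
    apply relIndex_eq_of_inf_eq
    intro x _
    constructor
    · intro hx
      obtain ⟨a, e, ha, he, rfl⟩ := key x hx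
      refine ⟨e, he, ?_⟩
      simp [ha]
    · rintro ⟨e, he, hex⟩
      have hex' : e / σ e = x / σ x := hex
      have he' : f e = 1 := he
      have : f x = f (x / e) := by rw [map_div, he', div_one]
      change f x ∈ IK
      rw [this]
      apply hfix
      rw [map_div, div_eq_div_iff_mul_eq_mul]
      rw [div_eq_div_iff_mul_eq_mul] at hex'
      rw [mul_comm, hex', mul_comm]
  have relIndex_sqrt : P.relIndex (sqrtSubgroup P) = (IK ⊔ P).relIndex Y := by
    set Z := sqrtSubgroup P
    have hPY : IK ⊔ P ≤ Y := (sup_le_sup_right hIKB P).trans hBP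
    have hZ : Y = Z ⊔ (IK ⊔ P) := by
      apply le_antisymm
      · intro J hJ
        obtain ⟨k, rfl⟩ := hodd
        have h1 : J ^ 2 ∈ IK ⊔ P := by
          have : J ^ 2 = (J * τ J) * (J / τ J) := by
            rw [pow_two, mul_mul_div_cancel]
          rw [this]
          exact mul_mem (Subgroup.mem_sup_left (hN J)) (Subgroup.mem_sup_right hJ)
        have h2 : ∀ J ∈ IK ⊔ P, J ^ (2 * k + 1) ∈ P := by
          intro J hJ
          obtain ⟨b, hb, c, hc, rfl⟩ := Subgroup.mem_sup.1 hJ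
          rw [mul_pow]
          obtain ⟨x, -, hx⟩ := hpow b hb
          exact mul_mem ⟨x, hx⟩ (pow_mem hc _)
        refine Subgroup.mem_sup.2 ⟨J ^ (2 * k + 1), ?_, (J ^ 2)⁻¹ ^ k, pow_mem (inv_mem h1) k, ?_⟩
        · rw [mem_sqrtSubgroup, ← pow_mul, mul_comm, pow_mul]
          exact h2 _ h1
        · rw [pow_succ, pow_mul, inv_pow]; simp
      · refine sup_le ?_ hPY
        intro J hJ
        have h1 : J ^ 2 ∈ P := hJ
        rw [hY]
        obtain ⟨k, rfl⟩ := hodd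
        have h3 : (J * τ J) ^ (2 * k + 1) ∈ P := by
          obtain ⟨x, -, hx⟩ := hpow _ (hN J)
          exact ⟨x, hx⟩
        have h4 : (J / τ J) ^ (2 * k + 1) ∈ P := by
          have : (J / τ J) ^ (2 * k + 1) = (J * τ J) ^ (2 * k + 1) /
              (τ (J ^ 2)) ^ (2 * k + 1) := by
            rw [← div_pow]; congr 1
            rw [map_pow, pow_two, mul_div_mul_right_eq_div]
          rw [this]
          exact div_mem h3 (pow_mem (hPτ _ h1) _)
        have h5 : (J / τ J) ^ 2 ∈ P := by
          rw [div_pow, ← map_pow]; exact div_mem h1 (hPτ _ h1)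
        have : J / τ J = (J / τ J) ^ (2 * k + 1) / ((J / τ J) ^ 2) ^ k := by
          rw [← pow_mul, pow_succ]; simp
        rw [this]
        exact div_mem h4 (pow_mem h5 _)
    rw [hZ, Subgroup.relIndex_sup_right]
    apply relIndex_eq_of_inf_eq
    intro J hJ
    refine ⟨fun h => Subgroup.mem_sup_right h, fun h' => ?_⟩
    have h1 : J ^ 2 ∈ P := hJ
    obtain ⟨k, rfl⟩ := hodd
    have h2 : J ^ (2 * k + 1) ∈ P := by
      obtain ⟨b, hb, c, hc, rfl⟩ := Subgroup.mem_sup.1 h'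
      rw [mul_pow]
      obtain ⟨x, -, hx⟩ := hpow b hb
      exact mul_mem ⟨x, hx⟩ (pow_mem hc _)
    have : J = J ^ (2 * k + 1) / (J ^ 2) ^ k := by rw [← pow_mul, pow_succ]; simp
    rw [this]
    exact div_mem h2 (pow_mem h1 _)
  rw [relIndex_sqrt, ← Subgroup.relIndex_mul_relIndex (IK ⊔ P) (B ⊔ P) Y
    (sup_le_sup_right hIKB P) hBP, relIndex_fixed, ← relIndex_inf, ← relIndex_base]
  ring

end Abstract

section TwoRank

/-- The count relating the index of the doubled subgroup to rank and two-torsion. -/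
def DoublingFormula (A : Type*) [AddCommGroup A] : Prop :=
  (nsmulAddMonoidHom 2 : A →+ A).range.index =
    2 ^ Module.finrank ℤ A * Nat.card (nsmulAddMonoidHom 2 : A →+ A).ker

lemma finrank_int_of_finite (A : Type*) [AddCommGroup A] [Finite A] : Module.finrank ℤ A = 0 := by
  rw [Module.finrank_eq_zero_iff_isTorsion]
  intro x
  refine ⟨⟨(addOrderOf x : ℤ), ?_⟩, ?_⟩
  · rw [mem_nonZeroDivisors_iff_ne_zero]
    exact_mod_cast (addOrderOf_pos x).ne'
  · change (addOrderOf x : ℤ) • x = 0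
    rw [natCast_zsmul, addOrderOf_nsmul_eq_zero]

lemma finrank_int_add_ker {A B : Type*} [AddCommGroup A] [AddCommGroup B] [Module.Finite ℤ A]
    (f : A →ₗ[ℤ] B) :
    Module.finrank ℤ f.range + Module.finrank ℤ f.ker = Module.finrank ℤ A := by
  rw [← f.quotKerEquivRange.finrank_eq]
  exact Submodule.finrank_quotient_add_finrank _

lemma DoublingFormula.congr {A B : Type*} [AddCommGroup A] [AddCommGroup B] (e : A ≃+ B)
    (hA : DoublingFormula A) : DoublingFormula B := by
  unfold DoublingFormula at *
  have h1 : (nsmulAddMonoidHom 2 : B →+ B).range =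
      (nsmulAddMonoidHom 2 : A →+ A).range.map (e : A →+ B) := by
    ext x
    constructor
    · rintro ⟨y, rfl⟩
      exact ⟨2 • e.symm y, ⟨_, rfl⟩, by simp⟩
    · rintro ⟨_, ⟨y, rfl⟩, rfl⟩
      exact ⟨e y, by simp⟩
  have h2 : Nat.card (nsmulAddMonoidHom 2 : A →+ A).ker =
      Nat.card (nsmulAddMonoidHom 2 : B →+ B).ker := by
    refine Nat.card_congr (e.toEquiv.subtypeEquiv fun a => ?_)
    change 2 • a = 0 ↔ 2 • e a = 0
    rw [← map_nsmul, EmbeddingLike.map_eq_zero_iff]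
  rw [h1, AddSubgroup.index_map_equiv, hA, h2, e.toIntLinearEquiv.finrank_eq]

lemma DoublingFormula.of_finite (A : Type*) [AddCommGroup A] [Finite A] : DoublingFormula A := by
  unfold DoublingFormula
  rw [finrank_int_of_finite, pow_zero, one_mul]
  have h1 := AddSubgroup.card_mul_index (nsmulAddMonoidHom 2 : A →+ A).range
  have h2 := AddSubgroup.card_mul_index (nsmulAddMonoidHom 2 : A →+ A).ker
  rw [AddSubgroup.index_ker, mul_comm] at h2
  exact Nat.eq_of_mul_eq_mul_left Nat.card_pos (h1.trans h2.symm)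

lemma DoublingFormula.prod {A B : Type*} [AddCommGroup A] [AddCommGroup B]
    [Module.Finite ℤ A] [Module.Finite ℤ B]
    (hA : DoublingFormula A) (hB : DoublingFormula B) : DoublingFormula (A × B) := by
  unfold DoublingFormula at *
  have h0 : (nsmulAddMonoidHom 2 : A × B →+ A × B) =
    (nsmulAddMonoidHom 2 : A →+ A).prodMap (nsmulAddMonoidHom 2 : B →+ B) := rfl
  have h3 : Module.finrank ℤ (A × B) = Module.finrank ℤ A + Module.finrank ℤ B := by
    rw [← finrank_int_add_ker (LinearMap.fst ℤ A B), LinearMap.range_eq_top.2 Prod.fst_surjective,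
      finrank_top, LinearMap.ker_fst,
      (LinearEquiv.ofInjective (LinearMap.inr ℤ A B) LinearMap.inr_injective).finrank_eq]
  rw [h0, AddMonoidHom.range_prodMap, AddSubgroup.index_prod, hA, hB, AddMonoidHom.ker_prodMap,
    Nat.card_congr (AddSubgroup.prodEquiv _ _).toEquiv, Nat.card_prod, h3]
  ring

lemma DoublingFormula.free (n : ℕ) : DoublingFormula (Fin n → ℤ) := by
  unfold DoublingFormula
  have h1 : (nsmulAddMonoidHom 2 : (Fin n → ℤ) →+ (Fin n → ℤ)).range =
      AddSubgroup.pi Set.univ fun _ => AddSubgroup.zmultiples (2 : ℤ) := by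
    ext x
    rw [AddSubgroup.mem_pi]
    simp only [AddSubgroup.mem_zmultiples_iff, AddMonoidHom.mem_range]
    constructor
    · rintro ⟨y, rfl⟩ i -
      exact ⟨y i, by simp [mul_comm]⟩
    · intro h
      choose y hy using fun i => h i (Set.mem_univ i)
      exact ⟨y, by ext i; simp [← hy i, mul_comm]⟩
  have h2 : (nsmulAddMonoidHom 2 : (Fin n → ℤ) →+ (Fin n → ℤ)).ker = ⊥ := by
    rw [AddMonoidHom.ker_eq_bot_iff]
    intro x y hxy
    exact smul_right_injective _ (two_ne_zero (α := ℕ)) hxy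
  rw [h1, h2, AddSubgroup.index_pi]
  simp

theorem doublingFormula (A : Type*) [AddCommGroup A] [Module.Finite ℤ A] : DoublingFormula A := by
  have : AddGroup.FG A := Module.Finite.iff_addGroup_fg.1 inferInstance
  obtain ⟨n, ι, _, p, hp, e, ⟨f⟩⟩ := AddCommGroup.equiv_free_prod_directSum_zmod A
  have : ∀ i, NeZero (p i ^ e i) := fun i => ⟨pow_ne_zero _ (hp i).ne_zero⟩
  have : Finite (DirectSum ι fun i => ZMod (p i ^ e i)) :=
    Finite.of_equiv _ (DirectSum.addEquivProd _).symm.toEquiv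
  exact (((DoublingFormula.free n).congr
    (Finsupp.linearEquivFunOnFinite ℤ ℤ (Fin n)).symm.toAddEquiv).prod (.of_finite _)).congr f.symm

end TwoRank

section Herbrand

variable {M : Type*} [CommGroup M]

lemma relIndex_map_pow_two (S : Subgroup M) [Module.Finite ℤ (Additive S)] (c : M) (hc : c ∈ S)
    (hc1 : c ≠ 1) (hc2 : c ^ 2 = 1) (htor : ∀ x ∈ S, x ^ 2 = 1 → x = 1 ∨ x = c) :
    (S.map (powMonoidHom 2)).relIndex S = 2 ^ (Module.finrank ℤ (Additive S) + 1) := by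
  have h := doublingFormula (Additive S)
  unfold DoublingFormula at h
  have h1 : Nat.card (nsmulAddMonoidHom 2 : Additive S →+ Additive S).ker = 2 := by
    rw [Nat.card_eq_two_iff]
    refine ⟨⟨Additive.ofMul 1, ?_⟩, ⟨Additive.ofMul ⟨c, hc⟩, ?_⟩, ?_, ?_⟩
    · exact (one_pow 2 : (1 : S) ^ 2 = 1)
    · change (⟨c, hc⟩ : S) ^ 2 = 1
      ext; exact hc2
    · intro h
      have h' : (1 : S) = ⟨c, hc⟩ := congrArg Subtype.val h
      exact hc1 (congrArg Subtype.val h').symm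
    · rw [Set.eq_univ_iff_forall]
      rintro ⟨x, hx⟩
      have hx' : (x.toMul : S) ^ 2 = 1 := hx
      have := htor x.toMul x.toMul.2 (by
        rw [← Subgroup.coe_pow, hx']; rfl)
      rcases this with h | h
      · left; apply Subtype.ext; apply Additive.toMul.injective; apply Subtype.ext; exact h
      · right; apply Subtype.ext; apply Additive.toMul.injective; apply Subtype.ext; exact h
  rw [h1, ← pow_succ] at h
  rw [← h]
  change ((S.map (powMonoidHom 2)).subgroupOf S).index =
    (AddSubgroup.toSubgroup' (nsmulAddMonoidHom 2 : Additive S →+ Additive S).range).index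
  congr 1
  ext x
  constructor
  · rintro ⟨y, hy, hyx⟩
    exact ⟨Additive.ofMul ⟨y, hy⟩, Subtype.ext hyx⟩
  · rintro ⟨y, hy⟩
    exact ⟨y.toMul, y.toMul.2, congrArg Subtype.val hy⟩

lemma relIndex_map_map_eq {G G' : Type*} [Group G] [Group G'] (f : G →* G') (H K : Subgroup G) :
    (H.map f).relIndex (K.map f) = (H ⊔ f.ker).relIndex K := by
  rw [← Subgroup.relIndex_comap, Subgroup.comap_map_eq]

/-- The Herbrand quotient of a group of units on which an involution acts. -/
theorem herbrand_units (σ : M →* M) (hσ : ∀ x, σ (σ x) = x) (E : Subgroup M)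
    (hE : ∀ x ∈ E, σ x ∈ E) (r : ℕ) [Module.Finite ℤ (Additive E)]
    [Module.Finite ℤ (Additive (E ⊓ fixedBy σ : Subgroup M))]
    (hrE : Module.finrank ℤ (Additive E) = 2 * r + 1)
    (hrK : Module.finrank ℤ (Additive (E ⊓ fixedBy σ : Subgroup M)) = r)
    (c : M) (hc : c ∈ E) (hcσ : σ c = c) (hc1 : c ≠ 1) (hc2 : c ^ 2 = 1)
    (htor : ∀ x ∈ E, x ^ 2 = 1 → x = 1 ∨ x = c) :
    (E.map (twistedDiv σ)).relIndex (E ⊓ (twistedNorm σ).ker) =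
      2 * (E.map (twistedNorm σ)).relIndex (E ⊓ fixedBy σ) ∧
    (E.map (twistedNorm σ)).relIndex (E ⊓ fixedBy σ) ≠ 0 := by
  set EK := E ⊓ fixedBy σ
  set Em := E ⊓ (twistedNorm σ).ker
  have hNE : ∀ x ∈ E, twistedNorm σ x ∈ EK := by
    intro x hx
    refine ⟨mul_mem hx (hE x hx), ?_⟩
    change σ (x * σ x) = x * σ x
    rw [map_mul, hσ, mul_comm]
  let Λ : Additive E →+ Additive EK := MonoidHom.toAdditive
    (((twistedNorm σ).comp E.subtype).codRestrict EK fun x => hNE x x.2)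
  have hfinEm : Module.Finite ℤ (Additive Em) := by
    let j : Additive Em →+ Additive E :=
      MonoidHom.toAdditive (Subgroup.inclusion (inf_le_left : Em ≤ E))
    exact Module.Finite.of_injective j.toIntLinearMap
      (Subgroup.inclusion_injective (inf_le_left : Em ≤ E))
  have hrm : Module.finrank ℤ (Additive Em) = r + 1 := by
    have h1 := finrank_int_add_ker Λ.toIntLinearMap
    have h2 : Module.finrank ℤ Λ.toIntLinearMap.ker = Module.finrank ℤ (Additive Em) := by
      let e : Λ.toIntLinearMap.ker →+ Additive Em :=
        { toFun := fun x => Additive.ofMul ⟨x.1.toMul.1, x.1.toMul.2,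
            congrArg (fun z : Additive EK => (z.toMul : M)) x.2⟩
          map_zero' := rfl
          map_add' := fun _ _ => rfl }
      have he : Function.Bijective e := by
        constructor
        · intro x y hxy
          have : (x.1.toMul : M) = y.1.toMul :=
            congrArg (fun z : Additive Em => (z.toMul : M)) hxy
          exact Subtype.ext (Additive.toMul.injective (Subtype.ext this))
        · intro y
          refine ⟨⟨Additive.ofMul ⟨y.toMul.1, y.toMul.2.1⟩, ?_⟩, rfl⟩
          have := y.toMul.2.2
          exact Additive.toMul.injective (Subtype.ext this)
      exact (AddEquiv.ofBijective e he).toIntLinearEquiv.finrank_eq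
    have h3 : Module.finrank ℤ Λ.toIntLinearMap.range = r := by
      apply le_antisymm
      · rw [← hrK]; exact Submodule.finrank_le _
      · let d : Additive EK →ₗ[ℤ] Additive EK := (nsmulAddMonoidHom 2).toIntLinearMap
        have h4 := finrank_int_add_ker d
        have h5 : Module.finrank ℤ d.ker = 0 := by
          rw [Module.finrank_eq_zero_iff_isTorsion]
          rintro ⟨x, hx⟩
          refine ⟨⟨2, by simp⟩, ?_⟩
          apply Subtype.ext
          change (2 : ℤ) • x = 0
          have : 2 • x = 0 := hx
          rw [← this]; norm_cast
        rw [h5, add_zero, hrK] at h4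
        rw [← h4]
        apply Submodule.finrank_mono
        rintro _ ⟨x, rfl⟩
        refine ⟨Additive.ofMul ⟨x.toMul.1, x.toMul.2.1⟩, ?_⟩
        apply Additive.toMul.injective; apply Subtype.ext
        change x.toMul.1 * σ x.toMul.1 = (x.toMul ^ 2 : EK)
        rw [x.toMul.2.2, Subgroup.coe_pow, pow_two]; rfl
    omega
  have hcK : c ∈ EK := ⟨hc, hcσ⟩
  have hcm : c ∈ Em := ⟨hc, by
    change c * σ c = 1
    rw [hcσ, ← pow_two, hc2]⟩
  have iK := relIndex_map_pow_two EK c hcK hc1 hc2 fun x hx => htor x hx.1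
  have im := relIndex_map_pow_two Em c hcm hc1 hc2 fun x hx => htor x hx.1
  have sK : EK.map (powMonoidHom 2) = EK.map (twistedNorm σ) := by
    ext x
    constructor
    · rintro ⟨y, hy, rfl⟩
      refine ⟨y, hy, ?_⟩
      have : σ y = y := hy.2
      simp [this, pow_two]
    · rintro ⟨y, hy, rfl⟩
      refine ⟨y, hy, ?_⟩
      have : σ y = y := hy.2
      simp [this, pow_two]
  have sm : Em.map (powMonoidHom 2) = Em.map (twistedDiv σ) := by
    have key : ∀ y ∈ Em, y ^ 2 = y / σ y := by
      intro y hy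
      have : y * σ y = 1 := hy.2
      rw [eq_div_iff_mul_eq', pow_two, mul_assoc, this, mul_one]
    ext x
    constructor
    · rintro ⟨y, hy, rfl⟩
      exact ⟨y, hy, (key y hy).symm⟩
    · rintro ⟨y, hy, rfl⟩
      exact ⟨y, hy, key y hy⟩
  rw [sK, hrK, ← Subgroup.relIndex_mul_relIndex (EK.map (twistedNorm σ)) (E.map (twistedNorm σ)) EK
    (Subgroup.map_mono inf_le_left) (by rintro _ ⟨x, hx, rfl⟩; exact hNE x hx),
    relIndex_map_map_eq] at iK
  rw [sm, hrm, ← Subgroup.relIndex_mul_relIndex (Em.map (twistedDiv σ)) (E.map (twistedDiv σ)) Em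
    (Subgroup.map_mono inf_le_left) (by
      rintro _ ⟨x, hx, rfl⟩
      refine ⟨(div_mem hx (hE x hx) : x / σ x ∈ E), ?_⟩
      change x / σ x * σ (x / σ x) = 1
      rw [map_div, hσ]; simp),
    relIndex_map_map_eq] at im
  have hmid : (EK ⊔ (twistedNorm σ).ker).relIndex E = (Em ⊔ (twistedDiv σ).ker).relIndex E := by
    have hker : ∀ x, x ∈ (twistedDiv σ).ker ↔ σ x = x := fun x => by
      rw [MonoidHom.mem_ker, twistedDiv_apply, div_eq_one, eq_comm]
    apply relIndex_eq_of_inf_eq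
    intro x hx
    constructor
    · intro h
      obtain ⟨a, ha, b, hb, rfl⟩ := Subgroup.mem_sup.1 h
      have hb' : b ∈ E := by simpa using div_mem hx ha.1
      exact Subgroup.mem_sup.2 ⟨b, ⟨hb', hb⟩, a, (hker a).2 ha.2, mul_comm _ _⟩
    · intro h
      obtain ⟨a, ha, b, hb, rfl⟩ := Subgroup.mem_sup.1 h
      have hb' : b ∈ E := by simpa using div_mem hx ha.1
      exact Subgroup.mem_sup.2 ⟨b, ⟨hb', (hker b).1 hb⟩, a, ha.2, mul_comm _ _⟩
  rw [hmid] at iK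
  have hne : (Em ⊔ (twistedDiv σ).ker).relIndex E ≠ 0 := fun h => by
    rw [h, zero_mul] at iK
    exact absurd iK.symm (by positivity)
  refine ⟨?_, fun h => ?_⟩
  · apply Nat.eq_of_mul_eq_mul_left (Nat.pos_of_ne_zero hne)
    rw [im, mul_left_comm, iK]; ring
  · rw [h, mul_zero] at iK
    exact absurd iK.symm (by positivity)

/-- The ambiguous class number formula combined with the Herbrand quotient of the units. -/
theorem ambiguous_class_formula_units {I : Type*} [CommGroup I]
    (σ : M →* M) (τ : I →* I) (hσ : ∀ x, σ (σ x) = x)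
    (hτ : ∀ J, τ (τ J) = J) (f : M →* I) (hf : ∀ x, f (σ x) = τ (f x))
    (h90M : ∀ x, x * σ x = 1 → ∃ y, x = y / σ y)
    (h90I : ∀ J, J * τ J = 1 → ∃ y, J = y / τ y)
    (IK : Subgroup I) (hIK : ∀ J ∈ IK, τ J = J) (hN : ∀ J, J * τ J ∈ IK)
    (h : ℕ) (hodd : Odd h) (hpow : ∀ J ∈ IK, ∃ x, σ x = x ∧ f x = J ^ h)
    (hfix : ∀ x, σ x = x → f x ∈ IK)
    (r : ℕ) [Module.Finite ℤ (Additive f.ker)]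
    [Module.Finite ℤ (Additive (f.ker ⊓ fixedBy σ : Subgroup M))]
    (hrE : Module.finrank ℤ (Additive f.ker) = 2 * r + 1)
    (hrK : Module.finrank ℤ (Additive (f.ker ⊓ fixedBy σ : Subgroup M)) = r)
    (c : M) (hc : f c = 1) (hcσ : σ c = c) (hc1 : c ≠ 1) (hc2 : c ^ 2 = 1)
    (htor : ∀ x, f x = 1 → x ^ 2 = 1 → x = 1 ∨ x = c) :
    2 * f.range.relIndex (sqrtSubgroup f.range) *
        (twistedNorm σ).range.relIndex (f.ker ⊓ fixedBy σ) = IK.relIndex (fixedBy τ) := by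
  obtain ⟨h1, h2⟩ := herbrand_units σ hσ f.ker (fun x hx => by
    rw [MonoidHom.mem_ker, hf, hx, map_one]) r hrE hrK c hc hcσ hc1 hc2 htor
  have h3 := ambiguous_class_formula σ τ hσ hτ f hf h90M h90I IK hIK hN h hodd hpow hfix
  have hle : (twistedNorm σ).range ≤ fixedBy σ := by
    rintro _ ⟨x, rfl⟩
    rw [mem_fixedBy, twistedNorm_apply, map_mul, hσ, mul_comm]
  have h4 := Subgroup.relIndex_mul_relIndex (f.ker.map (twistedNorm σ))
    (f.ker ⊓ (twistedNorm σ).range) (f.ker ⊓ fixedBy σ)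
    (by
      rintro _ ⟨x, hx, rfl⟩
      refine ⟨?_, x, rfl⟩
      have hx' : f x = 1 := hx
      change f (x * σ x) = 1
      rw [map_mul, hf, hx', map_one, mul_one])
    (inf_le_inf_left _ hle)
  have h5 : (f.ker ⊓ (twistedNorm σ).range).relIndex (f.ker ⊓ fixedBy σ) =
      (twistedNorm σ).range.relIndex (f.ker ⊓ fixedBy σ) := by
    apply relIndex_eq_of_inf_eq
    intro x hx
    exact ⟨fun h => h.2, fun h => ⟨hx.1, h⟩⟩
  rw [h5] at h4
  rw [h1, ← h4] at h3
  rw [← h4] at h2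
  have h6 := left_ne_zero_of_mul h2
  apply Nat.eq_of_mul_eq_mul_right (Nat.pos_of_ne_zero h6)
  rw [← h3]
  ring

end Herbrand

section IdealGroup

/-- The group of invertible fractional ideals of a number field. -/
abbrev IdealGroup (K : Type*) [Field K] : Type _ := (FractionalIdeal (𝓞 K)⁰ K)ˣ

variable {K L : Type*} [Field K] [Field L]

lemma nonZeroDivisors_le_comap_mapRingHom (φ : K →+* L) :
    (𝓞 K)⁰ ≤ (𝓞 L)⁰.comap (RingOfIntegers.mapRingHom φ) := by
  intro x hx
  have hx' : x ≠ 0 := nonZeroDivisors.ne_zero hx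
  apply mem_nonZeroDivisors_of_ne_zero
  intro h
  apply hx'
  have : φ (x : K) = 0 := congrArg (fun y : 𝓞 L => (y : L)) h
  exact RingOfIntegers.ext (φ.injective (this.trans (map_zero φ).symm))

variable [NumberField K] [NumberField L]

/-- Extension of fractional ideals along an embedding of number fields. -/
noncomputable def idealExt (φ : K →+* L) : IdealGroup K →* IdealGroup L :=
  Units.map (FractionalIdeal.extendedHom' (K := K) L
    (nonZeroDivisors_le_comap_mapRingHom φ)).toMonoidHom

lemma coe_idealExt (φ : K →+* L) (J : IdealGroup K) :
    (idealExt φ J : FractionalIdeal (𝓞 L)⁰ L) =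
      (J : FractionalIdeal (𝓞 K)⁰ K).extended L (nonZeroDivisors_le_comap_mapRingHom φ) := rfl

lemma localizationMap_mapRingHom (φ : K →+* L) (x : K) :
    IsLocalization.map L (RingOfIntegers.mapRingHom φ)
      (nonZeroDivisors_le_comap_mapRingHom φ) x = φ x := by
  have : IsLocalization.map (S := K) L (RingOfIntegers.mapRingHom φ)
      (nonZeroDivisors_le_comap_mapRingHom φ) = φ := by
    apply IsLocalization.ringHom_ext (𝓞 K)⁰
    ext y
    simp
  rw [this]

lemma idealExt_toPrincipalIdeal (φ : K →+* L) (x : Kˣ) :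
    idealExt φ (toPrincipalIdeal (𝓞 K) K x) = toPrincipalIdeal (𝓞 L) L (Units.map φ x) := by
  ext1
  rw [coe_idealExt, coe_toPrincipalIdeal, coe_toPrincipalIdeal,
    FractionalIdeal.extended_spanSingleton, localizationMap_mapRingHom]
  rfl

lemma idealExt_comp {F : Type*} [Field F] [NumberField F] (φ : K →+* L) (ψ : L →+* F)
    (J : IdealGroup K) : idealExt ψ (idealExt φ J) = idealExt (ψ.comp φ) J := by
  ext1
  rw [coe_idealExt, coe_idealExt, coe_idealExt, FractionalIdeal.extended_extended]
  rfl

lemma coe_idealExt_of_coe (φ : K →+* L) (J : IdealGroup K) (I : Ideal (𝓞 K))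
    (h : (J : FractionalIdeal (𝓞 K)⁰ K) = I) :
    (idealExt φ J : FractionalIdeal (𝓞 L)⁰ L) =
      (I.map (RingOfIntegers.mapRingHom φ) : Ideal _) := by
  rw [coe_idealExt, h, FractionalIdeal.extended_coeIdeal_eq_map]

lemma idealExt_id (J : IdealGroup K) : idealExt (RingHom.id K) J = J := by
  ext1
  rw [coe_idealExt]
  rw [← FractionalIdeal.coeToSubmodule_inj, FractionalIdeal.coe_extended_eq_span]
  have : (IsLocalization.map (S := K) K (RingOfIntegers.mapRingHom (RingHom.id K))
      (nonZeroDivisors_le_comap_mapRingHom (RingHom.id K)) : K → K) = id := by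
    funext x
    rw [localizationMap_mapRingHom]; rfl
  rw [this, Set.image_id]
  exact Submodule.span_eq _

/-- A nonzero prime as an invertible fractional ideal. -/
noncomputable def primeUnit (v : HeightOneSpectrum (𝓞 K)) : IdealGroup K :=
  Units.mk0 (v.asIdeal : FractionalIdeal (𝓞 K)⁰ K) (FractionalIdeal.coeIdeal_ne_zero.2 v.ne_bot)

@[simp] lemma coe_primeUnit (v : HeightOneSpectrum (𝓞 K)) :
    (primeUnit v : FractionalIdeal (𝓞 K)⁰ K) = v.asIdeal := rfl

/-- The exponent of a prime in a fractional ideal. -/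
noncomputable def ord (v : HeightOneSpectrum (𝓞 K)) (J : IdealGroup K) : ℤ :=
  FractionalIdeal.count K v J

variable (v w : HeightOneSpectrum (𝓞 K))

@[simp] lemma ord_one : ord v 1 = 0 := FractionalIdeal.count_one K v

@[simp] lemma ord_mul (J J' : IdealGroup K) : ord v (J * J') = ord v J + ord v J' :=
  FractionalIdeal.count_mul K v J.ne_zero J'.ne_zero

@[simp] lemma ord_inv (J : IdealGroup K) : ord v J⁻¹ = -ord v J := by
  have := ord_mul v J J⁻¹
  rw [mul_inv_cancel, ord_one] at this
  omega

@[simp] lemma ord_pow (J : IdealGroup K) (n : ℕ) : ord v (J ^ n) = n * ord v J := by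
  induction n with
  | zero => simp
  | succ k ih => rw [pow_succ, ord_mul, ih]; push_cast; ring

@[simp] lemma ord_zpow (J : IdealGroup K) (n : ℤ) : ord v (J ^ n) = n * ord v J := by
  cases n with
  | ofNat k => simp
  | negSucc k => rw [zpow_negSucc, ord_inv, ord_pow, Int.negSucc_eq]; push_cast; ring

@[simp] lemma ord_primeUnit_self : ord v (primeUnit v) = 1 := FractionalIdeal.count_self K v

lemma ord_primeUnit_ne (h : w ≠ v) : ord v (primeUnit w) = 0 :=
  FractionalIdeal.count_maximal_coprime K v h

lemma finite_ord_ne_zero (J : IdealGroup K) : {v | ord v J ≠ 0}.Finite :=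
  FractionalIdeal.finite_factors (K := K) (J : FractionalIdeal (𝓞 K)⁰ K)

lemma idealGroup_ext {J J' : IdealGroup K} (h : ∀ v, ord v J = ord v J') : J = J' := by
  ext1
  rw [← FractionalIdeal.finprod_heightOneSpectrum_factorization' K J.ne_zero,
    ← FractionalIdeal.finprod_heightOneSpectrum_factorization' K J'.ne_zero]
  exact finprod_congr fun v => by rw [show FractionalIdeal.count K v J = _ from h v]; rfl

lemma eq_one_of_ord {J : IdealGroup K} (h : ∀ v, ord v J = 0) : J = 1 :=
  idealGroup_ext fun v => by rw [h, ord_one]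

/-- Induction on invertible fractional ideals. -/
lemma mem_of_primeUnit_mem (H : Subgroup (IdealGroup K)) (J : IdealGroup K)
    (h : ∀ v, ord v J ≠ 0 → primeUnit v ∈ H) : J ∈ H := by
  induction hk : {v | ord v J ≠ 0}.ncard using Nat.strong_induction_on generalizing J with
  | _ k ih =>
  by_cases hJ : ∀ v, ord v J = 0
  · rw [eq_one_of_ord hJ]; exact one_mem H
  · push Not at hJ
    obtain ⟨v, hv⟩ := hJ
    have h1 : J = J * (primeUnit v ^ ord v J)⁻¹ * primeUnit v ^ ord v J := by simp
    have h2 : ∀ w, ord w (J * (primeUnit v ^ ord v J)⁻¹) ≠ 0 → ord w J ≠ 0 := by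
      intro w hw hw0
      by_cases hvw : v = w
      · subst hvw; simp at hw
      · simp [ord_primeUnit_ne _ _ hvw, hw0] at hw
    rw [h1]
    refine mul_mem (ih _ ?_ _ (fun w hw => h w (h2 w hw)) rfl) (zpow_mem (h v hv) _)
    rw [← hk]
    exact Set.ncard_lt_ncard ⟨h2, fun hs => hs hv (by simp)⟩ (finite_ord_ne_zero J)

end IdealGroup

section ExtendPrimes

variable {K L : Type*} [Field K] [NumberField K] [Field L] [NumberField L]

/-- The image of a prime under an automorphism. -/
noncomputable def conjPrime (σ : L ≃+* L) (v : HeightOneSpectrum (𝓞 L)) :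
    HeightOneSpectrum (𝓞 L) where
  asIdeal := v.asIdeal.map (RingOfIntegers.mapRingHom (σ : L →+* L))
  isPrime := Ideal.map_isPrime_of_equiv (RingOfIntegers.mapRingEquiv σ)
  ne_bot := by
    intro h
    apply v.ne_bot
    rw [Ideal.map_eq_bot_iff_of_injective] at h
    · exact h
    · exact (RingOfIntegers.mapRingEquiv σ).injective

lemma idealExt_primeUnit_conj (σ : L ≃+* L) (v : HeightOneSpectrum (𝓞 L)) :
    idealExt (σ : L →+* L) (primeUnit v) = primeUnit (conjPrime σ v) :=
  Units.ext (coe_idealExt_of_coe _ _ _ rfl)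

lemma primeUnit_injective : Function.Injective (primeUnit (K := K)) := fun _ _ h =>
  HeightOneSpectrum.ext (FractionalIdeal.coeIdeal_injective (congrArg Units.val h))

lemma idealExt_symm_apply (σ : L ≃+* L) (J : IdealGroup L) :
    idealExt (σ.symm : L →+* L) (idealExt (σ : L →+* L) J) = J := by
  rw [idealExt_comp]
  have : ((σ.symm : L →+* L).comp (σ : L →+* L)) = RingHom.id L := by ext; simp
  rw [this, idealExt_id]

lemma conjPrime_injective (σ : L ≃+* L) : Function.Injective (conjPrime σ) := by
  intro v w h
  have h1 := congrArg primeUnit h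
  rw [← idealExt_primeUnit_conj, ← idealExt_primeUnit_conj] at h1
  have := congrArg (idealExt (σ.symm : L →+* L)) h1
  rw [idealExt_symm_apply, idealExt_symm_apply] at this
  exact primeUnit_injective this

lemma ord_conjPrime (σ : L ≃+* L) (v : HeightOneSpectrum (𝓞 L)) (J : IdealGroup L) :
    ord (conjPrime σ v) (idealExt (σ : L →+* L) J) = ord v J := by
  let H : Subgroup (IdealGroup L) :=
    { carrier := {J | ord (conjPrime σ v) (idealExt (σ : L →+* L) J) = ord v J}
      one_mem' := by simp
      mul_mem' := by intro a b ha hb; simp_all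
      inv_mem' := by intro a ha; simp_all }
  refine mem_of_primeUnit_mem H J (fun w _ => ?_)
  change ord (conjPrime σ v) (idealExt (σ : L →+* L) (primeUnit w)) = ord v (primeUnit w)
  rw [idealExt_primeUnit_conj]
  by_cases h : w = v
  · subst h; simp
  · rw [ord_primeUnit_ne _ _ h, ord_primeUnit_ne _ _ fun h' => h (conjPrime_injective σ h')]

variable [Algebra K L]

/-- The prime of the base field below a prime. -/
noncomputable def underPrime (K : Type*) [Field K] [NumberField K] [Algebra K L]
    (v : HeightOneSpectrum (𝓞 L)) : HeightOneSpectrum (𝓞 K) where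
  asIdeal := v.asIdeal.under (𝓞 K)
  isPrime := inferInstance
  ne_bot := Ideal.IsIntegral.comap_ne_bot (𝓞 K) v.ne_bot

/-- The ramification exponent of a prime. -/
noncomputable def ramExp (K : Type*) [Field K] [NumberField K] [Algebra K L]
    (v : HeightOneSpectrum (𝓞 L)) : ℤ :=
  ord v (idealExt (algebraMap K L) (primeUnit (underPrime K v)))

lemma ord_coe_eq_zero (v : HeightOneSpectrum (𝓞 L)) (J : IdealGroup L) (I : Ideal (𝓞 L))
    (h : (J : FractionalIdeal (𝓞 L)⁰ L) = I) : ord v J = 0 ↔ ¬ I ≤ v.asIdeal := by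
  classical
  have hI : I ≠ 0 := by
    rintro rfl
    exact J.ne_zero (h.trans FractionalIdeal.coeIdeal_bot)
  rw [ord, h, FractionalIdeal.count_coe L v hI, ← Ideal.dvd_iff_le, ← not_iff_not, not_not,
    ← Associates.count_ne_zero_iff_dvd hI v.irreducible]
  norm_cast

lemma ord_idealExt (v : HeightOneSpectrum (𝓞 L)) (J : IdealGroup K) :
    ord v (idealExt (algebraMap K L) J) = ramExp K v * ord (underPrime K v) J := by
  let H : Subgroup (IdealGroup K) :=
    { carrier := {J | ord v (idealExt (algebraMap K L) J) = ramExp K v * ord (underPrime K v) J}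
      one_mem' := by simp
      mul_mem' := by intro a b ha hb; simp_all [mul_add]
      inv_mem' := by intro a ha; simp_all }
  refine mem_of_primeUnit_mem H J (fun w _ => ?_)
  change ord v (idealExt (algebraMap K L) (primeUnit w)) =
    ramExp K v * ord (underPrime K v) (primeUnit w)
  by_cases h : w = underPrime K v
  · subst h; simp [ramExp]
  · rw [ord_primeUnit_ne _ _ h, mul_zero,
      ord_coe_eq_zero v _ _ (coe_idealExt_of_coe _ _ _ (coe_primeUnit w))]
    intro hle
    apply h
    apply HeightOneSpectrum.ext
    exact w.isMaximal.eq_of_le (underPrime K v).isPrime.ne_top (Ideal.map_le_iff_le_comap.1 hle)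

lemma count_map_eq_ramificationIdx {R : Type*} [CommRing R] [Algebra R (𝓞 L)]
    (v : HeightOneSpectrum (𝓞 L)) (I : Ideal R) [v.asIdeal.LiesOver I]
    (h0 : I.map (algebraMap R (𝓞 L)) ≠ ⊥) :
    FractionalIdeal.count L v (I.map (algebraMap R (𝓞 L)) : FractionalIdeal (𝓞 L)⁰ L) =
      v.asIdeal.ramificationIdx R := by
  classical
  rw [FractionalIdeal.count_coe L v h0,
    Ideal.IsDedekindDomain.ramificationIdx_eq_factors_count I v.asIdeal h0,
    UniqueFactorizationMonoid.factors_eq_normalizedFactors, Associates.factors_mk _ h0,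
    Associates.count_some (Associates.irreducible_mk.2 v.irreducible),
    ← Multiset.count_map_eq_count' _ _ Subtype.val_injective, Associates.map_subtype_coe_factors',
    UniqueFactorizationMonoid.factors_eq_normalizedFactors,
    ← Multiset.count_map_eq_count' _ (UniqueFactorizationMonoid.normalizedFactors _)
      (Associates.mk_injective (M := Ideal (𝓞 L)))]

lemma ramExp_eq (v : HeightOneSpectrum (𝓞 L)) :
    ramExp K v = v.asIdeal.ramificationIdx (𝓞 K) := by
  have : v.asIdeal.LiesOver (underPrime K v).asIdeal := ⟨rfl⟩
  rw [ramExp, ord, coe_idealExt_of_coe _ _ _ (coe_primeUnit _)]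
  exact count_map_eq_ramificationIdx v (underPrime K v).asIdeal
    (Ideal.map_ne_bot_of_ne_bot (underPrime K v).ne_bot)

end ExtendPrimes

section Quadratic

variable {K L : Type*} [Field K] [NumberField K] [Field L] [NumberField L] [Algebra K L]
  [IsGalois K L] (h2 : Module.finrank K L = 2) (σ : L ≃ₐ[K] L) (hσ : σ ≠ 1)

include h2 hσ in
lemma gal_eq_one_or (g : L ≃ₐ[K] L) : g = 1 ∨ g = σ := by
  have hc : Nat.card (L ≃ₐ[K] L) = 2 := by rw [IsGalois.card_aut_eq_finrank, h2]
  obtain ⟨x, y, hxy, hu⟩ := Nat.card_eq_two_iff.1 hc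
  have h1 : (1 : L ≃ₐ[K] L) ∈ ({x, y} : Set _) := hu ▸ Set.mem_univ _
  have h3 : σ ∈ ({x, y} : Set _) := hu ▸ Set.mem_univ _
  have h4 : g ∈ ({x, y} : Set _) := hu ▸ Set.mem_univ _
  simp only [Set.mem_insert_iff, Set.mem_singleton_iff] at h1 h3 h4
  grind

include h2 hσ in
lemma gal_involutive (x : L) : σ (σ x) = x := by
  have : σ * σ = 1 := by
    rcases gal_eq_one_or h2 σ hσ (σ * σ) with h | h
    · exact h
    · exact absurd (mul_eq_left.1 h) hσ
  exact congrArg (fun g : L ≃ₐ[K] L => g x) this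

include h2 hσ in
lemma mem_range_of_gal_fixed (x : L) (hx : σ x = x) : ∃ y : K, algebraMap K L y = x := by
  have := (IsGalois.mem_bot_iff_fixed (F := K) x).2 fun g => by
    rcases gal_eq_one_or h2 σ hσ g with rfl | rfl
    · rfl
    · exact hx
  exact IntermediateField.mem_bot.1 this

/-- The action of an automorphism on invertible fractional ideals. -/
noncomputable abbrev idealConj (σ : L ≃ₐ[K] L) : IdealGroup L →* IdealGroup L :=
  idealExt ((σ : L ≃+* L) : L →+* L)

/-- The subgroup of fractional ideals extended from the base. -/
noncomputable abbrev baseIdeals (K L : Type*) [Field K] [NumberField K] [Field L] [NumberField L]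
    [Algebra K L] : Subgroup (IdealGroup L) :=
  (idealExt (algebraMap K L)).range

omit [IsGalois K L] in
lemma idealConj_of_mem_base {J : IdealGroup L} (hJ : J ∈ baseIdeals K L) : idealConj σ J = J := by
  obtain ⟨J, rfl⟩ := hJ
  rw [idealExt_comp]
  congr 1
  congr 1
  ext x
  simp

include h2 hσ in
lemma idealConj_idealConj (J : IdealGroup L) : idealConj σ (idealConj σ J) = J := by
  rw [idealExt_comp]
  have : (((σ : L ≃+* L) : L →+* L).comp ((σ : L ≃+* L) : L →+* L)) = RingHom.id L := by
    ext x; exact gal_involutive h2 σ hσ x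
  rw [this, idealExt_id]

omit [IsGalois K L] in
lemma underPrime_conjPrime (v : HeightOneSpectrum (𝓞 L)) :
    underPrime K (conjPrime (σ : L ≃+* L) v) = underPrime K v := by
  by_contra hne
  have h1 : ord (conjPrime (σ : L ≃+* L) v)
      (idealExt (algebraMap K L) (primeUnit (underPrime K v))) = ramExp K v := by
    rw [← idealConj_of_mem_base σ ⟨_, rfl⟩]
    exact ord_conjPrime (σ : L ≃+* L) v _
  rw [ord_idealExt, ord_primeUnit_ne _ _ (Ne.symm hne), mul_zero, ramExp_eq] at h1
  have := Ideal.ramificationIdx_pos v.asIdeal (𝓞 K)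
  omega

omit [IsGalois K L] in
lemma ramExp_conjPrime (v : HeightOneSpectrum (𝓞 L)) :
    ramExp K (conjPrime (σ : L ≃+* L) v) = ramExp K v := by
  rw [ramExp, underPrime_conjPrime, ← idealConj_of_mem_base σ ⟨_, rfl⟩]
  exact ord_conjPrime (σ : L ≃+* L) v _

include h2 hσ in
lemma eq_or_eq_conjPrime {v w : HeightOneSpectrum (𝓞 L)} (h : underPrime K w = underPrime K v) :
    w = v ∨ w = conjPrime (σ : L ≃+* L) v := by
  have h1 : v.asIdeal.LiesOver (underPrime K v).asIdeal := ⟨rfl⟩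
  have h3 : w.asIdeal.LiesOver (underPrime K v).asIdeal := ⟨by rw [← h]; rfl⟩
  obtain ⟨g, hg⟩ := Ideal.exists_smul_eq_of_isGaloisGroup (underPrime K v).asIdeal v.asIdeal
    w.asIdeal (L ≃ₐ[K] L)
  rcases gal_eq_one_or h2 σ hσ g with rfl | rfl
  · left; rw [one_smul] at hg; exact HeightOneSpectrum.ext hg.symm
  · right; exact HeightOneSpectrum.ext hg.symm

include h2 in
lemma ncard_primesOver_mul_ramExp_dvd (v : HeightOneSpectrum (𝓞 L)) :
    ∃ f : ℕ, (Ideal.primesOver (underPrime K v).asIdeal (𝓞 L)).ncard * (ramExp K v * f) = 2 := by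
  have h1 : v.asIdeal.LiesOver (underPrime K v).asIdeal := ⟨rfl⟩
  have := Ideal.ncard_primesOver_mul_ramificationIdxIn_mul_inertiaDegIn
    (underPrime K v).asIdeal (𝓞 L) (L ≃ₐ[K] L)
  rw [IsGalois.card_aut_eq_finrank, h2, Ideal.ramificationIdxIn_eq_ramificationIdx
    (underPrime K v).asIdeal v.asIdeal (L ≃ₐ[K] L)] at this
  exact ⟨_, by rw [ramExp_eq]; exact_mod_cast this⟩

include h2 in
lemma ramExp_eq_one_or_two (v : HeightOneSpectrum (𝓞 L)) : ramExp K v = 1 ∨ ramExp K v = 2 := by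
  obtain ⟨f, hf⟩ := ncard_primesOver_mul_ramExp_dvd h2 v
  have h1 : ramExp K v ∣ 2 := ⟨_ * f, by rw [← hf]; ring⟩
  have h3 : 0 ≤ ramExp K v := by rw [ramExp_eq]; positivity
  have h4 := Int.le_of_dvd two_pos h1
  interval_cases h : ramExp K v
  · simp at h1
  · simp
  · simp

include h2 in
lemma ramExp_of_conjPrime_ne {v : HeightOneSpectrum (𝓞 L)}
    (hv : conjPrime (σ : L ≃+* L) v ≠ v) : ramExp K v = 1 := by
  obtain ⟨f, hf⟩ := ncard_primesOver_mul_ramExp_dvd h2 v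
  rcases ramExp_eq_one_or_two (K := K) h2 v with h | h
  · exact h
  exfalso
  rw [h] at hf
  have h1 : (Ideal.primesOver (underPrime K v).asIdeal (𝓞 L)).ncard = 1 := by
    have : (Ideal.primesOver (underPrime K v).asIdeal (𝓞 L)).ncard ∣ 1 :=
      ⟨f, by zify; linarith⟩
    simpa using this
  obtain ⟨P, hP⟩ := Set.ncard_eq_one.1 h1
  have h3 : ∀ w : HeightOneSpectrum (𝓞 L), underPrime K w = underPrime K v → w.asIdeal = P := by
    intro w hw
    have : w.asIdeal ∈ Ideal.primesOver (underPrime K v).asIdeal (𝓞 L) :=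
      ⟨w.isPrime, ⟨by rw [← hw]; rfl⟩⟩
    rw [hP] at this
    exact this
  exact hv (HeightOneSpectrum.ext ((h3 _ (underPrime_conjPrime σ v)).trans (h3 v rfl).symm))

include h2 hσ in
lemma idealExt_underPrime_of_fixed {v : HeightOneSpectrum (𝓞 L)}
    (hv : conjPrime (σ : L ≃+* L) v = v) :
    idealExt (algebraMap K L) (primeUnit (underPrime K v)) = primeUnit v ^ ramExp K v := by
  apply idealGroup_ext
  intro w
  rw [ord_zpow]
  by_cases hw : w = v
  · subst hw; simp [ramExp]
  · rw [ord_primeUnit_ne _ _ (Ne.symm hw), ord_idealExt, ord_primeUnit_ne]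
    · simp
    · intro h
      rcases eq_or_eq_conjPrime h2 σ hσ h.symm with h | h
      · exact hw h
      · exact hw (h.trans hv)

include h2 hσ in
lemma idealExt_underPrime_of_not_fixed {v : HeightOneSpectrum (𝓞 L)}
    (hv : conjPrime (σ : L ≃+* L) v ≠ v) :
    idealExt (algebraMap K L) (primeUnit (underPrime K v)) =
      primeUnit v * primeUnit (conjPrime (σ : L ≃+* L) v) := by
  have h1 := ramExp_of_conjPrime_ne h2 σ hv
  apply idealGroup_ext
  intro w
  rw [ord_mul]
  by_cases hw : w = v
  · subst hw; rw [ord_primeUnit_self, ord_primeUnit_ne _ _ hv]; simpa [ramExp] using h1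
  by_cases hw' : w = conjPrime (σ : L ≃+* L) v
  · subst hw'
    rw [ord_primeUnit_self, ord_primeUnit_ne _ _ (Ne.symm hw), ord_idealExt, ramExp_conjPrime,
      underPrime_conjPrime, h1]
    simp
  · rw [ord_primeUnit_ne _ _ (Ne.symm hw), ord_primeUnit_ne _ _ (Ne.symm hw'), ord_idealExt,
      ord_primeUnit_ne]
    · simp
    · intro h
      rcases eq_or_eq_conjPrime h2 σ hσ h.symm with h | h
      · exact hw h
      · exact hw' h

include h2 hσ in
lemma primeUnit_mul_conj_mem (v : HeightOneSpectrum (𝓞 L)) :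
    primeUnit v * primeUnit (conjPrime (σ : L ≃+* L) v) ∈ baseIdeals K L := by
  by_cases hv : conjPrime (σ : L ≃+* L) v = v
  · have h := idealExt_underPrime_of_fixed h2 σ hσ hv
    rw [hv, ← pow_two]
    rcases ramExp_eq_one_or_two (K := K) h2 v with h1 | h1
    · rw [h1, zpow_one] at h
      rw [← h]; exact pow_mem (show idealExt (algebraMap K L) _ ∈ baseIdeals K L from ⟨_, rfl⟩) 2
    · rw [h1] at h
      exact ⟨_, h⟩
  · exact ⟨_, idealExt_underPrime_of_not_fixed h2 σ hσ hv⟩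

include h2 hσ in
lemma mul_idealConj_mem (J : IdealGroup L) : J * idealConj σ J ∈ baseIdeals K L := by
  refine mem_of_primeUnit_mem ((baseIdeals K L).comap (twistedNorm (idealConj σ))) J (fun v _ => ?_)
  change primeUnit v * idealConj σ (primeUnit v) ∈ baseIdeals K L
  rw [idealExt_primeUnit_conj]
  exact primeUnit_mul_conj_mem h2 σ hσ v

/-- The set of primes ramified in a quadratic extension. -/
def ramSet (K L : Type*) [Field K] [NumberField K] [Field L] [NumberField L]
    [Algebra K L] : Set (HeightOneSpectrum (𝓞 L)) := {v | ramExp K v = 2}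

include h2 in
lemma conjPrime_of_mem_ramSet {v : HeightOneSpectrum (𝓞 L)} (hv : v ∈ ramSet K L) :
    conjPrime (σ : L ≃+* L) v = v := by
  by_contra h
  have h1 := ramExp_of_conjPrime_ne h2 σ h
  rw [show ramExp K v = 2 from hv] at h1
  omega

include h2 hσ in
/-- An ambiguous ideal with even exponents at the ramified primes comes from the base. -/
lemma mem_base_of_even (J : IdealGroup L) (hJ : idealConj σ J = J)
    (he : ∀ v ∈ ramSet K L, Even (ord v J)) : J ∈ baseIdeals K L := by
  induction hk : {v | ord v J ≠ 0}.ncard using Nat.strong_induction_on generalizing J with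
  | _ k ih =>
  by_cases hJ0 : ∀ v, ord v J = 0
  · rw [eq_one_of_ord hJ0]; exact one_mem _
  · push Not at hJ0
    obtain ⟨v, hv⟩ := hJ0
    have main : ∀ B ∈ baseIdeals K L, (∀ w, ord w J = 0 → ord w B = 0) →
        ord v B = ord v J → J ∈ baseIdeals K L := by
      intro B hB h1 h3
      have h4 : J = J * B⁻¹ * B := by simp
      rw [h4]
      refine mul_mem (ih _ ?_ _ ?_ ?_ rfl) hB
      · rw [← hk]
        apply Set.ncard_lt_ncard _ (finite_ord_ne_zero J)
        refine ⟨fun w hw hw0 => hw ?_, fun hs => hs hv ?_⟩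
        · simp [hw0, h1 w hw0]
        · simp [h3]
      · rw [map_mul, map_inv, hJ, idealConj_of_mem_base σ hB]
      · intro w hw
        rw [ord_mul, ord_inv]
        obtain ⟨B, rfl⟩ := hB
        rw [ord_idealExt, show ramExp K w = 2 from hw]
        exact (he w hw).add (by simp)
    by_cases hc : conjPrime (σ : L ≃+* L) v = v
    · have h := idealExt_underPrime_of_fixed h2 σ hσ hc
      rcases ramExp_eq_one_or_two (K := K) h2 v with h1 | h1
      · refine main (primeUnit v ^ ord v J) (zpow_mem
          (show primeUnit v ∈ baseIdeals K L from ⟨_, by rw [h, h1, zpow_one]⟩) _) ?_ (by simp)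
        intro w hw
        rw [ord_zpow, ord_primeUnit_ne _ _ (by rintro rfl; exact hv hw), mul_zero]
      · obtain ⟨m, hm⟩ := he v h1
        refine main ((primeUnit v ^ (2 : ℤ)) ^ m) (zpow_mem
          (show primeUnit v ^ (2 : ℤ) ∈ baseIdeals K L from ⟨_, by rw [h, h1]⟩) _) ?_
          (by simp [hm]; ring)
        intro w hw
        rw [ord_zpow, ord_zpow, ord_primeUnit_ne _ _ (by rintro rfl; exact hv hw), mul_zero,
          mul_zero]
    · have hcc : ord (conjPrime (σ : L ≃+* L) v) J = ord v J := by
        conv_lhs => rw [← hJ]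
        exact ord_conjPrime (σ : L ≃+* L) v J
      refine main ((primeUnit v * primeUnit (conjPrime (σ : L ≃+* L) v)) ^ ord v J)
        (zpow_mem (primeUnit_mul_conj_mem h2 σ hσ v) _) ?_ ?_
      · intro w hw
        rw [ord_zpow, ord_mul, ord_primeUnit_ne _ _ (by rintro rfl; exact hv hw),
          ord_primeUnit_ne _ _ (by rintro rfl; exact hv (hcc ▸ hw))]
        simp
      · rw [ord_zpow, ord_mul, ord_primeUnit_self, ord_primeUnit_ne _ _ hc]
        simp

include h2 hσ in
/-- The group of ambiguous ideals modulo ideals of the base is generated freely over `ℤ/2` by the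
ramified primes. -/
theorem relIndex_base_fixedBy (hfin : (ramSet K L).Finite) :
    (baseIdeals K L).relIndex (fixedBy (idealConj σ)) = 2 ^ (ramSet K L).ncard := by
  classical
  have : Fintype (ramSet K L) := hfin.fintype
  let Φ : IdealGroup L →* Multiplicative (ramSet K L → ZMod 2) :=
    { toFun := fun J => Multiplicative.ofAdd fun v => (ord v.1 J : ZMod 2)
      map_one' := by
        apply Multiplicative.toAdd.injective; ext v; simp
      map_mul' := fun a b => by
        apply Multiplicative.toAdd.injective; ext v; simp }
  have hΦ : ∀ J v, Multiplicative.toAdd (Φ J) v = (ord v.1 J : ZMod 2) := fun _ _ => rfl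
  have hker : ∀ J ∈ fixedBy (idealConj σ), J ∈ baseIdeals K L ↔ J ∈ Φ.ker := by
    intro J hJ
    constructor
    · rintro ⟨B, rfl⟩
      apply Multiplicative.toAdd.injective
      ext v
      rw [hΦ, ord_idealExt, show ramExp K v.1 = 2 from v.2]
      push_cast
      rw [show (2 : ZMod 2) = 0 from rfl, zero_mul]; rfl
    · intro h
      refine mem_base_of_even h2 σ hσ J hJ fun v hv => ?_
      have h3 := congrFun (congrArg Multiplicative.toAdd (MonoidHom.mem_ker.1 h)) ⟨v, hv⟩
      rw [hΦ] at h3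
      exact (ZMod.intCast_eq_zero_iff_even).1 h3
  have hsurj : (fixedBy (idealConj σ)).map Φ = ⊤ := by
    rw [eq_top_iff]
    rintro x -
    refine ⟨∏ v : ramSet K L, primeUnit v.1 ^ ((Multiplicative.toAdd x v).val), ?_, ?_⟩
    · refine prod_mem fun v _ => pow_mem ?_ _
      change idealConj σ (primeUnit v.1) = primeUnit v.1
      rw [idealExt_primeUnit_conj, conjPrime_of_mem_ramSet h2 σ v.2]
    · rw [map_prod]
      apply Multiplicative.toAdd.injective
      ext w
      rw [toAdd_prod, Finset.sum_apply, Finset.sum_eq_single w]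
      · rw [map_pow, toAdd_pow, Pi.smul_apply, hΦ, ord_primeUnit_self]
        simp
      · intro v _ hvw
        rw [map_pow, toAdd_pow, Pi.smul_apply, hΦ, ord_primeUnit_ne]
        · simp
        · exact fun h => hvw (Subtype.ext h)
      · simp
  rw [relIndex_eq_of_inf_eq hker, ← MonoidHom.comap_bot, Subgroup.relIndex_comap, hsurj,
    Subgroup.relIndex_top_right, Subgroup.index_bot, Nat.card_eq_fintype_card]
  rw [Fintype.card_multiplicative, Fintype.card_fun, ZMod.card, ← Set.fintypeCard_eq_ncard]

end Quadratic

section ClassGroupSquares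

/-- The quotient of the class group by its subgroup of squares. -/
noncomputable def classSquareIndex (L : Type*) [Field L] [NumberField L] : ℕ :=
  (powMonoidHom 2 : ClassGroup (𝓞 L) →* ClassGroup (𝓞 L)).range.index

/-- The homomorphism from invertible fractional ideals to the class group. -/
noncomputable def idealClass (L : Type*) [Field L] [NumberField L] :
    IdealGroup L →* ClassGroup (𝓞 L) :=
  (ClassGroup.equiv (R := 𝓞 L) L).symm.toMonoidHom.comp
    (QuotientGroup.mk' (toPrincipalIdeal (𝓞 L) L).range)

variable {L : Type*} [Field L] [NumberField L]

lemma idealClass_surjective : Function.Surjective (idealClass L) :=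
  (ClassGroup.equiv (R := 𝓞 L) L).symm.surjective.comp (QuotientGroup.mk'_surjective _)

lemma idealClass_eq_one {J : IdealGroup L} :
    idealClass L J = 1 ↔ J ∈ (toPrincipalIdeal (𝓞 L) L).range := by
  rw [← QuotientGroup.eq_one_iff]
  exact (ClassGroup.equiv (R := 𝓞 L) L).symm.map_eq_one_iff

lemma exists_toPrincipalIdeal_eq_pow (J : IdealGroup L) :
    ∃ x : Lˣ, toPrincipalIdeal (𝓞 L) L x = J ^ classNumber L := by
  refine idealClass_eq_one.1 ?_
  rw [map_pow]
  exact pow_card_eq_one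

lemma relIndex_sqrtSubgroup_eq :
    (toPrincipalIdeal (𝓞 L) L).range.relIndex (sqrtSubgroup (toPrincipalIdeal (𝓞 L) L).range) =
      classSquareIndex L := by
  set π := idealClass L
  let φ := (powMonoidHom 2 : ClassGroup (𝓞 L) →* ClassGroup (𝓞 L))
  have e1 : (toPrincipalIdeal (𝓞 L) L).range = (⊥ : Subgroup (ClassGroup (𝓞 L))).comap π := by
    ext J; exact idealClass_eq_one.symm
  have e2 : sqrtSubgroup (toPrincipalIdeal (𝓞 L) L).range = φ.ker.comap π := by
    ext J
    rw [mem_sqrtSubgroup, ← idealClass_eq_one, map_pow]; rfl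
  rw [e2, e1, Subgroup.relIndex_comap, Subgroup.map_comap_eq_self_of_surjective
    idealClass_surjective, Subgroup.relIndex_bot_left]
  have h1 := φ.range.card_mul_index
  have h2 := φ.ker.card_mul_index
  rw [Subgroup.index_ker, ← h1, mul_comm] at h2
  exact Nat.eq_of_mul_eq_mul_left Nat.card_pos h2

lemma odd_classNumber_of_classSquareIndex_eq_one (h : classSquareIndex L = 1) :
    Odd (classNumber L) := by
  rw [← Nat.not_even_iff_odd, even_iff_two_dvd]
  intro h2
  have : Fact (Nat.Prime 2) := ⟨Nat.prime_two⟩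
  obtain ⟨x, hx⟩ := exists_prime_orderOf_dvd_card (G := ClassGroup (𝓞 L)) 2 h2
  have hs := MonoidHom.range_eq_top.1 (Subgroup.index_eq_one.1 h)
  have hi := Finite.injective_iff_surjective.2 hs
  have : x = 1 := hi (by
    change x ^ 2 = 1 ^ 2
    rw [one_pow, ← hx, pow_orderOf_eq_one])
  simp [this] at hx

end ClassGroupSquares

section NormUnits

/-- The group of units of `K` of the form `x ^ 2 - δ * y ^ 2`. -/
def normUnits {K : Type*} [Field K] [NumberField K] (δ : K) : Subgroup (𝓞 K)ˣ where
  carrier := {u | ∃ x y : K, ((u : 𝓞 K) : K) = x ^ 2 - δ * y ^ 2}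
  one_mem' := ⟨1, 0, by simp⟩
  mul_mem' := by
    rintro u v ⟨a, b, h⟩ ⟨x, y, h'⟩
    exact ⟨a * x + δ * b * y, a * y + b * x, (congrArg₂ (· * ·) h h').trans (by ring)⟩
  inv_mem' := by
    rintro u ⟨a, b, h⟩
    have h1 : ((u⁻¹ : (𝓞 K)ˣ) : 𝓞 K) * ((u : 𝓞 K) : K) = 1 := by
      norm_cast; simp
    set v : K := (((u⁻¹ : (𝓞 K)ˣ) : 𝓞 K) : K) with hv
    refine ⟨v * a, v * b, ?_⟩
    rw [← hv]
    calc v = v ^ 2 * ((u : 𝓞 K) : K) := by rw [pow_two, mul_assoc, h1, mul_one]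
      _ = _ := by rw [h]; ring

variable {K : Type*} [Field K] [NumberField K]

lemma mem_normUnits {δ : K} {u : (𝓞 K)ˣ} :
    u ∈ normUnits δ ↔ ∃ x y : K, ((u : 𝓞 K) : K) = x ^ 2 - δ * y ^ 2 := Iff.rfl

lemma finrank_units_of_isTotallyComplex [IsTotallyComplex K] :
    2 * (Module.finrank ℤ (Additive (𝓞 K)ˣ) + 1) = Module.finrank ℚ K := by
  rw [NumberField.Units.finrank_eq, NumberField.Units.rank, IsTotallyComplex.finrank,
    Nat.sub_add_cancel Fintype.card_pos, InfinitePlace.card_eq_nrRealPlaces_add_nrComplexPlaces,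
    IsTotallyComplex.nrRealPlaces_eq_zero, zero_add]

/-- The units of the ring of integers inside the multiplicative group of the field. -/
noncomputable def unitIncl (K : Type*) [Field K] [NumberField K] : (𝓞 K)ˣ →* Kˣ :=
  Units.map (algebraMap (𝓞 K) K)

lemma coe_unitIncl (u : (𝓞 K)ˣ) : (unitIncl K u : K) = ((u : 𝓞 K) : K) := rfl

lemma unitIncl_injective : Function.Injective (unitIncl K) :=
  Units.map_injective RingOfIntegers.coe_injective

lemma range_unitIncl : (unitIncl K).range = (toPrincipalIdeal (𝓞 K) K).ker := by
  ext x
  rw [MonoidHom.mem_ker, toPrincipalIdeal_eq_iff, Units.val_one,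
    ← FractionalIdeal.spanSingleton_one,
    FractionalIdeal.spanSingleton_eq_spanSingleton]
  constructor
  · rintro ⟨u, rfl⟩
    refine ⟨u⁻¹, ?_⟩
    rw [coe_unitIncl, Units.smul_def, Algebra.smul_def]
    norm_cast; simp
  · rintro ⟨z, hz⟩
    refine ⟨z⁻¹, ?_⟩
    ext
    rw [coe_unitIncl]
    rw [Units.smul_def, Algebra.smul_def] at hz
    have h1 : (((z⁻¹ : (𝓞 K)ˣ) : 𝓞 K) : K) * ((z : 𝓞 K) : K) = 1 := by norm_cast; simp
    calc _ = (((z⁻¹ : (𝓞 K)ˣ) : 𝓞 K) : K) * (((z : 𝓞 K) : K) * x) := by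
          rw [show ((z : 𝓞 K) : K) * (x : K) = 1 from hz, mul_one]
      _ = _ := by rw [← mul_assoc, h1, one_mul]

end NormUnits

section Chevalley

variable {K L : Type*} [Field K] [NumberField K] [Field L] [NumberField L] [Algebra K L]

lemma exists_eq_div_of_mul_conj_eq_one [IsGalois K L] (h2 : Module.finrank K L = 2)
    (σ : L ≃ₐ[K] L) (hσ : σ ≠ 1) (x : Lˣ) (hx : (x : L) * σ x = 1) :
    ∃ y : Lˣ, (x : L) = y / σ y := by
  by_cases h : (x : L) = -1
  · obtain ⟨α, hα⟩ : ∃ α, σ α ≠ α := by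
      by_contra! hc
      exact hσ (AlgEquiv.ext hc)
    refine ⟨Units.mk0 (α - σ α) (sub_ne_zero.2 hα.symm), ?_⟩
    have : σ α - α ≠ 0 := sub_ne_zero.2 hα
    rw [h, Units.val_mk0, map_sub, gal_involutive h2 σ hσ]
    field_simp
    ring
  · have h1 : 1 + (x : L) ≠ 0 := fun h' => h (by linear_combination h')
    refine ⟨Units.mk0 (1 + x) h1, ?_⟩
    have h3 : σ (1 + (x : L)) ≠ 0 := (map_ne_zero σ).2 h1
    rw [Units.val_mk0, eq_div_iff h3, map_add, map_one]
    linear_combination hx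

omit [NumberField K] in
lemma exists_ideal_eq_div_of_mul_conj_eq_one (σ : L ≃ₐ[K] L) (J : IdealGroup L)
    (hJ : J * idealConj σ J = 1) : ∃ y, J = y / idealConj σ y := by
  have h1 : (1 : FractionalIdeal (𝓞 L)⁰ L) + J ≠ 0 := by
    intro h
    have : (1 : FractionalIdeal (𝓞 L)⁰ L) ≤ 0 := by
      rw [← h, ← FractionalIdeal.sup_eq_add]; exact le_sup_left
    exact one_ne_zero (le_antisymm this bot_le)
  let Y : IdealGroup L := Units.mk0 _ h1
  refine ⟨Y, ?_⟩
  have h3 : ((idealConj σ Y : IdealGroup L) : FractionalIdeal (𝓞 L)⁰ L) =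
      1 + ((idealConj σ J : IdealGroup L) : FractionalIdeal (𝓞 L)⁰ L) := by
    rw [coe_idealExt, coe_idealExt, Units.val_mk0, FractionalIdeal.extended_add,
      FractionalIdeal.extended_one]
  rw [eq_div_iff_mul_eq']
  ext1
  rw [Units.val_mul, h3, mul_add, mul_one, ← Units.val_mul, hJ]
  simp [Y, add_comm]

/-- The ambiguous class number formula for a quadratic extension of totally complex fields whose
base has odd class number. -/
theorem classSquareIndex_mul_index [IsGalois K L] (h2 : Module.finrank K L = 2)
    (σ : L ≃ₐ[K] L) (hσ : σ ≠ 1) [IsTotallyComplex K] (hK : Odd (classNumber K))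
    (hfin : (ramSet K L).Finite) (δ : K) (s : L) (hs : s ^ 2 = algebraMap K L δ)
    (hσs : σ s = -s) (hspan : ∀ x : L, ∃ a b : K, x = algebraMap K L a + algebraMap K L b * s) :
    2 * classSquareIndex L * (normUnits δ).index = 2 ^ (ramSet K L).ncard := by
  have : IsTotallyComplex L := isTotallyComplex_of_algebra K L
  let f := toPrincipalIdeal (𝓞 L) L
  let τ : Lˣ →* Lˣ := Units.map ((σ : L ≃+* L) : L →+* L)
  have hτ : ∀ x, ((τ x : Lˣ) : L) = σ x := fun x => rfl
  let φ : (𝓞 K)ˣ →* Lˣ := (Units.map (algebraMap K L : K →* L)).comp (unitIncl K)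
  have hφ : ∀ u, ((φ u : Lˣ) : L) = algebraMap K L ((u : 𝓞 K) : K) := fun _ => rfl
  have hφi : Function.Injective φ :=
    (Units.map_injective (algebraMap K L).injective).comp unitIncl_injective
  have hφr : φ.range = f.ker ⊓ fixedBy τ := by
    ext x
    constructor
    · rintro ⟨u, rfl⟩
      refine ⟨?_, ?_⟩
      · have h1 : unitIncl K u ∈ (toPrincipalIdeal (𝓞 K) K).ker := by
          rw [← range_unitIncl]; exact ⟨u, rfl⟩
        change toPrincipalIdeal (𝓞 L) L (Units.map (algebraMap K L) (unitIncl K u)) = 1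
        rw [← idealExt_toPrincipalIdeal, MonoidHom.mem_ker.1 h1, map_one]
      · change τ (φ u) = φ u
        ext
        rw [hτ, hφ, AlgEquiv.commutes]
    · rintro ⟨h1, h3⟩
      change x ∈ (toPrincipalIdeal (𝓞 L) L).ker at h1
      rw [← range_unitIncl] at h1
      obtain ⟨u, rfl⟩ := h1
      obtain ⟨y, hy⟩ := mem_range_of_gal_fixed h2 σ hσ _ (congrArg Units.val h3)
      have hi : IsIntegral ℤ y := by
        rw [← isIntegral_algebraMap_iff (algebraMap K L).injective, hy]
        exact (u : 𝓞 L).2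
      obtain ⟨y', hy'⟩ := mem_range_of_gal_fixed h2 σ hσ ((((u⁻¹ : (𝓞 L)ˣ) : 𝓞 L)) : L) (by
        have : τ (unitIncl L u⁻¹) = unitIncl L u⁻¹ := by rw [map_inv, map_inv, h3]; rfl
        exact congrArg Units.val this)
      have hi' : IsIntegral ℤ y' := by
        rw [← isIntegral_algebraMap_iff (algebraMap K L).injective, hy']
        exact ((u⁻¹ : (𝓞 L)ˣ) : 𝓞 L).2
      have h5 : y * y' = 1 := by
        apply (algebraMap K L).injective
        rw [map_mul, hy, hy', coe_unitIncl, map_one]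
        norm_cast; simp
      refine ⟨⟨⟨y, hi⟩, ⟨y', hi'⟩, RingOfIntegers.ext h5,
        RingOfIntegers.ext ((mul_comm _ _).trans h5)⟩, ?_⟩
      ext
      rw [hφ]; exact hy
  have hidx : (normUnits δ).index = (twistedNorm τ).range.relIndex (f.ker ⊓ fixedBy τ) := by
    rw [← hφr, ← Subgroup.index_comap]
    congr 1
    ext u
    rw [mem_normUnits, Subgroup.mem_comap]
    have key : ∀ a b : K, (algebraMap K L a + algebraMap K L b * s) *
        σ (algebraMap K L a + algebraMap K L b * s) = algebraMap K L (a ^ 2 - δ * b ^ 2) := by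
      intro a b
      simp only [map_add, map_mul, AlgEquiv.commutes, hσs, map_sub, map_pow]
      linear_combination (-(algebraMap K L b) ^ 2) * hs
    constructor
    · rintro ⟨a, b, h⟩
      have h1 : algebraMap K L a + algebraMap K L b * s ≠ 0 := by
        intro h0
        have := key a b
        rw [h0, zero_mul, ← h, eq_comm, map_eq_zero] at this
        exact u.ne_zero (RingOfIntegers.ext this)
      refine ⟨Units.mk0 _ h1, ?_⟩
      ext
      rw [twistedNorm_apply, Units.val_mul, hτ, Units.val_mk0, key, hφ, h]
    · rintro ⟨x, hx⟩
      obtain ⟨a, b, hab⟩ := hspan x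
      refine ⟨a, b, (algebraMap K L).injective ?_⟩
      rw [← key, ← hab, ← hφ, ← hx]; rfl
  have h3 : Module.finrank ℤ (Additive f.ker) = Module.finrank ℤ (Additive (𝓞 L)ˣ) ∧
      Module.Finite ℤ (Additive f.ker) := by
    let e : Additive (𝓞 L)ˣ ≃ₗ[ℤ] Additive (unitIncl L).range :=
      (MonoidHom.ofInjective (unitIncl_injective (K := L))).toAdditive.toIntLinearEquiv
    change Module.finrank ℤ (Additive (toPrincipalIdeal (𝓞 L) L).ker) = _ ∧
      Module.Finite ℤ (Additive (toPrincipalIdeal (𝓞 L) L).ker)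
    rw [← range_unitIncl]
    exact ⟨e.finrank_eq.symm, Module.Finite.equiv e⟩
  have h4 : Module.finrank ℤ (Additive (f.ker ⊓ fixedBy τ : Subgroup Lˣ)) =
      Module.finrank ℤ (Additive (𝓞 K)ˣ) ∧
      Module.Finite ℤ (Additive (f.ker ⊓ fixedBy τ : Subgroup Lˣ)) := by
    let e : Additive (𝓞 K)ˣ ≃ₗ[ℤ] Additive φ.range :=
      (MonoidHom.ofInjective hφi).toAdditive.toIntLinearEquiv
    rw [← hφr]
    exact ⟨e.finrank_eq.symm, Module.Finite.equiv e⟩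
  have := h3.2
  have := h4.2
  have hrank : Module.finrank ℤ (Additive (𝓞 L)ˣ) =
      2 * Module.finrank ℤ (Additive (𝓞 K)ˣ) + 1 := by
    have a1 := finrank_units_of_isTotallyComplex (K := K)
    have a2 := finrank_units_of_isTotallyComplex (K := L)
    rw [← Module.finrank_mul_finrank ℚ K L, h2, ← a1] at a2
    omega
  rw [hidx, ← relIndex_sqrtSubgroup_eq, ← relIndex_base_fixedBy h2 σ hσ hfin]
  refine ambiguous_class_formula_units τ (idealConj σ) (fun x => ?_)
    (idealConj_idealConj h2 σ hσ) f (fun x => ?_) (fun x hx => ?_)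
    (exists_ideal_eq_div_of_mul_conj_eq_one σ) (baseIdeals K L)
    (fun J hJ => idealConj_of_mem_base σ hJ) (mul_idealConj_mem h2 σ hσ)
    (classNumber K) hK ?_ ?_ _ (h3.1.trans hrank) h4.1 (-1) ?_ ?_ ?_ ?_ ?_
  · ext; exact gal_involutive h2 σ hσ x
  · exact (idealExt_toPrincipalIdeal _ x).symm
  · obtain ⟨y, hy⟩ := exists_eq_div_of_mul_conj_eq_one h2 σ hσ x (congrArg Units.val hx)
    exact ⟨y, by ext; rw [hy, Units.val_div_eq_div_val, hτ]⟩
  · rintro _ ⟨J, rfl⟩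
    obtain ⟨x, hx⟩ := exists_toPrincipalIdeal_eq_pow J
    refine ⟨Units.map (algebraMap K L) x, ?_, ?_⟩
    · ext; rw [hτ]; exact σ.commutes _
    · rw [← idealExt_toPrincipalIdeal, hx, map_pow]
  · intro x hx
    obtain ⟨y, hy⟩ := mem_range_of_gal_fixed h2 σ hσ _ (congrArg Units.val hx)
    have hy0 : y ≠ 0 := by rintro rfl; exact x.ne_zero (by rw [← hy, map_zero])
    refine ⟨toPrincipalIdeal (𝓞 K) K (Units.mk0 y hy0), ?_⟩
    rw [idealExt_toPrincipalIdeal]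
    congr 1
    ext; exact hy
  · change (-1 : Lˣ) ∈ (toPrincipalIdeal (𝓞 L) L).ker
    rw [← range_unitIncl]
    exact ⟨-1, by ext; simp [coe_unitIncl]⟩
  · ext; simp [hτ]
  · intro h
    have := congrArg Units.val h
    simp only [Units.val_neg, Units.val_one] at this
    norm_num at this
  · simp
  · intro x _ hx
    rcases sq_eq_one_iff.1 (congrArg Units.val hx) with h | h
    · exact Or.inl (Units.ext h)
    · exact Or.inr (Units.ext h)

end Chevalley

section QuadraticField

variable {K L : Type*} [Field K] [NumberField K] [Field L] [NumberField L] [Algebra K L]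

/-- The extension `L` is generated over `K` by a square root `s` of the nonsquare `δ`. -/
structure IsSqrtExt (δ : K) (s : L) : Prop where
  sq_eq : s ^ 2 = algebraMap K L δ
  not_isSquare : ¬ IsSquare δ
  adjoin_eq : IntermediateField.adjoin K {s} = ⊤

lemma IsSqrtExt.finrank_eq {δ : K} {s : L} (h : IsSqrtExt δ s) : Module.finrank K L = 2 := by
  have hirr : Irreducible (Polynomial.X ^ 2 - Polynomial.C δ) :=
    X_pow_sub_C_irreducible_of_prime Nat.prime_two fun b hb =>
      h.not_isSquare ⟨b, by rw [← hb, pow_two]⟩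
  have hmin : Polynomial.X ^ 2 - Polynomial.C δ = minpoly K s :=
    minpoly.eq_of_irreducible_of_monic hirr (by simp [h.sq_eq])
      (Polynomial.monic_X_pow_sub_C δ two_ne_zero)
  rw [← IntermediateField.finrank_top', ← h.adjoin_eq,
    IntermediateField.adjoin.finrank (Algebra.IsIntegral.isIntegral s), ← hmin,
    Polynomial.natDegree_X_pow_sub_C]

lemma IsSqrtExt.isGalois {δ : K} {s : L} (h : IsSqrtExt δ s) : IsGalois K L := by
  have : Algebra.IsQuadraticExtension K L := { finrank_eq_two' := h.finrank_eq }
  infer_instance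

lemma IsSqrtExt.exists_conj {δ : K} {s : L} (h : IsSqrtExt δ s) :
    ∃ σ : L ≃ₐ[K] L, σ ≠ 1 ∧ σ s = -s := by
  have := h.isGalois
  by_contra! hc
  have hfix : ∀ σ : L ≃ₐ[K] L, σ s = s := by
    intro σ
    by_cases h1 : σ = 1
    · rw [h1]; rfl
    · have h3 : (σ s) ^ 2 = s ^ 2 := by rw [← map_pow, h.sq_eq, AlgEquiv.commutes]
      exact (sq_eq_sq_iff_eq_or_eq_neg.1 h3).resolve_right (hc σ h1)
  obtain ⟨y, hy⟩ := IntermediateField.mem_bot.1 ((IsGalois.mem_bot_iff_fixed (F := K) s).2 hfix)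
  refine h.not_isSquare ⟨y, (algebraMap K L).injective ?_⟩
  rw [← h.sq_eq, ← hy, map_mul, pow_two]

omit [NumberField K] [NumberField L] in
lemma IsSqrtExt.ne_zero {δ : K} {s : L} (h : IsSqrtExt δ s) : s ≠ 0 := by
  rintro rfl
  refine h.not_isSquare ⟨0, ?_⟩
  have := h.sq_eq
  rw [zero_pow two_ne_zero, eq_comm, map_eq_zero] at this
  rw [this, zero_mul]

lemma IsSqrtExt.exists_eq_add {δ : K} {s : L} (h : IsSqrtExt δ s) (x : L) :
    ∃ a b : K, x = algebraMap K L a + algebraMap K L b * s := by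
  have := h.isGalois
  obtain ⟨σ, hσ, hs⟩ := h.exists_conj
  have h0 := h.ne_zero
  have hi := gal_involutive h.finrank_eq σ hσ
  obtain ⟨a, ha⟩ := mem_range_of_gal_fixed h.finrank_eq σ hσ ((x + σ x) / 2) (by
    rw [map_div₀, map_add, hi, map_ofNat, add_comm])
  obtain ⟨b, hb⟩ := mem_range_of_gal_fixed h.finrank_eq σ hσ ((x - σ x) / (2 * s)) (by
    rw [map_div₀, map_sub, hi, map_mul, map_ofNat, hs]
    field_simp
    ring)
  refine ⟨a, b, ?_⟩
  rw [ha, hb]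
  field_simp
  ring

lemma sub_mem_of_mem_ramSet [IsGalois K L] (h2 : Module.finrank K L = 2) (σ : L ≃ₐ[K] L)
    (hσ : σ ≠ 1) {v : HeightOneSpectrum (𝓞 L)} (hv : v ∈ ramSet K L) (α : 𝓞 L) :
    RingOfIntegers.mapRingHom ((σ : L ≃+* L) : L →+* L) α - α ∈ v.asIdeal := by
  have h1 : v.asIdeal.LiesOver (underPrime K v).asIdeal := ⟨rfl⟩
  have hfin : Finite (𝓞 K ⧸ (underPrime K v).asIdeal) :=
    Ring.HasFiniteQuotients.finiteQuotient (underPrime K v).ne_bot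
  have hmax := (underPrime K v).isMaximal
  have hI := Ideal.card_inertia_eq_ramificationIdxIn (G := L ≃ₐ[K] L) (underPrime K v).asIdeal
    v.asIdeal
  rw [Ideal.ramificationIdxIn_eq_ramificationIdx
    (underPrime K v).asIdeal v.asIdeal (L ≃ₐ[K] L)] at hI
  have h3 : ramExp K v = 2 := hv
  rw [ramExp_eq] at h3
  have h4 : Nat.card (v.asIdeal.inertia (L ≃ₐ[K] L)) = 2 := by rw [hI]; exact_mod_cast h3
  obtain ⟨x, y, hxy, -⟩ := Nat.card_eq_two_iff.1 h4
  have h5 : σ ∈ v.asIdeal.inertia (L ≃ₐ[K] L) := by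
    rcases gal_eq_one_or h2 σ hσ x.1 with hx | hx
    · rcases gal_eq_one_or h2 σ hσ y.1 with hy | hy
      · exact absurd (Subtype.ext (hx.trans hy.symm)) hxy
      · exact hy ▸ y.2
    · exact hx ▸ x.2
  exact h5 α

/-- The square root as an algebraic integer. -/
def sqrtInt {δ : 𝓞 K} {s : L} (h : IsSqrtExt (δ : K) s) : 𝓞 L :=
  ⟨s, by
    apply IsIntegral.of_pow two_pos
    rw [h.sq_eq]
    exact δ.2.map (algebraMap K L).toIntAlgHom⟩

lemma mem_of_sq_sub_eq_of_mem_ramSet {δ : 𝓞 K} {s : L} (h : IsSqrtExt (δ : K) s)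
    {v : HeightOneSpectrum (𝓞 L)} (hv : v ∈ ramSet K L) (a c : 𝓞 K) (hac : a ^ 2 - δ = 4 * c) :
    δ ∈ (underPrime K v).asIdeal := by
  have := h.isGalois
  obtain ⟨σ, hσ, hs⟩ := h.exists_conj
  let α : L := (algebraMap K L a + s) / 2
  have hac' : ((a : 𝓞 K) : K) ^ 2 - δ = 4 * (c : K) := congrArg (algebraMap (𝓞 K) K) hac
  have hα : IsIntegral (𝓞 K) α := by
    refine ⟨Polynomial.X ^ 2 - Polynomial.C a * Polynomial.X + Polynomial.C c, by monicity!, ?_⟩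
    have h1 : (algebraMap K L a) ^ 2 - s ^ 2 = 4 * algebraMap K L c := by
      rw [h.sq_eq, ← map_pow, ← map_sub, hac', map_mul, map_ofNat]
    simp only [Polynomial.eval₂_add, Polynomial.eval₂_sub, Polynomial.eval₂_mul,
      Polynomial.eval₂_pow, Polynomial.eval₂_X, Polynomial.eval₂_C]
    rw [IsScalarTower.algebraMap_apply (𝓞 K) K L, IsScalarTower.algebraMap_apply (𝓞 K) K L]
    simp only [α]
    field_simp
    linear_combination (-1) * h1
  have h3 := sub_mem_of_mem_ramSet h.finrank_eq σ hσ hv ⟨α, isIntegral_trans α hα⟩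
  have h4 : (RingOfIntegers.mapRingHom ((σ : L ≃+* L) : L →+* L) ⟨α, isIntegral_trans α hα⟩ -
      ⟨α, isIntegral_trans α hα⟩ : 𝓞 L) = - sqrtInt h := by
    apply RingOfIntegers.ext
    change σ α - α = -s
    simp only [α]
    rw [map_div₀, map_add, AlgEquiv.commutes, map_ofNat, hs]
    ring
  rw [h4, neg_mem_iff] at h3
  have h5 : (sqrtInt h) ^ 2 = algebraMap (𝓞 K) (𝓞 L) δ := RingOfIntegers.ext h.sq_eq
  change algebraMap (𝓞 K) (𝓞 L) δ ∈ v.asIdeal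
  rw [← h5]
  exact Ideal.pow_mem_of_mem _ h3 2 two_pos

lemma mem_of_mem_ramSet {δ : 𝓞 K} {s : L} (h : IsSqrtExt (δ : K) s)
    {v : HeightOneSpectrum (𝓞 L)} (hv : v ∈ ramSet K L) :
    2 ∈ (underPrime K v).asIdeal ∨ δ ∈ (underPrime K v).asIdeal := by
  have := h.isGalois
  obtain ⟨σ, hσ, hs⟩ := h.exists_conj
  have h3 := sub_mem_of_mem_ramSet h.finrank_eq σ hσ hv (sqrtInt h)
  have h4 : (RingOfIntegers.mapRingHom ((σ : L ≃+* L) : L →+* L) (sqrtInt h) -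
      sqrtInt h : 𝓞 L) = - (2 * sqrtInt h) := by
    apply RingOfIntegers.ext
    change σ s - s = -(2 * s)
    rw [hs]; ring
  rw [h4, neg_mem_iff] at h3
  rcases v.isPrime.mem_or_mem h3 with h6 | h6
  · left
    change algebraMap (𝓞 K) (𝓞 L) 2 ∈ v.asIdeal
    rwa [map_ofNat]
  · right
    have h5 : (sqrtInt h) ^ 2 = algebraMap (𝓞 K) (𝓞 L) δ := RingOfIntegers.ext h.sq_eq
    change algebraMap (𝓞 K) (𝓞 L) δ ∈ v.asIdeal
    rw [← h5]
    exact Ideal.pow_mem_of_mem _ h6 2 two_pos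

lemma underPrime_injOn_ramSet [IsGalois K L] (h2 : Module.finrank K L = 2) :
    Set.InjOn (underPrime K) (ramSet K L) := by
  intro v hv w _ hvw
  by_cases hσ : ∃ σ : L ≃ₐ[K] L, σ ≠ 1
  · obtain ⟨σ, hσ⟩ := hσ
    rcases eq_or_eq_conjPrime h2 σ hσ hvw.symm with h | h
    · exact h.symm
    · exact (h.trans (conjPrime_of_mem_ramSet h2 σ hv)).symm
  · push Not at hσ
    have hc : Nat.card (L ≃ₐ[K] L) = 2 := by rw [IsGalois.card_aut_eq_finrank, h2]
    obtain ⟨x, y, hxy, -⟩ := Nat.card_eq_two_iff.1 hc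
    exact absurd ((hσ x).trans (hσ y).symm) hxy

/-- The order of an element at a prime. -/
noncomputable def elemOrd (v : HeightOneSpectrum (𝓞 K)) (x : Kˣ) : ℤ :=
  ord v (toPrincipalIdeal (𝓞 K) K x)

lemma elemOrd_mul (v : HeightOneSpectrum (𝓞 K)) (x y : Kˣ) :
    elemOrd v (x * y) = elemOrd v x + elemOrd v y := by simp [elemOrd]

lemma elemOrd_pow (v : HeightOneSpectrum (𝓞 K)) (x : Kˣ) (k : ℕ) :
    elemOrd v (x ^ k) = k * elemOrd v x := by simp [elemOrd]

lemma mem_ramSet_of_odd [IsGalois K L] (h2 : Module.finrank K L = 2) {δ : Kˣ} {s : L}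
    (hs : s ^ 2 = algebraMap K L δ) (v : HeightOneSpectrum (𝓞 L))
    (hodd : Odd (elemOrd (underPrime K v) δ)) : v ∈ ramSet K L := by
  have hs0 : s ≠ 0 := by
    rintro rfl
    rw [zero_pow two_ne_zero, eq_comm, map_eq_zero] at hs
    exact δ.ne_zero hs
  have h1 : Units.mk0 s hs0 ^ 2 = Units.map (algebraMap K L : K →* L) δ := Units.ext hs
  have h3 := elemOrd_pow v (Units.mk0 s hs0) 2
  rw [h1, elemOrd, ← idealExt_toPrincipalIdeal, ord_idealExt] at h3
  rcases ramExp_eq_one_or_two (K := K) h2 v with h | h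
  · rw [h, one_mul] at h3
    rw [elemOrd, h3] at hodd
    exact absurd hodd (Int.not_odd_iff_even.2 (even_two_mul _))
  · exact h

omit [NumberField L] in
lemma exists_underPrime_eq (P : HeightOneSpectrum (𝓞 K)) :
    ∃ v : HeightOneSpectrum (𝓞 L), underPrime K v = P := by
  obtain ⟨Q, -, hQ, hQP⟩ := Ideal.exists_ideal_over_prime_of_isIntegral P.asIdeal (⊥ : Ideal (𝓞 L))
    (by rw [Ideal.comap_bot_of_injective _ (FaithfulSMul.algebraMap_injective _ _)]; exact bot_le)
  refine ⟨⟨Q, hQ, ?_⟩, HeightOneSpectrum.ext hQP⟩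
  rintro rfl
  rw [Ideal.comap_bot_of_injective _ (FaithfulSMul.algebraMap_injective _ _)] at hQP
  exact P.ne_bot hQP.symm

lemma ramSet_finite_of_maps [IsGalois K L] (h2 : Module.finrank K L = 2)
    {T : Set (HeightOneSpectrum (𝓞 K))} (hT : T.Finite)
    (h : ∀ v ∈ ramSet K L, underPrime K v ∈ T) : (ramSet K L).Finite :=
  hT.of_injOn h (underPrime_injOn_ramSet h2)

lemma ncard_ramSet_le [IsGalois K L] (h2 : Module.finrank K L = 2)
    {T : Set (HeightOneSpectrum (𝓞 K))} (hT : T.Finite)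
    (h : ∀ v ∈ ramSet K L, underPrime K v ∈ T) : (ramSet K L).ncard ≤ T.ncard :=
  Set.ncard_le_ncard_of_injOn _ h (underPrime_injOn_ramSet h2) hT

lemma ncard_ramSet_eq [IsGalois K L] (h2 : Module.finrank K L = 2)
    {T : Set (HeightOneSpectrum (𝓞 K))}
    (h : ∀ v ∈ ramSet K L, underPrime K v ∈ T) {δ : Kˣ} {s : L}
    (hs : s ^ 2 = algebraMap K L δ) (hodd : ∀ P ∈ T, Odd (elemOrd P δ)) :
    (ramSet K L).ncard = T.ncard := by
  refine Set.ncard_congr (fun v _ => underPrime K v) h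
    (fun v w hv hw hvw => underPrime_injOn_ramSet h2 hv hw hvw) fun P hP => ?_
  obtain ⟨v, rfl⟩ := exists_underPrime_eq (L := L) P
  exact ⟨v, mem_ramSet_of_odd h2 hs v (hodd _ hP), rfl⟩

/-- Chevalley's formula for the extension generated by a square root. -/
theorem IsSqrtExt.classSquareIndex_mul_index [IsTotallyComplex K] (hK : Odd (classNumber K))
    {δ : K} {s : L} (h : IsSqrtExt δ s) (hfin : (ramSet K L).Finite) :
    2 * classSquareIndex L * (normUnits δ).index = 2 ^ (ramSet K L).ncard := by
  have := h.isGalois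
  obtain ⟨σ, hσ, hs⟩ := h.exists_conj
  exact _root_.classSquareIndex_mul_index h.finrank_eq σ hσ hK hfin δ s h.sq_eq hs h.exists_eq_add

end QuadraticField

section CyclotomicTwoPower

universe u

lemma exists_isSqrtExt {K : Type u} [Field K] [NumberField K] {δ : K} (hδ : ¬ IsSquare δ) :
    ∃ (L : Type u) (_ : Field L) (_ : NumberField L) (_ : Algebra K L) (s : L), IsSqrtExt δ s := by
  have hirr : Irreducible (Polynomial.X ^ 2 - Polynomial.C δ) :=
    X_pow_sub_C_irreducible_of_prime Nat.prime_two fun b hb => hδ ⟨b, by rw [← hb, pow_two]⟩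
  have : Fact (Irreducible (Polynomial.X ^ 2 - Polynomial.C δ)) := ⟨hirr⟩
  have hf : FiniteDimensional K (AdjoinRoot (Polynomial.X ^ 2 - Polynomial.C δ)) :=
    (AdjoinRoot.powerBasis hirr.ne_zero).finite
  have : CharZero (AdjoinRoot (Polynomial.X ^ 2 - Polynomial.C δ)) :=
    charZero_of_injective_algebraMap
      (algebraMap K (AdjoinRoot (Polynomial.X ^ 2 - Polynomial.C δ))).injective
  have : NumberField (AdjoinRoot (Polynomial.X ^ 2 - Polynomial.C δ)) :=
    { to_finiteDimensional := FiniteDimensional.trans ℚ K _ }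
  refine ⟨AdjoinRoot (Polynomial.X ^ 2 - Polynomial.C δ), inferInstance, this, inferInstance,
    AdjoinRoot.root _, ?_, hδ, ?_⟩
  · have := AdjoinRoot.eval₂_root (Polynomial.X ^ 2 - Polynomial.C δ)
    rw [Polynomial.eval₂_sub, Polynomial.eval₂_pow, Polynomial.eval₂_X, Polynomial.eval₂_C,
      sub_eq_zero] at this
    exact this
  · rw [← top_le_iff]
    intro x _
    have hx : x ∈ Algebra.adjoin K {AdjoinRoot.root (Polynomial.X ^ 2 - Polynomial.C δ)} := by
      rw [AdjoinRoot.adjoinRoot_eq_top]; trivial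
    exact IntermediateField.algebra_adjoin_le_adjoin K _ hx

/-- A bound for the index of norms among units in terms of the primes that may ramify. -/
lemma normUnits_index_le {K : Type u} [Field K] [NumberField K] [IsTotallyComplex K]
    (hK : Odd (classNumber K)) {δ : 𝓞 K} (hδ : ¬ IsSquare (δ : K))
    {T : Set (HeightOneSpectrum (𝓞 K))} (hT : T.Finite)
    (h : ∀ P : HeightOneSpectrum (𝓞 K), 2 ∈ P.asIdeal ∨ δ ∈ P.asIdeal → P ∈ T) :
    (normUnits (δ : K)).index ≠ 0 ∧ 2 * (normUnits (δ : K)).index ≤ 2 ^ T.ncard := by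
  obtain ⟨L, _, _, _, s, hs⟩ := exists_isSqrtExt hδ
  have := hs.isGalois
  have hsub : ∀ v ∈ ramSet K L, underPrime K v ∈ T := fun v hv => h _ (mem_of_mem_ramSet hs hv)
  have hfin := ramSet_finite_of_maps hs.finrank_eq hT hsub
  have h1 := hs.classSquareIndex_mul_index hK hfin
  have h2 : 2 ^ (ramSet K L).ncard ≤ 2 ^ T.ncard :=
    Nat.pow_le_pow_right two_pos (ncard_ramSet_le hs.finrank_eq hT hsub)
  have h3 : 2 ^ (ramSet K L).ncard ≠ 0 := by positivity
  rw [← h1] at h2 h3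
  refine ⟨right_ne_zero_of_mul h3, le_trans ?_ h2⟩
  have h4 : 1 ≤ classSquareIndex L :=
    Nat.one_le_iff_ne_zero.2 (right_ne_zero_of_mul (left_ne_zero_of_mul h3))
  nlinarith

/-- The set of primes above two. -/
def primesAboveTwo (K : Type*) [Field K] [NumberField K] : Set (HeightOneSpectrum (𝓞 K)) :=
  {P | 2 ∈ P.asIdeal}

lemma liesOver_span_natCast {K : Type*} [Field K] [NumberField K] (p : ℕ) (hp : p.Prime)
    (P : HeightOneSpectrum (𝓞 K)) (h : (p : 𝓞 K) ∈ P.asIdeal) :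
    P.asIdeal.LiesOver (Ideal.span {(p : ℤ)}) := by
  constructor
  have hmax : (Ideal.span {(p : ℤ)}).IsMaximal :=
    ((Ideal.span_singleton_prime (by exact_mod_cast hp.ne_zero)).2
      (Nat.prime_iff_prime_int.1 hp)).isMaximal (by simpa using hp.ne_zero)
  refine hmax.eq_of_le (Ideal.IsPrime.ne_top inferInstance) ?_
  rw [Ideal.span_singleton_le_iff_mem]
  change algebraMap ℤ (𝓞 K) p ∈ P.asIdeal
  simpa using h

variable {K : Type*} [Field K] [NumberField K]

lemma primesAboveTwo_subsingleton (k : ℕ) [IsCyclotomicExtension {2 ^ (k + 1)} ℚ K] :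
    (primesAboveTwo K).Subsingleton := by
  have : Fact (Nat.Prime 2) := ⟨Nat.prime_two⟩
  have hζ := IsCyclotomicExtension.zeta_spec (2 ^ (k + 1)) ℚ K
  have key : ∀ P ∈ primesAboveTwo K, P.asIdeal = Ideal.span {hζ.toInteger - 1} := by
    intro P hP
    have : P.asIdeal.LiesOver (Ideal.span {((2 : ℕ) : ℤ)}) :=
      liesOver_span_natCast 2 Nat.prime_two P hP
    exact IsCyclotomicExtension.Rat.eq_span_zeta_sub_one_of_liesOver 2 k K hζ P.asIdeal
  intro P hP Q hQ
  exact HeightOneSpectrum.ext ((key P hP).trans (key Q hQ).symm)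

lemma odd_classNumber_four [IsCyclotomicExtension {4} ℚ K] : Odd (classNumber K) := by
  have : IsPrincipalIdealRing (𝓞 K) := by
    apply RingOfIntegers.isPrincipalIdealRing_of_abs_discr_lt
    have h4 : Nat.totient 4 = 2 := rfl
    have hd : |NumberField.discr K| = 4 := by
      have : IsCyclotomicExtension {2 ^ (1 + 1)} ℚ K := by norm_num; assumption
      have : Fact (Nat.Prime 2) := ⟨Nat.prime_two⟩
      rw [IsCyclotomicExtension.Rat.discr_prime_pow_succ 2 1 K]
      norm_num
    rw [hd, IsCyclotomicExtension.finrank (n := 4) K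
      (Polynomial.cyclotomic.irreducible_rat (by simp)),
      IsCyclotomicExtension.Rat.nrComplexPlaces_eq_totient_div_two 4, h4]
    norm_num [Nat.factorial]
    nlinarith [Real.pi_gt_three]
  rw [classNumber_eq_one_iff.2 this]
  exact odd_one

lemma IsPrimitiveRoot.intermediateField_adjoin_eq_top {n : ℕ} [NeZero n] {L : Type*} [Field L]
    [NumberField L] [IsCyclotomicExtension {n} ℚ L] {ζ : L} (hζ : IsPrimitiveRoot ζ n) :
    IntermediateField.adjoin ℚ {ζ} = ⊤ := by
  rw [← top_le_iff]
  intro x _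
  have hx : x ∈ Algebra.adjoin ℚ {ζ} := by
    rw [IsCyclotomicExtension.adjoin_primitive_root_eq_top hζ]; trivial
  exact IntermediateField.algebra_adjoin_le_adjoin ℚ _ hx

lemma isSqrtExt_adjoin_sq {n : ℕ} (hn : 1 ≤ n) {L : Type*} [Field L] [NumberField L]
    [IsCyclotomicExtension {2 ^ (n + 1)} ℚ L] {ζ : L} (hζ : IsPrimitiveRoot ζ (2 ^ (n + 1))) :
    ∃ (K : IntermediateField ℚ L) (δ : 𝓞 K), IsUnit δ ∧ IsCyclotomicExtension {2 ^ n} ℚ K ∧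
      IsSqrtExt (δ : K) ζ := by
  have hζ2 : IsPrimitiveRoot (ζ ^ 2) (2 ^ n) := hζ.pow (by positivity) (by ring)
  let K := IntermediateField.adjoin ℚ {ζ ^ 2}
  have hc : IsCyclotomicExtension {2 ^ n} ℚ K :=
    hζ2.intermediateField_adjoin_isCyclotomicExtension ℚ
  let z : K := ⟨ζ ^ 2, IntermediateField.subset_adjoin ℚ _ rfl⟩
  have hz : IsPrimitiveRoot z (2 ^ n) :=
    IsPrimitiveRoot.of_map_of_injective (f := algebraMap K L) hζ2 (algebraMap K L).injective
  have htop : IntermediateField.adjoin K {ζ} = ⊤ := by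
    have h1 : IntermediateField.adjoin ℚ {ζ} = ⊤ :=
      hζ.intermediateField_adjoin_eq_top
    rw [← IntermediateField.restrictScalars_eq_top_iff (K := ℚ), ← top_le_iff, ← h1,
      IntermediateField.adjoin_le_iff]
    rintro _ rfl
    exact IntermediateField.subset_adjoin K _ rfl
  refine ⟨K, hz.toInteger, hz.toInteger_isPrimitiveRoot.isUnit (by positivity), hc, rfl, ?_, htop⟩
  rintro ⟨y, hy⟩
  have h1 : ζ ^ 2 = (algebraMap K L y) ^ 2 := by
    rw [pow_two (algebraMap K L y), ← map_mul, ← hy]; rfl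
  have hmem : ζ ∈ K := by
    rcases sq_eq_sq_iff_eq_or_eq_neg.1 h1 with h | h
    · rw [h]; exact y.2
    · rw [h]; exact neg_mem y.2
  have hKtop : K = ⊤ := by
    have h1 : IntermediateField.adjoin ℚ {ζ} = ⊤ :=
      hζ.intermediateField_adjoin_eq_top
    rw [← top_le_iff, ← h1, IntermediateField.adjoin_le_iff]
    rintro _ rfl
    exact hmem
  have h2 := IsCyclotomicExtension.finrank (n := 2 ^ (n + 1)) L
    (Polynomial.cyclotomic.irreducible_rat (by positivity))
  have h3 := IsCyclotomicExtension.finrank (n := 2 ^ n) K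
    (Polynomial.cyclotomic.irreducible_rat (by positivity))
  rw [hKtop, IntermediateField.finrank_top', h2, Nat.totient_prime_pow Nat.prime_two (by omega),
    Nat.totient_prime_pow Nat.prime_two (by omega)] at h3
  have := Nat.pow_lt_pow_right (a := 2) (by norm_num) (show n - 1 < n + 1 - 1 by omega)
  omega

/-- The class number of the `2 ^ n`-th cyclotomic field is odd. -/
theorem odd_classNumber_two_pow (n : ℕ) (hn : 2 ≤ n) {K : Type*} [Field K] [NumberField K]
    [IsCyclotomicExtension {2 ^ n} ℚ K] : Odd (classNumber K) := by
  induction n, hn using Nat.le_induction generalizing K with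
  | base =>
    have : IsCyclotomicExtension {4} ℚ K := by assumption
    exact odd_classNumber_four
  | succ n hn ih =>
    obtain ⟨F, δ, hδ, hF, h⟩ := isSqrtExt_adjoin_sq (by omega)
      (IsCyclotomicExtension.zeta_spec (2 ^ (n + 1)) ℚ K)
    have hodd : Odd (classNumber F) := ih
    have := IsCyclotomicExtension.Rat.isTotallyComplex (n := 2 ^ n) F
      (lt_of_lt_of_le (by norm_num) (Nat.pow_le_pow_right two_pos hn))
    have := h.isGalois
    have hsub : ∀ v ∈ ramSet F K, underPrime F v ∈ primesAboveTwo F := fun v hv =>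
      (mem_of_mem_ramSet h hv).resolve_right fun h' =>
        (underPrime F v).isPrime.ne_top (Ideal.eq_top_of_isUnit_mem _ h' hδ)
    obtain ⟨m, rfl⟩ : ∃ m, n = m + 1 := ⟨n - 1, by omega⟩
    have hss := primesAboveTwo_subsingleton (K := F) m
    have hfin := ramSet_finite_of_maps h.finrank_eq hss.finite hsub
    have := hss.finite.to_subtype
    have h1 := h.classSquareIndex_mul_index hodd hfin
    have h2 : (ramSet F K).ncard ≤ 1 :=
      (ncard_ramSet_le h.finrank_eq hss.finite hsub).trans (Set.ncard_le_one_iff_subsingleton.2 hss)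
    apply odd_classNumber_of_classSquareIndex_eq_one
    interval_cases hr : (ramSet F K).ncard
    · rw [mul_assoc] at h1; omega
    · have h3 : classSquareIndex K * (normUnits (δ : F)).index = 1 := by rw [mul_assoc] at h1; omega
      exact Nat.eq_one_of_mul_eq_one_right h3

lemma normUnits_eq_top_of_isUnit {n : ℕ} (hn : 2 ≤ n) [IsCyclotomicExtension {2 ^ n} ℚ K]
    {δ : 𝓞 K} (hδ : IsUnit δ) (hns : ¬ IsSquare (δ : K)) : normUnits (δ : K) = ⊤ := by
  have := IsCyclotomicExtension.Rat.isTotallyComplex (n := 2 ^ n) K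
    (lt_of_lt_of_le (by norm_num) (Nat.pow_le_pow_right two_pos hn))
  obtain ⟨m, rfl⟩ : ∃ m, n = m + 1 := ⟨n - 1, by omega⟩
  have hss := primesAboveTwo_subsingleton (K := K) m
  obtain ⟨h1, h2⟩ := normUnits_index_le (odd_classNumber_two_pow (m + 1) hn) hns hss.finite
    fun P hP => hP.resolve_right fun h' =>
      P.isPrime.ne_top (Ideal.eq_top_of_isUnit_mem _ h' hδ)
  rw [← Subgroup.index_eq_one]
  have := hss.finite.to_subtype
  have h3 : 2 ^ (primesAboveTwo K).ncard ≤ 2 ^ 1 :=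
    Nat.pow_le_pow_right two_pos (Set.ncard_le_one_iff_subsingleton.2 hss)
  omega

end CyclotomicTwoPower

section NormForm

/-- The element `a` is represented by the form `x ^ 2 - b * y ^ 2`. -/
def IsNormForm {K : Type*} [Field K] (a b : K) : Prop := ∃ x y : K, a = x ^ 2 - b * y ^ 2

variable {K : Type*} [Field K]

lemma IsNormForm.mul_left {a a' b : K} (h : IsNormForm a b) (h' : IsNormForm a' b) :
    IsNormForm (a * a') b := by
  obtain ⟨x, y, rfl⟩ := h
  obtain ⟨z, w, rfl⟩ := h'
  exact ⟨x * z + b * y * w, x * w + y * z, by ring⟩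

lemma IsNormForm.symm [CharZero K] {a b : K} (ha : a ≠ 0) (h : IsNormForm a b) :
    IsNormForm b a := by
  obtain ⟨x, y, h⟩ := h
  rcases eq_or_ne y 0 with rfl | hy
  · have hx : x ≠ 0 := by rintro rfl; simp at h; exact ha h
    refine ⟨(b + 1) / 2, (b - 1) / (2 * x), ?_⟩
    rw [h]; field_simp; ring
  · refine ⟨x / y, 1 / y, ?_⟩
    rw [h]; field_simp; ring

lemma IsNormForm.mul_right [CharZero K] {a b c : K} (ha : a ≠ 0) (hb : b ≠ 0) (hc : c ≠ 0)
    (h : IsNormForm a b) (h' : IsNormForm a c) : IsNormForm a (b * c) :=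
  ((h.symm ha).mul_left (h'.symm ha)).symm (mul_ne_zero hb hc)

lemma IsNormForm.of_isSquare [CharZero K] {a b : K} (hb : b ≠ 0) (h : IsSquare b) :
    IsNormForm a b := by
  obtain ⟨c, rfl⟩ := h
  exact IsNormForm.symm hb ⟨c, 0, by ring⟩

lemma IsNormForm.of_mul_sq {a b c : K} (h : IsNormForm a (b * c ^ 2)) : IsNormForm a b := by
  obtain ⟨x, y, rfl⟩ := h
  exact ⟨x, c * y, by ring⟩

/-- The group of `b` for which a fixed `a` is represented by the form `x ^ 2 - b * y ^ 2`. -/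
def normFormGroup [CharZero K] (a : Kˣ) : Subgroup Kˣ where
  carrier := {b | IsNormForm (a : K) b}
  one_mem' := IsNormForm.of_isSquare one_ne_zero ⟨1, by simp⟩
  mul_mem' {b c} h h' := h.mul_right a.ne_zero b.ne_zero c.ne_zero h'
  inv_mem' {b} h := by
    have h1 : IsNormForm (a : K) ((b⁻¹ : Kˣ) * (b : K) ^ 2) := by
      rw [pow_two, ← mul_assoc, Units.inv_mul, one_mul]; exact h
    exact h1.of_mul_sq

end NormForm

section LocalSquares

variable {K : Type*} [Field K] [NumberField K]

lemma valuation_coe (P : HeightOneSpectrum (𝓞 K)) (x : Kˣ) (r : 𝓞 K) (h : (r : K) = x) :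
    P.valuation K (x : K) = WithZero.exp (-elemOrd P x) := by
  have hr : r ≠ 0 := by rintro rfl; simp at h; exact x.ne_zero h.symm
  rw [← h]
  erw [P.valuation_of_algebraMap (K := K) r]
  rw [P.intValuation_if_neg hr]
  congr 2
  rw [elemOrd, ord, coe_toPrincipalIdeal, ← h,
    ← FractionalIdeal.count_coe K P (J := Ideal.span {r}) (by simpa using hr),
    FractionalIdeal.coeIdeal_span_singleton]

lemma not_isSquare_valuation (P : HeightOneSpectrum (𝓞 K)) (x : Kˣ) (r : 𝓞 K) (h : (r : K) = x)
    (hodd : Odd (elemOrd P x)) : ¬ IsSquare (P.valuation K (x : K)) := by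
  rintro ⟨c, hc⟩
  rw [valuation_coe P x r h] at hc
  have hc0 : c ≠ 0 := by rintro rfl; simp at hc
  rw [← WithZero.exp_log hc0, ← WithZero.exp_add, WithZero.exp_inj] at hc
  obtain ⟨k, hk⟩ := hodd
  omega

/-- The group of units of `K` which are squares modulo `P`. -/
def unitsSqMod (P : HeightOneSpectrum (𝓞 K)) : Subgroup (𝓞 K)ˣ :=
  (powMonoidHom 2 : (𝓞 K ⧸ P.asIdeal)ˣ →* _).range.comap
    (Units.map (Ideal.Quotient.mk P.asIdeal : 𝓞 K →* 𝓞 K ⧸ P.asIdeal))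

omit [NumberField K] in
lemma mem_unitsSqMod {P : HeightOneSpectrum (𝓞 K)} {u : (𝓞 K)ˣ} :
    u ∈ unitsSqMod P ↔ ∃ c : 𝓞 K, (u : 𝓞 K) - c ^ 2 ∈ P.asIdeal := by
  constructor
  · rintro ⟨c, hc⟩
    obtain ⟨r, hr⟩ := Ideal.Quotient.mk_surjective (c : 𝓞 K ⧸ P.asIdeal)
    refine ⟨r, Ideal.Quotient.eq.1 ?_⟩
    rw [map_pow, hr]
    exact (congrArg Units.val hc).symm
  · rintro ⟨r, hr⟩
    have h1 := Ideal.Quotient.eq.2 hr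
    rw [map_pow] at h1
    have h2 : IsUnit (Ideal.Quotient.mk P.asIdeal r) := by
      refine isUnit_pow_iff two_ne_zero |>.1 ?_
      rw [← h1]
      exact u.isUnit.map _
    refine ⟨h2.unit, Units.ext ?_⟩
    exact h1.symm

lemma mem_unitsSqMod_of_isNormForm (P : HeightOneSpectrum (𝓞 K)) {δ : K}
    (hδ : ¬ IsSquare (P.valuation K δ)) {u : (𝓞 K)ˣ} (h : IsNormForm ((u : 𝓞 K) : K) δ) :
    u ∈ unitsSqMod P := by
  obtain ⟨x, y, hxy⟩ := h
  have hu : P.valuation K ((u : 𝓞 K) : K) = 1 := by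
    erw [P.valuation_eq_one_iff_notMem]
    exact fun h => P.isPrime.ne_top (Ideal.eq_top_of_isUnit_mem _ h u.isUnit)
  have hsq : ¬ IsSquare (P.valuation K (δ * y ^ 2)) ∨ y = 0 := by
    rcases eq_or_ne y 0 with h | h
    · exact Or.inr h
    refine Or.inl fun ⟨c, hc⟩ => hδ ⟨c / P.valuation K y, ?_⟩
    have : P.valuation K y ≠ 0 := by simpa using h
    rw [map_mul, map_pow] at hc
    rw [div_mul_div_comm, ← hc, ← pow_two, mul_div_cancel_right₀ _ (pow_ne_zero 2 this)]
  have key : P.valuation K x = 1 ∧ P.valuation K (δ * y ^ 2) < 1 := by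
    rcases hsq with hsq | rfl
    · have hne : P.valuation K (x ^ 2) ≠ P.valuation K (-(δ * y ^ 2)) := fun h =>
        hsq ⟨P.valuation K x, by rw [← Valuation.map_neg, ← h, map_pow, pow_two]⟩
      have h1 := Valuation.map_add_of_distinct_val (P.valuation K) hne
      rw [← sub_eq_add_neg, ← hxy, hu, Valuation.map_neg] at h1
      have h2 : P.valuation K (δ * y ^ 2) ≠ 1 := fun h => hsq ⟨1, by rw [h, mul_one]⟩
      rcases max_cases (P.valuation K (x ^ 2)) (P.valuation K (δ * y ^ 2)) with h | h
      · rw [h.1, map_pow] at h1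
        refine ⟨(pow_eq_one_iff_of_nonneg zero_le two_ne_zero).1 h1.symm, lt_of_le_of_ne ?_ h2⟩
        rw [h1, ← map_pow]; exact h.2
      · exact absurd (h1.trans h.1).symm h2
    · refine ⟨(pow_eq_one_iff_of_nonneg zero_le two_ne_zero).1 ?_, by simp⟩
      rw [← map_pow, ← hu, hxy]; simp
  obtain ⟨r, s, hrs⟩ := P.exists_primeCompl_mul_eq_of_integer (K := K) x key.1.le
  have hmem : (s : 𝓞 K) ^ 2 * u - r ^ 2 ∈ P.asIdeal := by
    rw [← P.valuation_lt_one_iff_mem (K := K)]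
    have h1 : algebraMap (𝓞 K) K ((s : 𝓞 K) ^ 2 * u - r ^ 2) =
        -(δ * y ^ 2) * algebraMap (𝓞 K) K s ^ 2 := by
      rw [map_sub, map_mul, map_pow, map_pow, ← hrs]
      change (algebraMap (𝓞 K) K) s ^ 2 * ((u : 𝓞 K) : K) - _ = _
      rw [hxy]; ring
    change P.valuation K (algebraMap (𝓞 K) K ((s : 𝓞 K) ^ 2 * u - r ^ 2)) < 1
    rw [h1, map_mul, Valuation.map_neg, map_pow]
    have h2 : P.valuation K (algebraMap (𝓞 K) K s) ≤ 1 := P.valuation_le_one _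
    exact mul_lt_one_of_lt_of_le key.2 (pow_le_one' h2 2)
  have hmax : P.asIdeal.IsMaximal := P.isMaximal
  obtain ⟨t, i, hi, hti⟩ := hmax.exists_inv s.2
  refine mem_unitsSqMod.2 ⟨r * t, ?_⟩
  have h1 : (u : 𝓞 K) - (r * t) ^ 2 =
      t ^ 2 * ((s : 𝓞 K) ^ 2 * u - r ^ 2) + u * (1 + t * s) * i := by
    linear_combination (-(u : 𝓞 K)) * (1 + t * s) * hti
  rw [h1]
  exact add_mem (Ideal.mul_mem_left _ _ hmem) (Ideal.mul_mem_left _ _ hi)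

end LocalSquares

section NormUnitsCyclotomic

variable {K : Type*} [Field K] [NumberField K]

/-- A generator of an odd power of a prime. -/
lemma exists_generator_pow (P : HeightOneSpectrum (𝓞 K)) :
    ∃ (π : Kˣ) (r : 𝓞 K), (r : K) = π ∧
      toPrincipalIdeal (𝓞 K) K π = primeUnit P ^ classNumber K ∧
      ∀ Q : HeightOneSpectrum (𝓞 K), r ∈ Q.asIdeal → Q = P := by
  obtain ⟨π, hπ⟩ := exists_toPrincipalIdeal_eq_pow (primeUnit P)
  have h1 : FractionalIdeal.spanSingleton (𝓞 K)⁰ (π : K) =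
      ((P.asIdeal ^ classNumber K : Ideal (𝓞 K)) : FractionalIdeal (𝓞 K)⁰ K) := by
    rw [← coe_toPrincipalIdeal, hπ, Units.val_pow_eq_pow_val, FractionalIdeal.coeIdeal_pow]; rfl
  have h2 : (π : K) ∈ FractionalIdeal.spanSingleton (𝓞 K)⁰ (π : K) :=
    FractionalIdeal.mem_spanSingleton_self _ _
  rw [h1] at h2
  obtain ⟨r, hr, hrπ⟩ := FractionalIdeal.mem_coeIdeal _ |>.1 h2
  refine ⟨π, r, hrπ, hπ, fun Q hQ => ?_⟩
  have h3 : Ideal.span {r} = P.asIdeal ^ classNumber K := by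
    rw [← hrπ, ← FractionalIdeal.coeIdeal_span_singleton] at h1
    exact FractionalIdeal.coeIdeal_injective h1
  have h4 : P.asIdeal ^ classNumber K ≤ Q.asIdeal := by
    rw [← h3, Ideal.span_singleton_le_iff_mem]; exact hQ
  have h5 : P.asIdeal ≤ Q.asIdeal := Q.isPrime.le_of_pow_le h4
  exact HeightOneSpectrum.ext (P.isMaximal.eq_of_le Q.isPrime.ne_top h5).symm

variable {n : ℕ}

lemma normUnits_generator_eq (hn : 2 ≤ n) [IsCyclotomicExtension {2 ^ n} ℚ K]
    {P : HeightOneSpectrum (𝓞 K)} (hP : unitsSqMod P ≠ ⊤) {π : Kˣ} {r : 𝓞 K} (hr : (r : K) = π)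
    (hπ : toPrincipalIdeal (𝓞 K) K π = primeUnit P ^ classNumber K)
    (hQ : ∀ Q : HeightOneSpectrum (𝓞 K), r ∈ Q.asIdeal → Q = P) :
    normUnits (π : K) = unitsSqMod P ∧ (unitsSqMod P).index = 2 := by
  have := IsCyclotomicExtension.Rat.isTotallyComplex (n := 2 ^ n) K
    (lt_of_lt_of_le (by norm_num) (Nat.pow_le_pow_right two_pos hn))
  have hodd := odd_classNumber_two_pow n hn (K := K)
  have hord : Odd (elemOrd P π) := by
    rw [elemOrd, hπ, ord_pow, ord_primeUnit_self, mul_one]; exact_mod_cast hodd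
  have hval := not_isSquare_valuation P π r hr hord
  have hns : ¬ IsSquare (r : K) := by
    rintro ⟨c, hc⟩
    exact hval ⟨P.valuation K c, by rw [← hr, hc, map_mul]⟩
  obtain ⟨m, rfl⟩ : ∃ m, n = m + 1 := ⟨n - 1, by omega⟩
  have hss := primesAboveTwo_subsingleton (K := K) m
  have := hss.finite.to_subtype
  obtain ⟨h1, h2⟩ := normUnits_index_le hodd hns (hss.finite.union (Set.finite_singleton P))
    fun Q hQ' => hQ'.imp id fun h => hQ Q h
  have h3 : (primesAboveTwo K ∪ {P}).ncard ≤ 2 := by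
    have := Set.ncard_union_le (primesAboveTwo K) {P}
    have := Set.ncard_le_one_iff_subsingleton.2 hss
    rw [Set.ncard_singleton] at *
    omega
  have h4 : (normUnits (r : K)).index ≤ 2 := by
    have := Nat.pow_le_pow_right two_pos h3
    omega
  rw [hr] at h1 h4
  have hle : normUnits (π : K) ≤ unitsSqMod P := fun u hu =>
    mem_unitsSqMod_of_isNormForm P hval hu
  have h5 := Subgroup.relIndex_mul_index hle
  have h6 : (unitsSqMod P).index ≠ 1 := fun h => hP (Subgroup.index_eq_one.1 h)
  have h7 : (unitsSqMod P).index ≠ 0 := fun h => h1 (by rw [← h5, h, mul_zero])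
  have h8 : (normUnits (π : K)).relIndex (unitsSqMod P) ≠ 0 := fun h =>
    h1 (by rw [← h5, h, zero_mul])
  have h9 : (normUnits (π : K)).relIndex (unitsSqMod P) = 1 := by
    by_contra h
    have h10 : 2 ≤ (normUnits (π : K)).relIndex (unitsSqMod P) := by omega
    have h11 : 2 ≤ (unitsSqMod P).index := by omega
    have := Nat.mul_le_mul h10 h11
    omega
  refine ⟨le_antisymm hle (Subgroup.relIndex_eq_one.1 h9), ?_⟩
  rw [h9, one_mul] at h5
  omega

lemma exists_unit_mul_of_toPrincipalIdeal_eq {x y : Kˣ}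
    (h : toPrincipalIdeal (𝓞 K) K x = toPrincipalIdeal (𝓞 K) K y) :
    ∃ η : (𝓞 K)ˣ, x = unitIncl K η * y := by
  have h1 : x * y⁻¹ ∈ (toPrincipalIdeal (𝓞 K) K).ker := by
    rw [MonoidHom.mem_ker, map_mul, map_inv, h, mul_inv_cancel]
  rw [← range_unitIncl] at h1
  obtain ⟨η, hη⟩ := h1
  exact ⟨η, by rw [hη, inv_mul_cancel_right]⟩

lemma unitIncl_mem_normFormGroup (hn : 2 ≤ n) [IsCyclotomicExtension {2 ^ n} ℚ K]
    (u η : (𝓞 K)ˣ) : unitIncl K η ∈ normFormGroup (unitIncl K u) := by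
  by_cases hs : IsSquare (((η : 𝓞 K)) : K)
  · exact IsNormForm.of_isSquare (unitIncl K η).ne_zero hs
  · have h1 := normUnits_eq_top_of_isUnit hn η.isUnit hs
    have h2 : u ∈ normUnits ((η : 𝓞 K) : K) := by rw [h1]; trivial
    exact h2

/-- A unit is a norm from a quadratic extension of a cyclotomic field of two-power conductor as soon
as it is a square modulo the primes dividing the discriminant. -/
lemma mem_normUnits_of_mem_unitsSqMod (hn : 2 ≤ n) [IsCyclotomicExtension {2 ^ n} ℚ K] {δ : Kˣ}
    (hδ : ∀ P, elemOrd P δ ≠ 0 → unitsSqMod P ≠ ⊤) {u : (𝓞 K)ˣ}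
    (hu : ∀ P, elemOrd P δ ≠ 0 → u ∈ unitsSqMod P) : u ∈ normUnits (δ : K) := by
  set G := normFormGroup (unitIncl K u)
  have hunit : ∀ η, unitIncl K η ∈ G := unitIncl_mem_normFormGroup hn u
  let M : Subgroup (IdealGroup K) :=
    ((G.map (toPrincipalIdeal (𝓞 K) K)).comap (powMonoidHom (classNumber K)))
  have hM : toPrincipalIdeal (𝓞 K) K δ ∈ M := by
    refine mem_of_primeUnit_mem M _ fun P hP => ?_
    obtain ⟨π, r, hr, hπ, hQ⟩ := exists_generator_pow P
    obtain ⟨h1, -⟩ := normUnits_generator_eq hn (hδ P hP) hr hπ hQ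
    have h2 : u ∈ normUnits (π : K) := by rw [h1]; exact hu P hP
    exact ⟨π, h2, hπ⟩
  obtain ⟨y, hy, hyδ⟩ := hM
  have h1 : toPrincipalIdeal (𝓞 K) K (δ ^ classNumber K) = toPrincipalIdeal (𝓞 K) K y := by
    rw [hyδ, map_pow]; rfl
  obtain ⟨η, hη⟩ := exists_unit_mul_of_toPrincipalIdeal_eq h1
  have h2 : δ ^ classNumber K ∈ G := by rw [hη]; exact mul_mem (hunit η) hy
  obtain ⟨k, hk⟩ := odd_classNumber_two_pow n hn (K := K)
  rw [hk, pow_succ', mul_comm 2 k, pow_mul] at h2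
  exact IsNormForm.of_mul_sq (c := ((δ ^ k : Kˣ) : K)) h2

/-- Norms among units for a quadratic extension of a cyclotomic field of two-power conductor. -/
theorem mem_normUnits_iff (hn : 2 ≤ n) [IsCyclotomicExtension {2 ^ n} ℚ K] {δ : Kˣ} {r : 𝓞 K}
    (hr : (r : K) = δ) (hodd : ∀ P, elemOrd P δ ≠ 0 → Odd (elemOrd P δ))
    (hδ : ∀ P, elemOrd P δ ≠ 0 → unitsSqMod P ≠ ⊤) {u : (𝓞 K)ˣ} :
    u ∈ normUnits (δ : K) ↔ ∀ P, elemOrd P δ ≠ 0 → u ∈ unitsSqMod P :=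
  ⟨fun h P hP => mem_unitsSqMod_of_isNormForm P (not_isSquare_valuation P δ r hr (hodd P hP)) h,
    mem_normUnits_of_mem_unitsSqMod hn hδ⟩

end NormUnitsCyclotomic

section FiniteFieldSquares

lemma exists_pow_two_pow_eq {Q : ℕ} (hQ : Q % 16 = 9) (j : ℕ) :
    ∃ b, Odd b ∧ Q ^ 2 ^ j = 1 + 2 ^ (j + 3) * b := by
  induction j with
  | zero => exact ⟨Q / 8, by rw [Nat.odd_iff]; omega, by norm_num; omega⟩
  | succ j ih =>
    obtain ⟨b, hb, h⟩ := ih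
    refine ⟨b + 2 * (2 ^ (j + 1) * b ^ 2), hb.add_even (even_two_mul _), ?_⟩
    rw [pow_succ, pow_mul, h]
    ring

lemma prod_one_add_pow_add_sq {R : Type*} [CommRing R] {Q : ℕ} (hQ : Q % 16 = 9) (k : ℕ) (z : R)
    (hz : z ^ 2 ^ (k + 2) = -1) :
    ∏ j ∈ Finset.range (2 ^ k), (1 + z ^ Q ^ j + (z ^ Q ^ j) ^ 2) =
      1 + z ^ 2 ^ k + (z ^ 2 ^ k) ^ 2 := by
  induction k generalizing z with
  | zero => simp
  | succ k ih =>
    obtain ⟨b, hb, hQk⟩ := exists_pow_two_pow_eq hQ k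
    have h1 : ∀ j, z ^ Q ^ (2 ^ k + j) = -(z ^ Q ^ j) := by
      intro j
      have hQj : Odd (Q ^ j) := Odd.pow (Nat.odd_iff.2 (by omega))
      rw [pow_add, pow_mul, hQk, pow_add, pow_one, pow_mul, show k + 3 = k + 1 + 2 by ring, hz,
        hb.neg_one_pow, mul_neg_one, hQj.neg_pow]
    rw [pow_succ 2 k, mul_two, Finset.prod_range_add, ← Finset.prod_mul_distrib,
      ← mul_two, pow_mul' z (2 ^ k) 2, ← ih (z ^ 2) (by rw [← pow_mul, ← hz]; congr 1; ring)]
    refine Finset.prod_congr rfl fun j _ => ?_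
    rw [h1, ← pow_mul z 2, mul_comm 2, pow_mul]
    ring

lemma pow_half_card {M : Type*} [CommMonoid M] {Q : ℕ} (hQ : Odd Q) (m : ℕ) (a : M) :
    a ^ (Q ^ m / 2) = (∏ j ∈ Finset.range m, a ^ Q ^ j) ^ (Q / 2) := by
  obtain ⟨c, rfl⟩ := hQ
  have h := geom_sum_mul_add (2 * c) m
  rw [Finset.prod_pow_eq_pow_sum, ← pow_mul]
  congr 1
  have h2 : (2 * c + 1) / 2 = c := by omega
  rw [h2, ← h, mul_left_comm]
  omega

variable {k : Type*} [Field k] [Finite k] {p e Q i : ℕ} [CharP k p]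

lemma isSquare_iff_prod_pow (hp : p ≠ 2) (hQ : Q % 16 = 9) (hk : Nat.card k = Q ^ i) {a : k}
    (ha : a ≠ 0) : IsSquare a ↔ (∏ j ∈ Finset.range i, a ^ Q ^ j) ^ (Q / 2) = 1 := by
  have := Fintype.ofFinite k
  rw [FiniteField.isSquare_iff (by rwa [ringChar.eq k p]) ha, ← Nat.card_eq_fintype_card, hk,
    pow_half_card (Nat.odd_iff.2 (by omega))]

/-- A primitive `2 ^ (i + 3)`-th root of unity is not a square in a field with `Q ^ (2 ^ i)`
elements. -/
lemma not_isSquare_root (hp : p ≠ 2) (hQ : Q % 16 = 9) (hk : Nat.card k = Q ^ 2 ^ i) {z : k}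
    (hz : z ^ 2 ^ (i + 2) = -1) : ¬ IsSquare z := by
  have := Fintype.ofFinite k
  have hz0 : z ≠ 0 := by rintro rfl; rw [zero_pow (by positivity)] at hz; simp at hz
  have h2 : ringChar k ≠ 2 := by rwa [ringChar.eq k p]
  obtain ⟨b, hb, hQi⟩ := exists_pow_two_pow_eq hQ i
  rw [FiniteField.isSquare_iff h2 hz0, ← Nat.card_eq_fintype_card, hk, hQi,
    show (1 + 2 ^ (i + 3) * b) / 2 = 2 ^ (i + 2) * b by rw [pow_succ', mul_assoc]; omega,
    pow_mul, hz, hb.neg_one_pow]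
  exact Ring.neg_one_ne_one_of_char_ne_two h2

/-- The quadratic character of `1 + z + z ^ 2`, where `z` is a primitive `2 ^ (i + 3)`-th root of
unity. -/
lemma isSquare_one_add_root_add_sq [Fact p.Prime] (hp : p ≠ 2) (hQ : Q % 16 = 9) (hQp : Q = p ^ e)
    (hk : Nat.card k = Q ^ 2 ^ i) {z : k} (hz : z ^ 2 ^ (i + 2) = -1) (h0 : 1 + z + z ^ 2 ≠ 0) :
    IsSquare (1 + z + z ^ 2) ↔ (2 : k) ^ (Q / 4) = 1 := by
  have h2 : ringChar k ≠ 2 := by rwa [ringChar.eq k p]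
  have hadd : ∀ x y : k, (x + y) ^ Q = x ^ Q + y ^ Q := by
    intro x y; rw [hQp]; exact add_pow_char_pow x y _ _
  have hadd' : ∀ x y : k, ∀ j, (x + y) ^ Q ^ j = x ^ Q ^ j + y ^ Q ^ j := by
    intro x y j; rw [hQp, ← pow_mul]; exact add_pow_char_pow x y _ _
  rw [isSquare_iff_prod_pow hp hQ hk h0]
  have h1 : ∏ j ∈ Finset.range (2 ^ i), (1 + z + z ^ 2) ^ Q ^ j =
      1 + z ^ 2 ^ i + (z ^ 2 ^ i) ^ 2 := by
    rw [← prod_one_add_pow_add_sq hQ i z hz]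
    refine Finset.prod_congr rfl fun j _ => ?_
    rw [hadd', hadd', one_pow, ← pow_mul, ← pow_mul, mul_comm 2]
  rw [h1]
  set y := z ^ 2 ^ i
  have hy4 : y ^ 4 = -1 := by rw [← hz, ← pow_mul]; congr 1; ring
  have hy0 : y ≠ 0 := by intro h; rw [h] at hy4; norm_num at hy4
  have hyQ : y ^ (Q - 1) = 1 := by
    obtain ⟨c, hc⟩ : ∃ c, Q - 1 = 4 * (2 * c) := ⟨Q / 8, by omega⟩
    rw [hc, pow_mul, hy4, pow_mul]; norm_num
  have hy1 : 1 + y ≠ 0 := by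
    intro h
    have : y = -1 := by linear_combination h
    rw [this] at hy4
    exact Ring.neg_one_ne_one_of_char_ne_two h2 (by linear_combination -hy4)
  have h1yQ : (1 + y) ^ (Q - 1) = 1 := by
    have h3 : (1 + y) ^ Q = 1 + y := by
      rw [hadd, one_pow]
      conv_lhs => rw [show Q = Q - 1 + 1 by omega, pow_succ, hyQ, one_mul]
    rw [show Q = Q - 1 + 1 by omega, pow_succ] at h3
    exact mul_right_cancel₀ hy1 (h3.trans (one_mul _).symm)
  have hs : (1 + y + y ^ 2) * (y + y⁻¹) = (1 + y) ^ 2 := by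
    field_simp
    linear_combination hy4
  have hs2 : (y + y⁻¹) ^ 2 = 2 := by
    field_simp
    linear_combination hy4
  have h5 : (1 + y + y ^ 2) ^ (Q / 2) * (2 : k) ^ (Q / 4) = 1 := by
    rw [← hs2, ← pow_mul (y + y⁻¹), show 2 * (Q / 4) = Q / 2 by omega, ← mul_pow, hs, ← pow_mul,
      show 2 * (Q / 2) = Q - 1 by omega, h1yQ]
  constructor
  · intro h; rwa [h, one_mul] at h5
  · intro h; rwa [h, mul_one] at h5

end FiniteFieldSquares

section SplittingInCyclotomic

/-- The exponent `e ∈ {1, 2}` for which `p ^ e ≡ 9 (mod 16)`, when `p ≡ 9 (mod 16)` or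
`p ≡ 3 (mod 8)`. -/
def nineExp (p : ℕ) : ℕ := if p % 8 = 3 then 2 else 1

lemma pow_nineExp_mod {p : ℕ} (h : p % 8 = 3 ∨ p % 16 = 9) : p ^ nineExp p % 16 = 9 := by
  rw [nineExp]
  split_ifs with h3
  · rw [Nat.pow_mod]
    have : p % 16 = 3 ∨ p % 16 = 11 := by omega
    rcases this with h | h <;> simp [h]
  · rw [pow_one]; omega

lemma natCast_pow_eq_one_iff {Q : ℕ} (hQ : 0 < Q) (m k : ℕ) :
    (Q : ZMod m) ^ k = 1 ↔ m ∣ Q ^ k - 1 := by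
  rw [← ZMod.natCast_eq_zero_iff, Nat.cast_sub (Nat.one_le_pow _ _ hQ), sub_eq_zero]
  push_cast
  rfl

lemma orderOf_natCast_of_mod_sixteen {Q : ℕ} (hQ : Q % 16 = 9) (i : ℕ) :
    orderOf (Q : ZMod (2 ^ (i + 3))) = 2 ^ i := by
  have hQ0 : 0 < Q := by omega
  cases i with
  | zero =>
    rw [pow_zero, orderOf_eq_one_iff]
    have := (natCast_pow_eq_one_iff hQ0 8 1).2 (by rw [pow_one]; omega)
    simpa using this
  | succ k =>
    refine orderOf_eq_prime_pow ?_ ?_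
    · rw [natCast_pow_eq_one_iff hQ0]
      obtain ⟨b, hb, h⟩ := exists_pow_two_pow_eq hQ k
      rw [h, Nat.add_sub_cancel_left, show k + 1 + 3 = k + 3 + 1 by ring, pow_succ 2 (k + 3),
        Nat.mul_dvd_mul_iff_left (by positivity)]
      rw [Nat.odd_iff] at hb
      omega
    · rw [natCast_pow_eq_one_iff hQ0]
      obtain ⟨b, hb, h⟩ := exists_pow_two_pow_eq hQ (k + 1)
      rw [h, Nat.add_sub_cancel_left]
      exact dvd_mul_right _ _

lemma orderOf_natCast_eq_nineExp_mul {p : ℕ} (h : p % 8 = 3 ∨ p % 16 = 9) (i : ℕ) :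
    orderOf (p : ZMod (2 ^ (i + 3))) = nineExp p * 2 ^ i := by
  have h1 := orderOf_natCast_of_mod_sixteen (pow_nineExp_mod h) i
  rw [Nat.cast_pow] at h1
  rw [nineExp] at h1 ⊢
  split_ifs at h1 ⊢ with h3
  · have heven : Even (orderOf (p : ZMod (2 ^ (i + 3)))) := by
      by_contra hodd
      rw [Nat.not_even_iff_odd] at hodd
      obtain ⟨c, hc⟩ := hodd
      have h2 := (natCast_pow_eq_one_iff (by omega) _ _).1
        (pow_orderOf_eq_one (p : ZMod (2 ^ (i + 3))))
      rw [hc] at h2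
      have h4 : 8 ∣ p ^ (2 * c + 1) - 1 := (Dvd.intro_left (2 ^ i) (by ring)).trans h2
      have h5 : p ^ (2 * c + 1) % 8 = 3 := by
        rw [Nat.pow_mod, h3, pow_succ, pow_mul, Nat.mul_mod, Nat.pow_mod]
        norm_num
      omega
    have hf : IsOfFinOrder (p : ZMod (2 ^ (i + 3))) := by
      rw [isOfFinOrder_iff_pow_eq_one]
      refine ⟨2 * 2 ^ i, by positivity, ?_⟩
      rw [pow_mul, ← h1, pow_orderOf_eq_one]
    rw [hf.orderOf_pow, Nat.gcd_eq_right heven.two_dvd] at h1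
    have := heven.two_dvd
    omega
  · rwa [pow_one, ← one_mul (2 ^ i)] at h1

variable {K : Type*} [Field K] [NumberField K]
lemma not_dvd_two_pow {p : ℕ} (hp : p.Prime) (h : p % 8 = 3 ∨ p % 16 = 9) (k : ℕ) :
    ¬ p ∣ 2 ^ k := fun hd => by
  have := (Nat.prime_dvd_prime_iff_eq hp Nat.prime_two).1 (hp.dvd_of_dvd_pow hd)
  omega

lemma natCard_residueField (i : ℕ) [IsCyclotomicExtension {2 ^ (i + 3)} ℚ K] {p : ℕ}
    (hp : p.Prime) (h : p % 8 = 3 ∨ p % 16 = 9)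
    (P : HeightOneSpectrum (𝓞 K)) (hP : (p : 𝓞 K) ∈ P.asIdeal) :
    Nat.card (𝓞 K ⧸ P.asIdeal) = (p ^ nineExp p) ^ 2 ^ i := by
  have := Fact.mk hp
  have := liesOver_span_natCast p hp P hP
  have : (Ideal.span {(p : ℤ)}).IsMaximal :=
    Int.ideal_span_isMaximal_of_prime p
  have := P.isMaximal
  have h1 := Ideal.absNorm_eq_pow_inertiaDeg' P.asIdeal hp
  rw [Ideal.inertiaDeg'_eq_inertiaDeg, IsCyclotomicExtension.Rat.inertiaDeg_eq_of_not_dvd p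
    (m := 2 ^ (i + 3)) K P.asIdeal (not_dvd_two_pow hp h _),
    orderOf_natCast_eq_nineExp_mul h, pow_mul] at h1
  rw [← h1, Ideal.absNorm_apply, Submodule.cardQuot_apply]

variable (K) in
lemma ncard_primesOver_natCast (i : ℕ) [IsCyclotomicExtension {2 ^ (i + 3)} ℚ K] {p : ℕ}
    (hp : p.Prime) (h : p % 8 = 3 ∨ p % 16 = 9) :
    {P : HeightOneSpectrum (𝓞 K) | (p : 𝓞 K) ∈ P.asIdeal}.ncard * nineExp p = 4 := by
  have := Fact.mk hp
  have hmax : (Ideal.span {(p : ℤ)}).IsMaximal := Int.ideal_span_isMaximal_of_prime p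
  have hgal : IsGalois ℚ K := IsCyclotomicExtension.isGalois {2 ^ (i + 3)} ℚ K
  have h1 := Ideal.ncard_primesOver_mul_ramificationIdxIn_mul_inertiaDegIn
    (Ideal.span {(p : ℤ)}) (𝓞 K) Gal(K/ℚ)
  have hnd := not_dvd_two_pow hp h (i + 3)
  rw [IsCyclotomicExtension.Rat.ramificationIdxIn_eq_of_not_dvd (m := 2 ^ (i + 3)) p K hnd,
    IsCyclotomicExtension.Rat.inertiaDegIn_eq_of_not_dvd (m := 2 ^ (i + 3)) p K hnd,
    orderOf_natCast_eq_nineExp_mul h, IsGalois.card_aut_eq_finrank,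
    IsCyclotomicExtension.finrank (n := 2 ^ (i + 3)) K (Polynomial.cyclotomic.irreducible_rat
      (by positivity)), Nat.totient_prime_pow_succ Nat.prime_two] at h1
  have himg : (fun P : HeightOneSpectrum (𝓞 K) => P.asIdeal) ''
      {P : HeightOneSpectrum (𝓞 K) | (p : 𝓞 K) ∈ P.asIdeal} =
        (Ideal.span {(p : ℤ)}).primesOver (𝓞 K) := by
    ext J
    constructor
    · rintro ⟨P, hP, rfl⟩
      exact ⟨P.isPrime, liesOver_span_natCast p hp P hP⟩
    · rintro ⟨hJ, hJp⟩
      refine ⟨⟨J, hJ, ?_⟩, ?_, rfl⟩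
      · exact Ideal.ne_bot_of_liesOver_of_ne_bot (p := Ideal.span {(p : ℤ)})
          (by simpa using hp.ne_zero) J
      · have h2 : (p : ℤ) ∈ Ideal.span {(p : ℤ)} := Ideal.mem_span_singleton_self _
        rw [Ideal.mem_of_liesOver J (Ideal.span {(p : ℤ)})] at h2
        simpa using h2
  rw [← himg, Set.ncard_image_of_injective _ fun _ _ => HeightOneSpectrum.ext] at h1
  refine Nat.eq_of_mul_eq_mul_right (show 0 < 2 ^ i by positivity) ?_
  rw [mul_assoc]
  refine Eq.trans ?_ (h1.trans ?_)
  · ring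
  · rw [pow_add]; ring

end SplittingInCyclotomic

section PrimesDividing

variable {K : Type*} [Field K] [NumberField K]

lemma elemOrd_ne_zero_iff (P : HeightOneSpectrum (𝓞 K)) {x : Kˣ} {r : 𝓞 K} (hr : (r : K) = x) :
    elemOrd P x ≠ 0 ↔ r ∈ P.asIdeal := by
  have h := ord_coe_eq_zero P (toPrincipalIdeal (𝓞 K) K x) (Ideal.span {r})
    (by rw [coe_toPrincipalIdeal, FractionalIdeal.coeIdeal_span_singleton, ← hr])
  rw [elemOrd, Ne, h, not_not, Ideal.span_singleton_le_iff_mem]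

lemma elemOrd_natCast_prime (i : ℕ) [IsCyclotomicExtension {2 ^ (i + 3)} ℚ K] {p : ℕ}
    (hp : p.Prime) (h : p % 8 = 3 ∨ p % 16 = 9) (P : HeightOneSpectrum (𝓞 K))
    (hP : (p : 𝓞 K) ∈ P.asIdeal) {x : Kˣ} (hx : (x : K) = p) : elemOrd P x = 1 := by
  have := Fact.mk hp
  have := liesOver_span_natCast p hp P hP
  have hmap : (Ideal.span {(p : ℤ)}).map (algebraMap ℤ (𝓞 K)) = Ideal.span {(p : 𝓞 K)} := by
    rw [Ideal.map_span]; simp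
  have h1 := count_map_eq_ramificationIdx P (Ideal.span {(p : ℤ)})
    (by rw [hmap]; simpa using hp.ne_zero)
  rw [IsCyclotomicExtension.Rat.ramificationIdx_eq_of_not_dvd (m := 2 ^ (i + 3)) p K P.asIdeal
    (not_dvd_two_pow hp h _), hmap, FractionalIdeal.coeIdeal_span_singleton] at h1
  rw [elemOrd, ord, coe_toPrincipalIdeal, hx]
  simpa using h1

omit [NumberField K] in
lemma exists_prime_dvd_mem {d : ℕ} (hd : d ≠ 0) (P : HeightOneSpectrum (𝓞 K))
    (hP : (d : 𝓞 K) ∈ P.asIdeal) : ∃ p : ℕ, p.Prime ∧ p ∣ d ∧ (p : 𝓞 K) ∈ P.asIdeal := by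
  rw [← Nat.prod_primeFactorsList hd] at hP
  push_cast at hP
  obtain ⟨x, hx, hxP⟩ := (P.isPrime.multiset_prod_mem_iff_exists_mem
    (d.primeFactorsList.map (Nat.cast : ℕ → 𝓞 K))).1 (by simpa using hP)
  simp only [Multiset.mem_coe, List.mem_map] at hx
  obtain ⟨p, hp, rfl⟩ := hx
  exact ⟨p, Nat.prime_of_mem_primeFactorsList hp, Nat.dvd_of_mem_primeFactorsList hp, hxP⟩

omit [NumberField K] in
lemma natCast_notMem_of_coprime {a b : ℕ} (hab : a.Coprime b) (P : HeightOneSpectrum (𝓞 K))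
    (ha : (a : 𝓞 K) ∈ P.asIdeal) : (b : 𝓞 K) ∉ P.asIdeal := by
  intro hb
  obtain ⟨u, v, huv⟩ := Nat.isCoprime_iff_coprime.2 hab
  apply P.isPrime.ne_top
  rw [Ideal.eq_top_iff_one]
  have h1 : (u : 𝓞 K) * a + v * b = 1 := by exact_mod_cast congrArg (Int.cast : ℤ → 𝓞 K) huv
  rw [← h1]
  exact add_mem (P.asIdeal.mul_mem_left _ ha) (P.asIdeal.mul_mem_left _ hb)

lemma elemOrd_natCast_squarefree (i : ℕ) [IsCyclotomicExtension {2 ^ (i + 3)} ℚ K] {d : ℕ}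
    (hsf : Squarefree d) (hall : ∀ p : ℕ, p.Prime → p ∣ d → p % 8 = 3 ∨ p % 16 = 9)
    (P : HeightOneSpectrum (𝓞 K)) (hP : (d : 𝓞 K) ∈ P.asIdeal) {x : Kˣ} (hx : (x : K) = d) :
    elemOrd P x = 1 := by
  obtain ⟨p, hp, ⟨c, rfl⟩, hpP⟩ := exists_prime_dvd_mem hsf.ne_zero P hP
  have hc : (c : 𝓞 K) ∉ P.asIdeal :=
    natCast_notMem_of_coprime (Nat.coprime_of_squarefree_mul hsf) P hpP
  have hp0 : (p : K) ≠ 0 := by exact_mod_cast hp.ne_zero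
  have hc0 : (c : K) ≠ 0 := by
    have := hsf.ne_zero
    rintro h0
    norm_cast at h0
    simp [h0] at this
  have hxy : x = Units.mk0 _ hp0 * Units.mk0 _ hc0 := Units.ext (by simp [hx])
  rw [hxy, elemOrd_mul, elemOrd_natCast_prime i hp (hall p hp (dvd_mul_right _ _)) P hpP rfl]
  have h0 := (elemOrd_ne_zero_iff P (x := Units.mk0 _ hc0) (r := (c : 𝓞 K)) (by simp)).not.2 hc
  rw [not_not.1 h0, add_zero]

lemma finite_setOf_mem {r : 𝓞 K} (hr : r ≠ 0) :
    {P : HeightOneSpectrum (𝓞 K) | r ∈ P.asIdeal}.Finite := by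
  have h0 : (r : K) ≠ 0 := by simpa using hr
  refine (finite_ord_ne_zero (toPrincipalIdeal (𝓞 K) K (Units.mk0 _ h0))).subset fun P hP => ?_
  exact (elemOrd_ne_zero_iff P rfl).2 hP

lemma ncard_setOf_natCast_mem {d : ℕ} (hd : d ≠ 0) :
    {P : HeightOneSpectrum (𝓞 K) | (d : 𝓞 K) ∈ P.asIdeal}.ncard =
      ∑ p ∈ d.primeFactors, {P : HeightOneSpectrum (𝓞 K) | (p : 𝓞 K) ∈ P.asIdeal}.ncard := by
  have hfin : ∀ p ∈ d.primeFactors,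
      {P : HeightOneSpectrum (𝓞 K) | (p : 𝓞 K) ∈ P.asIdeal}.Finite := fun p hp =>
    finite_setOf_mem (by exact_mod_cast (Nat.prime_of_mem_primeFactors hp).ne_zero)
  have hU : {P : HeightOneSpectrum (𝓞 K) | (d : 𝓞 K) ∈ P.asIdeal} =
      ⋃ p ∈ d.primeFactors, {P : HeightOneSpectrum (𝓞 K) | (p : 𝓞 K) ∈ P.asIdeal} := by
    ext P
    simp only [Set.mem_ofPred_eq, Set.mem_iUnion]
    constructor
    · intro hP
      obtain ⟨p, hp, hpd, hpP⟩ := exists_prime_dvd_mem hd P hP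
      exact ⟨p, Nat.mem_primeFactors.2 ⟨hp, hpd, hd⟩, hpP⟩
    · rintro ⟨p, hp, hpP⟩
      exact Ideal.mem_of_dvd _ (Nat.cast_dvd_cast (Nat.dvd_of_mem_primeFactors hp)) hpP
  rw [hU]
  have h := d.primeFactors.finite_toSet.ncard_biUnion
    (s := fun p : ℕ => {P : HeightOneSpectrum (𝓞 K) | (p : 𝓞 K) ∈ P.asIdeal})
    (fun p hp => hfin p hp) ?_
  · rw [finsum_mem_coe_finset] at h
    simpa using h
  · intro p hp p' hp' hne
    rw [Function.onFun, Set.disjoint_left]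
    intro P hP
    exact natCast_notMem_of_coprime ((Nat.coprime_primes (Nat.prime_of_mem_primeFactors hp)
      (Nat.prime_of_mem_primeFactors hp')).2 hne) P hP

lemma ncard_setOf_natCast_mem_eq (i : ℕ) [IsCyclotomicExtension {2 ^ (i + 3)} ℚ K] {d : ℕ}
    (hd : d ≠ 0) (hall : ∀ p : ℕ, p.Prime → p ∣ d → p % 8 = 3 ∨ p % 16 = 9) :
    {P : HeightOneSpectrum (𝓞 K) | (d : 𝓞 K) ∈ P.asIdeal}.ncard =
      4 * {p : ℕ | p.Prime ∧ p ∣ d ∧ p % 16 = 9}.ncard +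
      2 * {p : ℕ | p.Prime ∧ p ∣ d ∧ (p % 8 = 3 ∨ p % 8 = 5)}.ncard := by
  have h1 : {p : ℕ | p.Prime ∧ p ∣ d ∧ p % 16 = 9} =
      (d.primeFactors.filter fun p => ¬ p % 8 = 3 : Finset ℕ) := by
    ext p
    simp only [Set.mem_ofPred_eq, Finset.coe_filter, Nat.mem_primeFactors]
    constructor
    · rintro ⟨hp, hpd, h⟩
      exact ⟨⟨hp, hpd, hd⟩, by omega⟩
    · rintro ⟨⟨hp, hpd, -⟩, h⟩
      have := hall p hp hpd
      exact ⟨hp, hpd, by omega⟩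
  have h2 : {p : ℕ | p.Prime ∧ p ∣ d ∧ (p % 8 = 3 ∨ p % 8 = 5)} =
      (d.primeFactors.filter fun p => p % 8 = 3 : Finset ℕ) := by
    ext p
    simp only [Set.mem_ofPred_eq, Finset.coe_filter, Nat.mem_primeFactors]
    constructor
    · rintro ⟨hp, hpd, h⟩
      have := hall p hp hpd
      exact ⟨⟨hp, hpd, hd⟩, by omega⟩
    · rintro ⟨⟨hp, hpd, -⟩, h⟩
      exact ⟨hp, hpd, Or.inl h⟩
  rw [h1, h2, Set.ncard_coe_finset, Set.ncard_coe_finset, ncard_setOf_natCast_mem hd,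
    ← Finset.sum_filter_not_add_sum_filter _ (fun p => p % 8 = 3)]
  have key : ∀ p ∈ d.primeFactors,
      {P : HeightOneSpectrum (𝓞 K) | (p : 𝓞 K) ∈ P.asIdeal}.ncard =
        if p % 8 = 3 then 2 else 4 := by
    intro p hp
    have h := ncard_primesOver_natCast K i (Nat.prime_of_mem_primeFactors hp)
      (hall p (Nat.prime_of_mem_primeFactors hp) (Nat.dvd_of_mem_primeFactors hp))
    rw [nineExp] at h
    split_ifs at h ⊢ <;> omega
  congr 1
  · rw [Finset.sum_congr rfl (g := fun _ => 4), Finset.sum_const, smul_eq_mul, mul_comm]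
    intro p hp
    rw [Finset.mem_filter] at hp
    rw [key p hp.1, if_neg hp.2]
  · rw [Finset.sum_congr rfl (g := fun _ => 2), Finset.sum_const, smul_eq_mul, mul_comm]
    intro p hp
    rw [Finset.mem_filter] at hp
    rw [key p hp.1, if_pos hp.2]

end PrimesDividing

section ExplicitUnits

lemma IsPrimitiveRoot.pow_two_pow_eq_neg_one {R : Type*} [CommRing R] [IsDomain R] {z : R} {k : ℕ}
    (hz : IsPrimitiveRoot z (2 ^ (k + 1))) : z ^ 2 ^ k = -1 := by
  have h1 : (z ^ 2 ^ k) ^ 2 = 1 := by rw [← pow_mul, ← pow_succ, hz.pow_eq_one]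
  refine (sq_eq_one_iff.1 h1).resolve_left ?_
  exact hz.pow_ne_one_of_pos_of_lt (by positivity) (Nat.pow_lt_pow_right (by norm_num) (by omega))

lemma IsPrimitiveRoot.isUnit_one_add_add_sq {R : Type*} [CommRing R] [IsDomain R] {z : R} {k : ℕ}
    (hz : IsPrimitiveRoot z (2 ^ (k + 1))) : IsUnit (1 + z + z ^ 2) := by
  have h := hz.geom_sum_isUnit (j := 3) (by rw [pow_succ]; have := Nat.two_pow_pos k; omega)
    (Nat.Coprime.pow_right _ (by norm_num))
  simpa [Finset.sum_range_succ] using h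

variable {K : Type*} [Field K] [NumberField K]

omit [NumberField K] in
lemma mem_unitsSqMod_iff_isSquare {P : HeightOneSpectrum (𝓞 K)} {u : (𝓞 K)ˣ} :
    u ∈ unitsSqMod P ↔ IsSquare (Ideal.Quotient.mk P.asIdeal (u : 𝓞 K)) := by
  rw [mem_unitsSqMod]
  constructor
  · rintro ⟨c, hc⟩
    exact ⟨Ideal.Quotient.mk P.asIdeal c, by rw [← sq, ← map_pow]; exact Ideal.Quotient.eq.2 hc⟩
  · rintro ⟨c, hc⟩
    obtain ⟨c, rfl⟩ := Ideal.Quotient.mk_surjective c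
    exact ⟨c, Ideal.Quotient.eq.1 (by rw [hc, map_pow, sq])⟩

omit [NumberField K] in
lemma charP_quotient {p : ℕ} (hp : p.Prime) {P : HeightOneSpectrum (𝓞 K)}
    (hP : (p : 𝓞 K) ∈ P.asIdeal) : CharP (𝓞 K ⧸ P.asIdeal) p := by
  have := P.isPrime
  refine ringChar.of_eq (CharP.ringChar_of_prime_eq_zero hp ?_)
  rw [← map_natCast (Ideal.Quotient.mk P.asIdeal)]
  exact Ideal.Quotient.eq_zero_iff_mem.2 hP

lemma finite_quotient (P : HeightOneSpectrum (𝓞 K)) : Finite (𝓞 K ⧸ P.asIdeal) :=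
  Ideal.finiteQuotientOfFreeOfNeBot _ P.ne_bot

variable {i : ℕ} [IsCyclotomicExtension {2 ^ (i + 3)} ℚ K] {p : ℕ} {P : HeightOneSpectrum (𝓞 K)}
  {z : 𝓞 K}

include i in
lemma root_notMem_unitsSqMod (hp : p.Prime) (h : p % 8 = 3 ∨ p % 16 = 9)
    (hP : (p : 𝓞 K) ∈ P.asIdeal) (hz : IsPrimitiveRoot z (2 ^ (i + 3))) {u : (𝓞 K)ˣ}
    (hu : (u : 𝓞 K) = z) : u ∉ unitsSqMod P := by
  have := P.isMaximal
  let := Ideal.Quotient.field P.asIdeal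
  have := charP_quotient hp hP
  have := finite_quotient P
  rw [mem_unitsSqMod_iff_isSquare, hu]
  refine not_isSquare_root (p := p) (by omega) (pow_nineExp_mod h)
    (natCard_residueField i hp h P hP) ?_
  rw [← map_pow, hz.pow_two_pow_eq_neg_one, map_neg, map_one]

lemma two_pow_quarter_eq_one_of_mod_eight (hp : p.Prime) (h : p % 8 = 3) :
    (2 : ZMod p) ^ (p ^ 2 / 4) = 1 := by
  have := Fact.mk hp
  obtain ⟨c, hc⟩ : ∃ c, p = 8 * c + 3 := ⟨p / 8, by omega⟩
  have h1 : p ^ 2 / 4 = (p - 1) * (2 * c + 1) := by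
    rw [hc, show 8 * c + 3 - 1 = 8 * c + 2 by omega]
    rw [show (8 * c + 3) ^ 2 = 1 + 4 * ((8 * c + 2) * (2 * c + 1)) by ring]
    omega
  have h2 : (2 : ZMod p) ≠ 0 := by
    have : ((2 : ℕ) : ZMod p) ≠ 0 := by
      rw [Ne, ZMod.natCast_eq_zero_iff]
      intro hd
      have := Nat.le_of_dvd (by norm_num) hd
      omega
    exact_mod_cast this
  rw [h1, pow_mul, ZMod.pow_card_sub_one_eq_one h2, one_pow]

include i in
lemma one_add_root_add_sq_mem_unitsSqMod_iff (hp : p.Prime) (h : p % 8 = 3 ∨ p % 16 = 9)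
    (hP : (p : 𝓞 K) ∈ P.asIdeal) (hz : IsPrimitiveRoot z (2 ^ (i + 3))) {u : (𝓞 K)ˣ}
    (hu : (u : 𝓞 K) = 1 + z + z ^ 2) :
    u ∈ unitsSqMod P ↔ (2 : ZMod p) ^ (p ^ nineExp p / 4) = 1 := by
  have := Fact.mk hp
  have := P.isMaximal
  let := Ideal.Quotient.field P.asIdeal
  have := charP_quotient hp hP
  have := finite_quotient P
  have hmk : Ideal.Quotient.mk P.asIdeal (u : 𝓞 K) = 1 + Ideal.Quotient.mk P.asIdeal z +
      Ideal.Quotient.mk P.asIdeal z ^ 2 := by simp [hu]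
  have hne := (u.isUnit.map (Ideal.Quotient.mk P.asIdeal)).ne_zero
  rw [hmk] at hne
  rw [mem_unitsSqMod_iff_isSquare, hmk,
    isSquare_one_add_root_add_sq (p := p) (by omega) (pow_nineExp_mod h) rfl
      (natCard_residueField i hp h P hP)
      (by rw [← map_pow, hz.pow_two_pow_eq_neg_one, map_neg, map_one]) hne,
    ← (ZMod.castHom (dvd_refl p) (𝓞 K ⧸ P.asIdeal)).injective.eq_iff,
    map_pow, map_ofNat, map_one]

lemma two_pow_quarter_sq_eq_one (hp : p.Prime) (h : p % 8 = 1) :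
    ((2 : ZMod p) ^ ((p - 1) / 4)) ^ 2 = 1 := by
  have := Fact.mk hp
  have h2 : p ≠ 2 := by omega
  have hsq : IsSquare (2 : ZMod p) := (ZMod.exists_sq_eq_two_iff h2).2 (Or.inl h)
  have hne : (2 : ZMod p) ≠ 0 := by
    have : ((2 : ℕ) : ZMod p) ≠ 0 := by
      rw [Ne, ZMod.natCast_eq_zero_iff]
      intro hd
      exact h2 ((Nat.prime_dvd_prime_iff_eq hp Nat.prime_two).1 hd)
    exact_mod_cast this
  rw [← pow_mul, show (p - 1) / 4 * 2 = p / 2 by omega]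
  exact (ZMod.euler_criterion p hne).1 hsq

/-- The square class of `1 + ζ + ζ²` modulo a prime is determined by the rational quartic residue
symbol of `2`. -/
lemma two_pow_nineExp_quarter_eq_one_iff (hp : p.Prime) (h : p % 8 = 3 ∨ p % 16 = 9) :
    (2 : ZMod p) ^ (p ^ nineExp p / 4) = 1 ↔
      ¬ (p % 8 = 1 ∧ (2 : ZMod p) ^ ((p - 1) / 4) = -1) := by
  rw [nineExp]
  split_ifs with h3
  · simp only [two_pow_quarter_eq_one_of_mod_eight hp h3, true_iff, not_and]
    omega
  · have h1 : p % 8 = 1 := by omega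
    have := Fact.mk hp
    have : Fact (2 < p) := ⟨by omega⟩
    rw [pow_one, show p / 4 = (p - 1) / 4 by omega]
    rcases sq_eq_one_iff.1 (two_pow_quarter_sq_eq_one hp h1) with h | h
    · simp [h, h1, (ZMod.neg_one_ne_one (n := p)).symm]
    · simp [h, h1, ZMod.neg_one_ne_one]

end ExplicitUnits

section FrobeniusNorm

lemma algebraMap_norm_eq_prod_pow {F K : Type*} [Field F] [Field K] [Algebra F K]
    [FiniteDimensional F K] [IsGalois F K] (τ : Gal(K/F)) (h : orderOf τ = Module.finrank F K)
    (x : K) : algebraMap F K (Algebra.norm F x) = ∏ j ∈ Finset.range (orderOf τ), (τ ^ j) x := by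
  classical
  have hgen : ∀ g : Gal(K/F), g ∈ Subgroup.zpowers τ := by
    intro g
    have : Subgroup.zpowers τ = ⊤ := by
      refine Subgroup.eq_top_of_card_eq _ ?_
      rw [Nat.card_zpowers, h, IsGalois.card_aut_eq_finrank]
    rw [this]; trivial
  rw [Algebra.norm_eq_prod_automorphisms, ← IsCyclic.image_range_orderOf hgen, Finset.prod_image]
  intro a ha b hb hab
  exact pow_injOn_Iio_orderOf (by simpa using ha) (by simpa using hb) hab

variable {F K : Type*} [Field F] [NumberField F] [Field K] [NumberField K] [Algebra F K]

variable (F K) in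
lemma finrank_eq_two_pow (i : ℕ) [IsCyclotomicExtension {2 ^ 3} ℚ F]
    [IsCyclotomicExtension {2 ^ (i + 3)} ℚ K] : Module.finrank F K = 2 ^ i := by
  have h1 := IsCyclotomicExtension.finrank (n := 2 ^ (i + 3)) K
    (Polynomial.cyclotomic.irreducible_rat (by positivity))
  have h2 := IsCyclotomicExtension.finrank (n := 2 ^ 3) F
    (Polynomial.cyclotomic.irreducible_rat (by positivity))
  rw [Nat.totient_prime_pow_succ Nat.prime_two] at h1 h2
  have h3 := Module.finrank_mul_finrank ℚ F K
  rw [h1, h2] at h3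
  norm_num [pow_add] at h3
  omega

variable (F K) in
lemma exists_galois_pow (i : ℕ) [IsCyclotomicExtension {2 ^ 3} ℚ F]
    [IsCyclotomicExtension {2 ^ (i + 3)} ℚ K] {Q : ℕ} (hQ : Q % 16 = 9) :
    ∃ τ : Gal(K/F), (∀ x : K, x ^ 2 ^ (i + 3) = 1 → τ x = x ^ Q) ∧
      orderOf τ = Module.finrank F K := by
  have hcop : Q.Coprime (2 ^ (i + 3)) :=
    Nat.Coprime.pow_right _ (Nat.coprime_two_right.2 (Nat.odd_iff.2 (by omega)))
  let σ := (IsCyclotomicExtension.Rat.galEquivZMod (2 ^ (i + 3)) K).symm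
    (ZMod.unitOfCoprime Q hcop)
  have hσ : ∀ x : K, x ^ 2 ^ (i + 3) = 1 → σ x = x ^ Q := by
    intro x hx
    rw [IsCyclotomicExtension.Rat.galEquivZMod_apply_of_pow_eq (2 ^ (i + 3)) K σ hx,
      MulEquiv.apply_symm_apply, ZMod.coe_unitOfCoprime, ZMod.val_natCast,
      pow_eq_pow_mod Q hx]
  have hF : (σ : K →ₐ[ℚ] K).comp (IsScalarTower.toAlgHom ℚ F K) = IsScalarTower.toAlgHom ℚ F K := by
    have hz := IsCyclotomicExtension.zeta_spec (2 ^ 3) ℚ F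
    refine (hz.powerBasis ℚ).algHom_ext ?_
    have h8 : algebraMap F K (IsCyclotomicExtension.zeta (2 ^ 3) ℚ F) ^ 8 = 1 := by
      rw [← map_pow]; exact (congrArg _ hz.pow_eq_one).trans (map_one _)
    simp only [IsPrimitiveRoot.powerBasis_gen, AlgHom.comp_apply, IsScalarTower.coe_toAlgHom']
    refine (hσ _ (by
      rw [pow_add, mul_comm, pow_mul]; exact (congrArg (· ^ 2 ^ i) h8).trans (one_pow _))).trans ?_
    rw [pow_eq_pow_mod Q h8, show Q % 8 = 1 by omega, pow_one]
  let τ : Gal(K/F) := { σ with commutes' := fun x => DFunLike.congr_fun hF x }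
  refine ⟨τ, hσ, ?_⟩
  have h1 : AlgEquiv.restrictScalarsHom ℚ τ = σ := rfl
  rw [← orderOf_injective (AlgEquiv.restrictScalarsHom ℚ) (AlgEquiv.restrictScalars_injective ℚ) τ,
    h1, finrank_eq_two_pow F K i, MulEquiv.orderOf_eq, ← orderOf_natCast_of_mod_sixteen hQ i,
    ← orderOf_injective _ Units.coeHom_injective]
  rfl

omit [NumberField F] in
lemma mk_galois_eq_pow (i : ℕ) [IsCyclotomicExtension {2 ^ (i + 3)} ℚ K] {p e : ℕ} (hp : p.Prime)
    {P : HeightOneSpectrum (𝓞 K)} (hP : (p : 𝓞 K) ∈ P.asIdeal) (τ : Gal(K/F))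
    (hτ : ∀ x : K, x ^ 2 ^ (i + 3) = 1 → τ x = x ^ p ^ e) (x : 𝓞 K) :
    Ideal.Quotient.mk P.asIdeal (τ • x) = Ideal.Quotient.mk P.asIdeal x ^ p ^ e := by
  have := Fact.mk hp
  have := charP_quotient hp hP
  have hz := IsCyclotomicExtension.zeta_spec (2 ^ (i + 3)) ℚ K
  have h := AlgHom.ext_of_adjoin_eq_top (IsCyclotomicExtension.Rat.adjoin_singleton_eq_top hz)
    (φ₁ := ((Ideal.Quotient.mk P.asIdeal).comp
      (MulSemiringAction.toRingHom _ (𝓞 K) τ)).toIntAlgHom)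
    (φ₂ := ((iterateFrobenius (𝓞 K ⧸ P.asIdeal) p e).comp
      (Ideal.Quotient.mk P.asIdeal)).toIntAlgHom) ?_
  · exact DFunLike.congr_fun h x
  · rintro y rfl
    change Ideal.Quotient.mk P.asIdeal (τ • hz.toInteger) =
      iterateFrobenius (𝓞 K ⧸ P.asIdeal) p e (Ideal.Quotient.mk P.asIdeal hz.toInteger)
    rw [iterateFrobenius_def, ← map_pow]
    congr 1
    apply RingOfIntegers.coe_injective
    exact hτ _ hz.pow_eq_one

end FrobeniusNorm

section EighthRoots

variable {F : Type*} [Field F] [NumberField F] [IsCyclotomicExtension {2 ^ 3} ℚ F]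

lemma exists_involution_neg_root {w : F} (hw : IsPrimitiveRoot w (2 ^ 3)) :
    ∃ σ : Gal(F/ℚ), σ w = -w ∧ ∀ x, σ (σ x) = x := by
  let u : (ZMod (2 ^ 3))ˣ := ZMod.unitOfCoprime 5 (by norm_num)
  have hu : u * u = 1 := by decide
  let σ := (IsCyclotomicExtension.Rat.galEquivZMod (2 ^ 3) F).symm u
  have hσ : σ * σ = 1 := by rw [← map_mul, hu, map_one]
  refine ⟨σ, ?_, fun x => by rw [← AlgEquiv.mul_apply, hσ]; rfl⟩
  rw [IsCyclotomicExtension.Rat.galEquivZMod_apply_of_pow_eq (2 ^ 3) F σ hw.pow_eq_one,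
    MulEquiv.apply_symm_apply]
  have h4 : w ^ 4 = -1 := IsPrimitiveRoot.pow_two_pow_eq_neg_one (k := 2) hw
  change w ^ 5 = -w
  rw [pow_succ, h4, neg_one_mul]

lemma not_isSquare_one_add_add_sq {w : F} (hw : IsPrimitiveRoot w (2 ^ 3)) :
    ¬ IsSquare (1 + w + w ^ 2) := by
  rintro ⟨v, hv⟩
  obtain ⟨σ, hσw, hσσ⟩ := exists_involution_neg_root hw
  have h4 : w ^ 4 = -1 := IsPrimitiveRoot.pow_two_pow_eq_neg_one (k := 2) hw
  have hw0 : w ≠ 0 := hw.ne_zero (by norm_num)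
  have hv0 : v ≠ 0 := by
    rintro rfl
    exact (hw.isUnit_one_add_add_sq (k := 2)).ne_zero (by rw [hv, mul_zero])
  set y := (1 + w) / v with hy
  have hy2 : w * y ^ 2 = 1 + w ^ 2 := by
    rw [hy, div_pow, ← mul_div_assoc, div_eq_iff (pow_ne_zero _ hv0), sq v, ← hv]
    linear_combination -h4
  have hσy : w * (σ y) ^ 2 = -(1 + w ^ 2) := by
    have := congrArg σ hy2
    simp only [map_mul, map_pow, map_add, map_one, hσw] at this
    linear_combination -this
  have hm : (y * σ y) ^ 2 = (w + w ^ 3) ^ 2 := by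
    have : w ^ 2 * ((y * σ y) ^ 2 - (w + w ^ 3) ^ 2) = 0 := by
      linear_combination w * σ y ^ 2 * hy2 + (1 + w ^ 2) * hσy - (1 + w ^ 2) ^ 2 * h4
    rcases mul_eq_zero.1 this with h | h
    · exact absurd h (pow_ne_zero _ hw0)
    · exact sub_eq_zero.1 h
  have hfix : σ (y * σ y) = y * σ y := by rw [map_mul, hσσ, mul_comm]
  have hneg : σ (w + w ^ 3) = -(w + w ^ 3) := by
    rw [map_add, map_pow, hσw]; ring
  have h0 : w + w ^ 3 = 0 := by
    rcases sq_eq_sq_iff_eq_or_eq_neg.1 hm with h | h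
    · rw [h, hneg] at hfix
      exact self_eq_neg.1 hfix.symm
    · rw [h, map_neg, hneg, neg_neg] at hfix
      exact self_eq_neg.1 hfix
  have h2 : (2 : F) = 0 := by linear_combination (w ^ 3 + w) * (-h0) + (2 + w ^ 2) * h4
  norm_num at h2

variable (F) in
lemma index_range_pow_two_units :
    (powMonoidHom 2 : (𝓞 F)ˣ →* (𝓞 F)ˣ).range.index = 4 := by
  have := IsCyclotomicExtension.Rat.isTotallyComplex (n := 2 ^ 3) F (by norm_num)
  have h2 := IsCyclotomicExtension.finrank (n := 2 ^ 3) F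
    (Polynomial.cyclotomic.irreducible_rat (by positivity))
  rw [Nat.totient_prime_pow_succ Nat.prime_two, ← finrank_units_of_isTotallyComplex] at h2
  let e : Additive (⊤ : Subgroup (𝓞 F)ˣ) ≃+ Additive (𝓞 F)ˣ :=
    MulEquiv.toAdditive Subgroup.topEquiv
  have hfin : Module.Finite ℤ (Additive (⊤ : Subgroup (𝓞 F)ˣ)) :=
    Module.Finite.equiv e.symm.toIntLinearEquiv
  have h := relIndex_map_pow_two (⊤ : Subgroup (𝓞 F)ˣ) (-1) trivial
    (fun h => by
      have := congrArg (fun u : (𝓞 F)ˣ => ((u : 𝓞 F) : F)) h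
      norm_num at this) (by simp)
    fun x _ hx => by
      have := congrArg Units.val hx
      rw [Units.val_pow_eq_pow_val, Units.val_one, sq_eq_one_iff] at this
      exact this.imp (fun h => Units.ext h) (fun h => Units.ext h)
  rw [e.toIntLinearEquiv.finrank_eq, Subgroup.relIndex_top_right, ← MonoidHom.range_eq_map] at h
  rw [h, show Module.finrank ℤ (Additive (𝓞 F)ˣ) + 1 = 2 by omega]
  norm_num

end EighthRoots

section UnitsSqModNorm

variable {F K : Type*} [Field F] [NumberField F] [Field K] [NumberField K] [Algebra F K]
  {P : HeightOneSpectrum (𝓞 K)} {p : ℕ} {i : ℕ}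

variable (F K) in
/-- The norm map on units of rings of integers. -/
noncomputable def unitsNorm : (𝓞 K)ˣ →* (𝓞 F)ˣ := Units.map (RingOfIntegers.norm F)

omit [NumberField F] [NumberField K] in
lemma smul_algebraMap_ringOfIntegers (τ : Gal(K/F)) (x : 𝓞 F) :
    τ • algebraMap (𝓞 F) (𝓞 K) x = algebraMap (𝓞 F) (𝓞 K) x :=
  RingOfIntegers.coe_injective (τ.commutes (x : F))

omit [NumberField F] [NumberField K] in
lemma mk_galois_pow_eq_pow {Q : ℕ} {τ : Gal(K/F)}
    (hτ : ∀ x : 𝓞 K, Ideal.Quotient.mk P.asIdeal (τ • x) = Ideal.Quotient.mk P.asIdeal x ^ Q)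
    (j : ℕ) (x : 𝓞 K) :
    Ideal.Quotient.mk P.asIdeal (τ ^ j • x) = Ideal.Quotient.mk P.asIdeal x ^ Q ^ j := by
  induction j with
  | zero => simp
  | succ j ih => rw [pow_succ', mul_smul, hτ, ih, ← pow_mul, ← pow_succ]

lemma algebraMap_unitsNorm_eq_prod [IsGalois F K] (τ : Gal(K/F))
    (h : orderOf τ = Module.finrank F K) (u : (𝓞 K)ˣ) :
    algebraMap (𝓞 F) (𝓞 K) (unitsNorm F K u) =
      ∏ j ∈ Finset.range (orderOf τ), τ ^ j • (u : 𝓞 K) := by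
  apply RingOfIntegers.coe_injective
  rw [map_prod]
  exact algebraMap_norm_eq_prod_pow τ h (u : K)

/-- At a prime above `p`, a unit of `K` is a square in the residue field exactly when its norm to
the eighth cyclotomic field `F` satisfies a condition that holds for all squares. -/
lemma exists_unitsSqMod_eq_comap (i : ℕ) [IsCyclotomicExtension {2 ^ 3} ℚ F]
    [IsCyclotomicExtension {2 ^ (i + 3)} ℚ K] (hp : p.Prime) (h : p % 8 = 3 ∨ p % 16 = 9)
    (hP : (p : 𝓞 K) ∈ P.asIdeal) :
    ∃ T : Subgroup (𝓞 F)ˣ, (powMonoidHom 2 : (𝓞 F)ˣ →* (𝓞 F)ˣ).range ≤ T ∧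
      unitsSqMod P = T.comap (unitsNorm F K) := by
  have : IsGalois ℚ K := IsCyclotomicExtension.isGalois {2 ^ (i + 3)} ℚ K
  have : IsGalois F K := IsGalois.tower_top_of_isGalois ℚ F K
  have := P.isMaximal
  let := Ideal.Quotient.field P.asIdeal
  have := charP_quotient hp hP
  have := finite_quotient P
  obtain ⟨τ, hτ, hord⟩ := exists_galois_pow F K i (pow_nineExp_mod h)
  have hmk := mk_galois_eq_pow i hp hP τ hτ
  have hcard := natCard_residueField i hp h P hP
  have hQ := pow_nineExp_mod h
  generalize p ^ nineExp p = Q at hmk hcard hQ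
  let φ : (𝓞 F)ˣ →* (𝓞 K ⧸ P.asIdeal)ˣ :=
    Units.map ((Ideal.Quotient.mk P.asIdeal).comp (algebraMap (𝓞 F) (𝓞 K))).toMonoidHom
  refine ⟨((powMonoidHom (Q / 2)).comp φ).ker, ?_, ?_⟩
  · rintro _ ⟨v, rfl⟩
    have h1 : φ v ^ Q = φ v := by
      ext
      refine (hmk (algebraMap (𝓞 F) (𝓞 K) (v : 𝓞 F))).symm.trans ?_
      rw [smul_algebraMap_ringOfIntegers]
      rfl
    rw [MonoidHom.mem_ker, MonoidHom.comp_apply, powMonoidHom_apply, powMonoidHom_apply,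
      map_pow, ← pow_mul]
    have h2 : φ v ^ (2 * (Q / 2)) * φ v = 1 * φ v := by
      rw [← pow_succ, one_mul, show 2 * (Q / 2) + 1 = Q by omega, h1]
    exact mul_right_cancel h2
  · ext u
    rw [mem_unitsSqMod_iff_isSquare, isSquare_iff_prod_pow (p := p) (by omega) hQ
      hcard (u.isUnit.map (Ideal.Quotient.mk P.asIdeal)).ne_zero,
      Subgroup.mem_comap, MonoidHom.mem_ker, ← Units.val_inj]
    have h1 : ((φ (unitsNorm F K u) : (𝓞 K ⧸ P.asIdeal)ˣ) : 𝓞 K ⧸ P.asIdeal) =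
        ∏ j ∈ Finset.range (2 ^ i), Ideal.Quotient.mk P.asIdeal (u : 𝓞 K) ^ Q ^ j := by
      change Ideal.Quotient.mk P.asIdeal (algebraMap (𝓞 F) (𝓞 K) (unitsNorm F K u)) = _
      rw [algebraMap_unitsNorm_eq_prod τ hord, map_prod, hord, finrank_eq_two_pow F K i]
      exact Finset.prod_congr rfl fun j _ => mk_galois_pow_eq_pow hmk j _
    rw [← h1, MonoidHom.comp_apply, powMonoidHom_apply, Units.val_pow_eq_pow_val, Units.val_one]

omit [NumberField F] [NumberField K] in
lemma galois_pow_root {Q : ℕ} {τ : Gal(K/F)} {z : 𝓞 K} (h : τ • z = z ^ Q) (j : ℕ) :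
    τ ^ j • z = z ^ Q ^ j := by
  induction j with
  | zero => simp
  | succ j ih => rw [pow_succ', mul_smul, ih, smul_pow', h, ← pow_mul, ← pow_succ']

/-- The norm of `1 + ζ + ζ²` to the eighth cyclotomic field is not a square. -/
lemma unitsNorm_one_add_root_add_sq_notMem_range (i : ℕ) [IsCyclotomicExtension {2 ^ 3} ℚ F]
    [IsCyclotomicExtension {2 ^ (i + 3)} ℚ K] {z : 𝓞 K} (hz : IsPrimitiveRoot z (2 ^ (i + 3)))
    {u : (𝓞 K)ˣ} (hu : (u : 𝓞 K) = 1 + z + z ^ 2) :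
    unitsNorm F K u ∉ (powMonoidHom 2 : (𝓞 F)ˣ →* (𝓞 F)ˣ).range := by
  have : IsGalois ℚ K := IsCyclotomicExtension.isGalois {2 ^ (i + 3)} ℚ K
  have : IsGalois F K := IsGalois.tower_top_of_isGalois ℚ F K
  obtain ⟨τ, hτ, hord⟩ := exists_galois_pow F K i (Q := 9) rfl
  have hτz : τ • z = z ^ 9 := RingOfIntegers.coe_injective (by
    refine (hτ (z : K) ?_).trans (map_pow (algebraMap (𝓞 K) K) z 9).symm
    have := congrArg (algebraMap (𝓞 K) K) hz.pow_eq_one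
    rwa [map_pow, map_one] at this)
  have hnorm : algebraMap (𝓞 F) (𝓞 K) (unitsNorm F K u) =
      1 + z ^ 2 ^ i + (z ^ 2 ^ i) ^ 2 := by
    rw [algebraMap_unitsNorm_eq_prod τ hord, hord, finrank_eq_two_pow F K i,
      ← prod_one_add_pow_add_sq (Q := 9) rfl i z hz.pow_two_pow_eq_neg_one]
    refine Finset.prod_congr rfl fun j _ => ?_
    rw [hu, smul_add, smul_add, smul_one, smul_pow', galois_pow_root hτz]
  have hz8 : IsPrimitiveRoot ((z ^ 2 ^ i : 𝓞 K) : K) (2 ^ 3) := by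
    have h1 : IsPrimitiveRoot (z ^ 2 ^ i) (2 ^ 3) := hz.pow (by positivity) (by rw [pow_add])
    exact h1.map_of_injective RingOfIntegers.coe_injective
  have hw0 := IsCyclotomicExtension.zeta_spec (2 ^ 3) ℚ F
  have hw0K : IsPrimitiveRoot (algebraMap F K (IsCyclotomicExtension.zeta (2 ^ 3) ℚ F)) (2 ^ 3) :=
    hw0.map_of_injective (algebraMap F K).injective
  obtain ⟨k, -, hcop, hk⟩ := (hw0K.isPrimitiveRoot_iff).1 hz8
  have hw := hw0.pow_of_coprime k hcop
  rintro ⟨v, hv⟩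
  refine not_isSquare_one_add_add_sq hw ⟨(v : F), (algebraMap F K).injective ?_⟩
  have h1 : algebraMap (𝓞 F) (𝓞 K) ((v : 𝓞 F) ^ 2) = 1 + z ^ 2 ^ i + (z ^ 2 ^ i) ^ 2 := by
    rw [← hnorm, ← hv]; rfl
  have h2 := congrArg (algebraMap (𝓞 K) K) h1
  rw [map_add, map_add, map_one, map_pow (algebraMap (𝓞 K) K) (z ^ 2 ^ i)] at h2
  have h3 : algebraMap (𝓞 K) K (z ^ 2 ^ i) =
    algebraMap F K (IsCyclotomicExtension.zeta (2 ^ 3) ℚ F ^ k) :=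
      hk.symm.trans (map_pow _ _ _).symm
  rw [h3, ← map_pow, ← (algebraMap F K).map_one, ← map_add, ← map_add] at h2
  rw [← h2, ← sq]
  rfl

end UnitsSqModNorm

section IndexOfInf

variable {G H ι : Type*} [Group G] [CommGroup H] {f : G →* H} {S : Subgroup H}
  {U : ι → Subgroup G}

lemma exists_iInf_eq_comap (hU : ∀ j, ∃ T, S ≤ T ∧ U j = T.comap f) :
    ∃ T, S ≤ T ∧ (∀ x, (∀ j, x ∈ U j) → f x ∈ T) ∧ (⨅ j, U j).index ∣ T.index := by
  choose T hST hT using hU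
  refine ⟨⨅ j, T j, le_iInf hST, fun x hx => ?_, ?_⟩
  · exact Subgroup.mem_iInf.2 fun j => by have := hx j; rwa [hT j] at this
  · rw [iInf_congr hT, ← Subgroup.comap_iInf, Subgroup.index_comap]
    exact Subgroup.relIndex_dvd_index_of_normal _ _

lemma index_iInf_eq_two (hS : S.index = 4) (hU : ∀ j, ∃ T, S ≤ T ∧ U j = T.comap f) [Nonempty ι]
    {z θ : G} (hz : ∀ j, z ∉ U j) (hθ : ∀ j, θ ∈ U j) (hfθ : f θ ∉ S) : (⨅ j, U j).index = 2 := by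
  obtain ⟨T, hST, hT, hdvd⟩ := exists_iInf_eq_comap hU
  have h1 := Subgroup.relIndex_mul_index hST
  rw [hS] at h1
  have h2 : S.relIndex T ≠ 1 := fun h => hfθ (Subgroup.relIndex_eq_one.1 h (hT θ hθ))
  have h3 : (⨅ j, U j).index ≠ 1 := fun h => by
    have h5 : z ∈ ⨅ j, U j := by rw [Subgroup.index_eq_one.1 h]; trivial
    exact hz (Classical.arbitrary ι) (Subgroup.mem_iInf.1 h5 _)
  have h4 : T.index ∣ 2 := by
    have h5 : T.index ≤ 4 := Nat.le_of_dvd (by norm_num) ⟨_, h1.symm.trans (mul_comm _ _)⟩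
    interval_cases T.index <;> omega
  exact ((Nat.dvd_prime Nat.prime_two).1 (hdvd.trans h4)).resolve_left h3

lemma index_iInf_eq_four (hS : S.index = 4) (hU : ∀ j, ∃ T, S ≤ T ∧ U j = T.comap f)
    {z θ : G} (hz : ∀ j, z ∉ U j) {j₀ j₁ : ι} (h₀ : θ ∈ U j₀) (h₁ : θ ∉ U j₁) :
    (⨅ j, U j).index = 4 := by
  obtain ⟨T, hST, -, hdvd⟩ := exists_iInf_eq_comap hU
  have h1 : (⨅ j, U j).index ∣ 2 ^ 2 :=
    (hdvd.trans (Subgroup.index_dvd_of_le hST)).trans (by rw [hS]; norm_num)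
  have h2 := Subgroup.relIndex_mul_index (iInf_le U j₀)
  have h3 : (U j₀).index ≠ 1 := fun h => hz j₀ (by rw [Subgroup.index_eq_one.1 h]; trivial)
  have h4 : (⨅ j, U j).relIndex (U j₀) ≠ 1 := fun h =>
    h₁ (Subgroup.mem_iInf.1 (Subgroup.relIndex_eq_one.1 h h₀) j₁)
  obtain ⟨k, hk, hk'⟩ := (Nat.dvd_prime_pow Nat.prime_two).1 h1
  rw [hk'] at h2 ⊢
  interval_cases k
  · exact absurd (Nat.eq_one_of_mul_eq_one_left h2) h3
  · rcases (Nat.dvd_prime Nat.prime_two).1 ⟨_, h2.symm.trans (mul_comm _ _)⟩ with h | h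
    · exact absurd h h3
    · exact absurd (Nat.eq_of_mul_eq_mul_right two_pos ((h ▸ h2).trans (one_mul 2).symm)) h4
  · rfl

end IndexOfInf

section NormUnitsIndex

variable (F : Type*) {K : Type*} [Field F] [NumberField F] [Field K] [NumberField K] [Algebra F K]
  {i d : ℕ} [IsCyclotomicExtension {2 ^ 3} ℚ F] [IsCyclotomicExtension {2 ^ (i + 3)} ℚ K] {δ : Kˣ}

omit [IsCyclotomicExtension {2 ^ (i + 3)} ℚ K] in
lemma exists_prime_mem (i : ℕ) [IsCyclotomicExtension {2 ^ (i + 3)} ℚ K] {p : ℕ} (hp : p.Prime)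
    (h : p % 8 = 3 ∨ p % 16 = 9) : ∃ P : HeightOneSpectrum (𝓞 K), (p : 𝓞 K) ∈ P.asIdeal := by
  by_contra! hne
  have h1 := ncard_primesOver_natCast (K := K) i hp h
  have h2 : {P : HeightOneSpectrum (𝓞 K) | (p : 𝓞 K) ∈ P.asIdeal} = ∅ :=
    Set.eq_empty_iff_forall_notMem.2 fun P hP => hne P hP
  rw [h2, Set.ncard_empty, zero_mul] at h1
  omega

omit [NumberField K] [IsCyclotomicExtension {2 ^ (i + 3)} ℚ K] in
lemma natCast_mem_of_dvd {p : ℕ} (hpd : p ∣ d) {P : HeightOneSpectrum (𝓞 K)}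
    (hP : (p : 𝓞 K) ∈ P.asIdeal) : (d : 𝓞 K) ∈ P.asIdeal := by
  obtain ⟨c, rfl⟩ := hpd
  rw [Nat.cast_mul]
  exact P.asIdeal.mul_mem_right _ hP

include i in
lemma normUnits_natCast_eq_iInf (hsf : Squarefree d)
    (hall : ∀ p, p.Prime → p ∣ d → p % 8 = 3 ∨ p % 16 = 9) (hδ : (δ : K) = d) :
    normUnits (δ : K) =
      ⨅ P : {P : HeightOneSpectrum (𝓞 K) // (d : 𝓞 K) ∈ P.asIdeal}, unitsSqMod P.1 := by
  have hr : ((d : 𝓞 K) : K) = δ := by rw [hδ]; exact map_natCast _ _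
  have hmem := fun P => elemOrd_ne_zero_iff P hr
  have hz := (IsCyclotomicExtension.zeta_spec (2 ^ (i + 3)) ℚ K).toInteger_isPrimitiveRoot
  ext u
  rw [mem_normUnits_iff (n := i + 3) (by omega) hr, Subgroup.mem_iInf]
  · simp only [hmem, Subtype.forall]
  · intro P hP
    rw [elemOrd_natCast_squarefree i hsf hall P ((hmem P).1 hP) hδ]
    exact odd_one
  · intro P hP htop
    obtain ⟨p, hp, hpd, hpP⟩ := exists_prime_dvd_mem hsf.ne_zero P ((hmem P).1 hP)
    refine root_notMem_unitsSqMod (i := i) hp (hall p hp hpd) hpP hz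
      (u := (hz.isUnit (by positivity)).unit) rfl ?_
    rw [htop]
    trivial

variable (hsf : Squarefree d) (hall : ∀ p, p.Prime → p ∣ d → p % 8 = 3 ∨ p % 16 = 9)
  (hp3 : ∃ p, p.Prime ∧ p ∣ d ∧ p % 8 = 3) (hδ : (δ : K) = d)
include F i hsf hall hp3 hδ

theorem index_normUnits_of_exists (h : ∃ p : ℕ, p.Prime ∧ p ∣ d ∧ p % 8 = 1 ∧
    (2 : ZMod p) ^ ((p - 1) / 4) = -1) : (normUnits (δ : K)).index = 4 := by
  have hz := (IsCyclotomicExtension.zeta_spec (2 ^ (i + 3)) ℚ K).toInteger_isPrimitiveRoot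
  rw [normUnits_natCast_eq_iInf (i := i) hsf hall hδ]
  obtain ⟨p₀, hp₀, hd₀, h₀⟩ := hp3
  obtain ⟨p₁, hp₁, hd₁, h₁⟩ := h
  obtain ⟨P₀, hP₀⟩ := exists_prime_mem (K := K) i hp₀ (hall p₀ hp₀ hd₀)
  obtain ⟨P₁, hP₁⟩ := exists_prime_mem (K := K) i hp₁ (hall p₁ hp₁ hd₁)
  refine index_iInf_eq_four (f := unitsNorm F K) (index_range_pow_two_units F)
    (θ := (hz.isUnit_one_add_add_sq (k := i + 2)).unit)
    (z := (hz.isUnit (by positivity)).unit)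
    (j₀ := ⟨P₀, natCast_mem_of_dvd hd₀ hP₀⟩) (j₁ := ⟨P₁, natCast_mem_of_dvd hd₁ hP₁⟩) ?_ ?_ ?_ ?_
  · rintro ⟨P, hP⟩
    obtain ⟨p, hp, hpd, hpP⟩ := exists_prime_dvd_mem hsf.ne_zero P hP
    exact exists_unitsSqMod_eq_comap i hp (hall p hp hpd) hpP
  · rintro ⟨P, hP⟩
    obtain ⟨p, hp, hpd, hpP⟩ := exists_prime_dvd_mem hsf.ne_zero P hP
    exact root_notMem_unitsSqMod (i := i) hp (hall p hp hpd) hpP hz (IsUnit.unit_spec _)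
  · rw [one_add_root_add_sq_mem_unitsSqMod_iff (i := i) hp₀ (hall p₀ hp₀ hd₀) hP₀ hz
        (IsUnit.unit_spec _),
      two_pow_nineExp_quarter_eq_one_iff hp₀ (hall p₀ hp₀ hd₀)]
    omega
  · rw [one_add_root_add_sq_mem_unitsSqMod_iff (i := i) hp₁ (hall p₁ hp₁ hd₁) hP₁ hz
        (IsUnit.unit_spec _),
      two_pow_nineExp_quarter_eq_one_iff hp₁ (hall p₁ hp₁ hd₁)]
    exact not_not.2 h₁

theorem index_normUnits_of_forall (h : ¬ ∃ p : ℕ, p.Prime ∧ p ∣ d ∧ p % 8 = 1 ∧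
    (2 : ZMod p) ^ ((p - 1) / 4) = -1) : (normUnits (δ : K)).index = 2 := by
  have hz := (IsCyclotomicExtension.zeta_spec (2 ^ (i + 3)) ℚ K).toInteger_isPrimitiveRoot
  rw [normUnits_natCast_eq_iInf (i := i) hsf hall hδ]
  obtain ⟨p₀, hp₀, hd₀, h₀⟩ := hp3
  obtain ⟨P₀, hP₀⟩ := exists_prime_mem (K := K) i hp₀ (hall p₀ hp₀ hd₀)
  have : Nonempty {P : HeightOneSpectrum (𝓞 K) // (d : 𝓞 K) ∈ P.asIdeal} :=
    ⟨P₀, natCast_mem_of_dvd hd₀ hP₀⟩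
  refine index_iInf_eq_two (f := unitsNorm F K) (index_range_pow_two_units F)
    (θ := (hz.isUnit_one_add_add_sq (k := i + 2)).unit)
    (z := (hz.isUnit (by positivity)).unit) ?_ ?_ ?_ ?_
  · rintro ⟨P, hP⟩
    obtain ⟨p, hp, hpd, hpP⟩ := exists_prime_dvd_mem hsf.ne_zero P hP
    exact exists_unitsSqMod_eq_comap i hp (hall p hp hpd) hpP
  · rintro ⟨P, hP⟩
    obtain ⟨p, hp, hpd, hpP⟩ := exists_prime_dvd_mem hsf.ne_zero P hP
    exact root_notMem_unitsSqMod (i := i) hp (hall p hp hpd) hpP hz (IsUnit.unit_spec _)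
  · rintro ⟨P, hP⟩
    obtain ⟨p, hp, hpd, hpP⟩ := exists_prime_dvd_mem hsf.ne_zero P hP
    rw [one_add_root_add_sq_mem_unitsSqMod_iff (i := i) hp (hall p hp hpd) hpP hz
        (IsUnit.unit_spec _),
      two_pow_nineExp_quarter_eq_one_iff hp (hall p hp hpd)]
    exact fun h₁ => h ⟨p, hp, hpd, h₁⟩
  · exact unitsNorm_one_add_root_add_sq_notMem_range i hz (IsUnit.unit_spec _)

end NormUnitsIndex

section CyclotomicQuadratic

variable {K : Type*} [Field K] [NumberField K] {i d : ℕ} [IsCyclotomicExtension {2 ^ (i + 3)} ℚ K]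

include i in
/-- An odd integer is congruent to a square modulo `4` in a cyclotomic field containing `√-1`. -/
lemma exists_sq_sub_natCast_eq_four_mul (hd : Odd d) :
    ∃ a c : 𝓞 K, a ^ 2 - (d : 𝓞 K) = 4 * c := by
  have hz := (IsCyclotomicExtension.zeta_spec (2 ^ (i + 3)) ℚ K).toInteger_isPrimitiveRoot
  have hI := hz.pow_two_pow_eq_neg_one (k := i + 2)
  rw [Nat.odd_iff] at hd
  rcases (by omega : d % 4 = 1 ∨ d % 4 = 3) with h | h
  · refine ⟨1, -((d / 4 : ℕ) : 𝓞 K), ?_⟩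
    have h1 : ((4 * (d / 4) + 1 : ℕ) : 𝓞 K) = d := congrArg _ (by omega)
    push_cast at h1
    linear_combination h1
  · rw [pow_succ 2 (i + 1), pow_mul] at hI
    refine ⟨_, -((d / 4 + 1 : ℕ) : 𝓞 K), (congrArg (· - (d : 𝓞 K)) hI).trans ?_⟩
    have h1 : ((4 * (d / 4) + 3 : ℕ) : 𝓞 K) = d := congrArg _ (by omega)
    push_cast at h1 ⊢
    linear_combination h1

include i in
lemma not_isSquare_natCast (hsf : Squarefree d)
    (hall : ∀ p, p.Prime → p ∣ d → p % 8 = 3 ∨ p % 16 = 9) {p : ℕ} (hp : p.Prime) (hpd : p ∣ d) :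
    ¬ IsSquare (d : K) := by
  rintro ⟨b, hb⟩
  have hd0 : (d : K) ≠ 0 := by exact_mod_cast hsf.ne_zero
  have hb0 : b ≠ 0 := by rintro rfl; exact hd0 (by rw [hb, mul_zero])
  obtain ⟨P, hP⟩ := exists_prime_mem (K := K) i hp (hall p hp hpd)
  have h1 := elemOrd_natCast_squarefree i hsf hall P (natCast_mem_of_dvd hpd hP)
    (x := Units.mk0 b hb0 * Units.mk0 b hb0) hb.symm
  rw [elemOrd_mul] at h1
  omega

include i in
lemma IsSqrtExt.two_mul_classSquareIndex_mul_index {L : Type*} [Field L] [NumberField L]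
    [Algebra K L] {s : L} (h : IsSqrtExt (d : K) s) (hodd : Odd d) (hsf : Squarefree d)
    (hall : ∀ p, p.Prime → p ∣ d → p % 8 = 3 ∨ p % 16 = 9) :
    2 * classSquareIndex L * (normUnits (d : K)).index =
      2 ^ (4 * {p : ℕ | p.Prime ∧ p ∣ d ∧ p % 16 = 9}.ncard +
        2 * {p : ℕ | p.Prime ∧ p ∣ d ∧ (p % 8 = 3 ∨ p % 8 = 5)}.ncard) := by
  have := h.isGalois
  have : IsTotallyComplex K := IsCyclotomicExtension.Rat.isTotallyComplex (n := 2 ^ (i + 3)) K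
    (by rw [pow_add]; have := Nat.two_pow_pos i; omega)
  have hd0 : (d : K) ≠ 0 := by exact_mod_cast hsf.ne_zero
  have hcoe : ((d : 𝓞 K) : K) = d := map_natCast _ _
  obtain ⟨a, c, hac⟩ := exists_sq_sub_natCast_eq_four_mul (K := K) (i := i) hodd
  have hmaps : ∀ v ∈ ramSet K L,
      underPrime K v ∈ {P : HeightOneSpectrum (𝓞 K) | (d : 𝓞 K) ∈ P.asIdeal} := fun v hv =>
    mem_of_sq_sub_eq_of_mem_ramSet (by rwa [hcoe]) hv a c hac
  have hfin := ramSet_finite_of_maps h.finrank_eq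
    (finite_setOf_mem (by exact_mod_cast hsf.ne_zero)) hmaps
  rw [h.classSquareIndex_mul_index (odd_classNumber_two_pow (i + 3) (by omega)) hfin,
    ncard_ramSet_eq h.finrank_eq hmaps (δ := Units.mk0 _ hd0) h.sq_eq,
    ncard_setOf_natCast_mem_eq i hsf.ne_zero hall]
  intro P hP
  rw [elemOrd_natCast_squarefree i hsf hall P hP rfl]
  exact odd_one

end CyclotomicQuadratic

section Rank

lemma Subgroup.closure_setOf_sq_eq_range (G : Type*) [CommGroup G] :
    Subgroup.closure {x : G | ∃ y, x = y ^ 2} = (powMonoidHom 2 : G →* G).range := by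
  refine (congrArg Subgroup.closure ?_).trans (Subgroup.closure_eq _)
  ext x
  exact exists_congr fun y => eq_comm

lemma rank2_eq_of_classSquareIndex {L : Type*} [Field L] [NumberField L] {t k : ℕ} (hk : k + 1 ≤ t)
    (h : 2 * classSquareIndex L * 2 ^ k = 2 ^ t) : rank2 L = t - (k + 1) := by
  obtain ⟨m, rfl⟩ := Nat.exists_eq_add_of_le hk
  have h1 : classSquareIndex L = 2 ^ m := by
    have : (2 * 2 ^ k) * classSquareIndex L = (2 * 2 ^ k) * 2 ^ m := by
      rw [pow_add, pow_add] at h; linarith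
    exact Nat.eq_of_mul_eq_mul_left (by positivity) this
  rw [rank2, Subgroup.closure_setOf_sq_eq_range, ← Subgroup.index_eq_card, Nat.add_sub_cancel_left]
  exact (congrArg (Nat.log 2) h1).trans (Nat.log_pow Nat.one_lt_two m)

lemma add_one_le_of_two_mul_mul_eq {a k t : ℕ} (h : 2 * a * 2 ^ k = 2 ^ t) : k + 1 ≤ t :=
  (Nat.pow_dvd_pow_iff_le_right Nat.one_lt_two).1 ⟨a, by rw [← h, pow_succ]; ring⟩

end Rank

section Main

variable {L : Type*} [Field L] [NumberField L]

lemma isSqrtExt_adjoin {ζ s : L} (hL : IntermediateField.adjoin ℚ {ζ, s} = ⊤) {d : ℕ}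
    (hs : s ^ 2 = (d : L)) (hd : ¬ IsSquare (d : ℚ⟮ζ⟯)) : IsSqrtExt (d : ℚ⟮ζ⟯) s where
  sq_eq := by rw [hs, map_natCast]
  not_isSquare := hd
  adjoin_eq := by
    rw [← IntermediateField.restrictScalars_eq_top_iff (K := ℚ)]
    exact (IntermediateField.adjoin_simple_adjoin_simple ℚ ζ s).trans hL

end Main

/-- Theorem 3.1(2): for n ≥ 3 and d > 2 odd composite square-free with all prime
divisors ≡ ±3 (mod 8) or ≡ 9 (mod 16), some prime divisor ≡ 3 (mod 8) and no prime
divisor ≡ 5 (mod 8): rank₂(Cl(Q(ζ_{2^n}, √d))) = t − 3 if some prime p ≡ 1 (mod 8)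
dividing d has (2/p)₄ = −1, and = t − 2 otherwise. -/
theorem stmt_17 (n : ℕ) (hn : 3 ≤ n) (d : ℕ) (hd2 : 2 < d) (hodd : Odd d)
    (hsf : Squarefree d) (hcomp : ¬ d.Prime)
    (hall : ∀ p : ℕ, p.Prime → p ∣ d → (p % 8 = 3 ∨ p % 8 = 5 ∨ p % 16 = 9))
    (hp3 : ∃ p : ℕ, p.Prime ∧ p ∣ d ∧ p % 8 = 3)
    (hno5 : ∀ p : ℕ, p.Prime → p ∣ d → p % 8 ≠ 5)
    (r q t : ℕ)
    (hr : r = {p : ℕ | p.Prime ∧ p ∣ d ∧ (p % 8 = 3 ∨ p % 8 = 5)}.ncard)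
    (hq : q = {p : ℕ | p.Prime ∧ p ∣ d ∧ p % 16 = 9}.ncard)
    (ht : t = 4 * q + 2 * r)
    (L : Type*) [Field L] [NumberField L] (ζ s : L)
    (hζ : IsPrimitiveRoot ζ (2 ^ n)) (hs : s ^ 2 = (d : L))
    (hL : IntermediateField.adjoin ℚ {ζ, s} = ⊤) :
    ((∃ p : ℕ, p.Prime ∧ p ∣ d ∧ p % 8 = 1 ∧ (2 : ZMod p) ^ ((p - 1) / 4) = -1) →
        rank2 L = t - 3) ∧
    (¬ (∃ p : ℕ, p.Prime ∧ p ∣ d ∧ p % 8 = 1 ∧ (2 : ZMod p) ^ ((p - 1) / 4) = -1) →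
        rank2 L = t - 2) := by
  obtain ⟨i, rfl⟩ := Nat.exists_eq_add_of_le' hn
  have hall' : ∀ p, p.Prime → p ∣ d → p % 8 = 3 ∨ p % 16 = 9 := fun p hp hpd => by
    rcases hall p hp hpd with h | h | h
    · exact Or.inl h
    · exact absurd h (hno5 p hp hpd)
    · exact Or.inr h
  let K : IntermediateField ℚ L := IntermediateField.adjoin ℚ {ζ}
  have : IsCyclotomicExtension {2 ^ (i + 3)} ℚ K :=
    hζ.intermediateField_adjoin_isCyclotomicExtension ℚ
  obtain ⟨w, hw⟩ : ∃ w : K, IsPrimitiveRoot w (2 ^ 3) :=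
    ⟨_, (IsCyclotomicExtension.zeta_spec (2 ^ (i + 3)) ℚ K).pow (by positivity)
      (pow_add 2 i 3)⟩
  let F : IntermediateField ℚ K := IntermediateField.adjoin ℚ {w}
  have : IsCyclotomicExtension {2 ^ 3} ℚ F :=
    hw.intermediateField_adjoin_isCyclotomicExtension ℚ
  have hd : ¬ IsSquare (d : K) := by
    obtain ⟨p, hp, hpd, -⟩ := hp3
    exact not_isSquare_natCast (i := i) hsf hall' hp hpd
  have hδ : ((Units.mk0 (d : K) (by exact_mod_cast hsf.ne_zero) : Kˣ) : K) = d := rfl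
  have hmain := (isSqrtExt_adjoin hL hs hd).two_mul_classSquareIndex_mul_index (i := i)
    hodd hsf hall'
  rw [← hq, ← hr, ← ht, ← hδ] at hmain
  constructor
  · intro h
    rw [index_normUnits_of_exists F (i := i) hsf hall' hp3 hδ h, show 4 = 2 ^ 2 from rfl] at hmain
    exact rank2_eq_of_classSquareIndex (add_one_le_of_two_mul_mul_eq hmain) hmain
  · intro h
    rw [index_normUnits_of_forall F (i := i) hsf hall' hp3 hδ h] at hmain
    replace hmain : 2 * classSquareIndex L * 2 ^ 1 = 2 ^ t := by rwa [pow_one]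
    exact rank2_eq_of_classSquareIndex (add_one_le_of_two_mul_mul_eq hmain) hmain
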